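/- arXiv:1908.10724 — 2 statements merged into one kernel-verified Lean document; each statement's English description precedes it below -/
import Mathlib

section
/- For every ζ ∈ C_c(ℝⁿ), the functional Z : Conv_sc(ℝⁿ) → ℝ defined by Z(u) = ∫_{dom(u)} ζ(∇u(x)) dx is a well-defined, continuous and epi-translation invariant valuation on Conv_sc(ℝⁿ) that is epi-homogeneous of degree n. -/
open Filter Topology MeasureTheory

noncomputable section

/-- Euclidean space `ℝⁿ`. -/
abbrev Vn (n : ℕ) := EuclideanSpace ℝ (Fin n)

/-- `u : ℝⁿ → ℝ ∪ {+∞}` (represented as an `EReal`-valued function that never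
takes the value `⊥ = -∞`) is convex. -/
def IsConvexFn {n : ℕ} (u : Vn n → EReal) : Prop :=
  ∀ x y : Vn n, ∀ t : ℝ, 0 < t → t < 1 →
    u (t • x + (1 - t) • y) ≤ (t : EReal) * u x + ((1 - t : ℝ) : EReal) * u y

/-- `Conv(ℝⁿ)`: convex, lower semicontinuous, proper functions
`ℝⁿ → ℝ ∪ {+∞}`. -/
def ConvSet (n : ℕ) : Set (Vn n → EReal) :=
  {u | IsConvexFn u ∧ LowerSemicontinuous u ∧ (∀ x, u x ≠ ⊥) ∧ (∃ x, u x ≠ ⊤)}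

/-- `Conv_sc(ℝⁿ)`: super-coercive elements of `Conv(ℝⁿ)`, i.e.
`u(x)/|x| → +∞` as `|x| → +∞`. -/
def ConvSc (n : ℕ) : Set (Vn n → EReal) :=
  {u | u ∈ ConvSet n ∧
    ∀ M : ℝ, ∃ R : ℝ, ∀ x : Vn n, R ≤ ‖x‖ → ((M * ‖x‖ : ℝ) : EReal) ≤ u x}

/-- Epi-convergence of a sequence `uk` to `u`. -/
def EpiConverges {n : ℕ} (uk : ℕ → Vn n → EReal) (u : Vn n → EReal) : Prop :=
  ∀ x : Vn n,
    (∀ xk : ℕ → Vn n, Tendsto xk atTop (𝓝 x) →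
      u x ≤ liminf (fun k => uk k (xk k)) atTop) ∧
    (∃ xk : ℕ → Vn n, Tendsto xk atTop (𝓝 x) ∧
      Tendsto (fun k => uk k (xk k)) atTop (𝓝 (u x)))

/-- Continuity (with respect to epi-convergence) of a functional on a class `X`. -/
def ContinuousVal {n : ℕ} (X : Set (Vn n → EReal)) (Z : (Vn n → EReal) → ℝ) : Prop :=
  ∀ (uk : ℕ → Vn n → EReal) (u : Vn n → EReal),
    (∀ k, uk k ∈ X) → u ∈ X → EpiConverges uk u →
      Tendsto (fun k => Z (uk k)) atTop (𝓝 (Z u))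

/-- The valuation property on a class `X` (here `⊔`, `⊓` are the pointwise
maximum and minimum). -/
def IsValuation {n : ℕ} (X : Set (Vn n → EReal)) (Z : (Vn n → EReal) → ℝ) : Prop :=
  ∀ u v : Vn n → EReal, u ∈ X → v ∈ X → u ⊔ v ∈ X → u ⊓ v ∈ X →
    Z (u ⊔ v) + Z (u ⊓ v) = Z u + Z v

/-- Epi-translation invariance: invariance under `u ↦ u(· - x₀) + c`. -/
def EpiTranslationInvariant {n : ℕ} (X : Set (Vn n → EReal)) (Z : (Vn n → EReal) → ℝ) : Prop :=
  ∀ u ∈ X, ∀ x₀ : Vn n, ∀ c : ℝ, Z (fun x => u (x - x₀) + (c : EReal)) = Z u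

-- Epi-multiplication `λ ⊡ u`; for `λ = 0` it is the indicator of `{0}`.
open Classical in
def epiMul {n : ℕ} (l : ℝ) (u : Vn n → EReal) : Vn n → EReal :=
  if l = 0 then (fun x => if x = 0 then (0 : EReal) else ⊤)
  else fun x => (l : EReal) * u (l⁻¹ • x)

/-- `Z` is epi-homogeneous of degree `α`: `Z(λ ⊡ u) = λ^α Z(u)` for `λ > 0`. -/
def EpiHomogeneous {n : ℕ} (X : Set (Vn n → EReal)) (Z : (Vn n → EReal) → ℝ) (α : ℝ) : Prop :=
  ∀ u ∈ X, ∀ l : ℝ, 0 < l → Z (epiMul l u) = l ^ α * Z u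

namespace IVH

variable {n : ℕ}

lemma conv_real {u : Vn n → EReal} (hu : IsConvexFn u) {x y : Vn n} {a b t : ℝ}
    (ht : 0 < t) (ht1 : t < 1) (hx : u x ≤ a) (hy : u y ≤ b) :
    u (t • x + (1 - t) • y) ≤ ((t * a + (1 - t) * b : ℝ) : EReal) := by
  refine (hu x y t ht ht1).trans ?_
  rw [EReal.coe_add, EReal.coe_mul, EReal.coe_mul]
  have h1 : (0 : EReal) ≤ (t : EReal) := by exact_mod_cast ht.le
  have h2 : (0 : EReal) ≤ ((1 - t : ℝ) : EReal) := by
    have : (0:ℝ) ≤ 1 - t := by linarith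
    exact_mod_cast this
  exact add_le_add (mul_le_mul_of_nonneg_left hx h1) (mul_le_mul_of_nonneg_left hy h2)

lemma isConvexFn_of_real {u : Vn n → EReal} (hb : ∀ x, u x ≠ ⊥)
    (h : ∀ (x y : Vn n) (a b t : ℝ), 0 < t → t < 1 → u x = a → u y = b →
      u (t • x + (1 - t) • y) ≤ ((t * a + (1 - t) * b : ℝ) : EReal)) : IsConvexFn u := by
  intro x y t ht ht1
  have ht2 : (0:ℝ) < 1 - t := by linarith
  have key : ∀ (z : Vn n) (s : ℝ), 0 < s → (s : EReal) * u z ≠ ⊥ := by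
    intro z s hs
    induction hz : u z using EReal.rec with
    | bot => exact absurd hz (hb z)
    | coe r => rw [← EReal.coe_mul]; exact EReal.coe_ne_bot _
    | top => rw [EReal.coe_mul_top_of_pos hs]; simp
  by_cases hx : u x = ⊤
  · rw [hx, EReal.coe_mul_top_of_pos ht, EReal.top_add_of_ne_bot (key y _ ht2)]
    exact le_top
  by_cases hy : u y = ⊤
  · rw [hy, EReal.coe_mul_top_of_pos ht2, EReal.add_top_of_ne_bot (key x _ ht)]
    exact le_top
  have h1 := h x y _ _ t ht ht1 (EReal.coe_toReal hx (hb x)).symm (EReal.coe_toReal hy (hb y)).symm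
  rwa [EReal.coe_add, EReal.coe_mul, EReal.coe_mul, EReal.coe_toReal hx (hb x),
    EReal.coe_toReal hy (hb y)] at h1

/-- Points where `u` is infinite or differentiable. -/
def Good (u : Vn n → EReal) (x : Vn n) : Prop :=
  u x ≠ ⊤ → {y | u y ≠ ⊤} ∈ 𝓝 x ∧ DifferentiableAt ℝ (fun y => (u y).toReal) x

lemma convex_dom {u : Vn n → EReal} (hu : u ∈ ConvSet n) : Convex ℝ {y | u y ≠ ⊤} := by
  obtain ⟨hc, -, hb, -⟩ := hu
  rw [convex_iff_pairwise_pos]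
  intro x hx y hy _ a b ha hb' hab
  have hba : b = 1 - a := by linarith
  subst hba
  have := conv_real hc ha (by linarith) (EReal.coe_toReal hx (hb x)).ge
    (EReal.coe_toReal hy (hb y)).ge
  exact ne_top_of_le_ne_top (EReal.coe_ne_top _) this

lemma convexOn_toReal {u : Vn n → EReal} (hu : u ∈ ConvSet n) :
    ConvexOn ℝ {y | u y ≠ ⊤} (fun y => (u y).toReal) := by
  refine ⟨convex_dom hu, ?_⟩
  intro x hx y hy a b ha hb' hab
  have hba : b = 1 - a := by linarith
  rcases ha.eq_or_lt with rfl | ha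
  · have : b = 1 := by linarith
    simp [this]
  rcases hb'.eq_or_lt with rfl | hb'
  · have : a = 1 := by linarith
    simp [this]
  subst hba
  obtain ⟨hc, -, hb, -⟩ := hu
  have := conv_real hc ha (by linarith) (EReal.coe_toReal hx (hb x)).ge
    (EReal.coe_toReal hy (hb y)).ge
  have h2 := EReal.toReal_le_toReal this (hb _) (EReal.coe_ne_top _)
  rw [EReal.toReal_coe] at h2
  simpa only [smul_eq_mul] using h2

lemma ae_good {u : Vn n → EReal} (hu : u ∈ ConvSet n) : ∀ᵐ x, Good u x := by
  have h1 : ∀ᵐ x, x ∉ frontier {y | u y ≠ ⊤} := by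
    rw [ae_iff]; simpa using (convex_dom hu).addHaar_frontier volume
  have hL := (convexOn_toReal hu).locallyLipschitzOn_interior
  set D : Set (Vn n) := {y | u y ≠ ⊤} with hD
  have h2 : ∀ᵐ x, x ∈ interior D → DifferentiableAt ℝ (fun y => (u y).toReal) x := by
    rw [ae_iff]
    refine measure_null_of_locally_null _ ?_
    intro x hx
    simp only [Set.mem_ofPred_eq, Classical.not_imp] at hx
    obtain ⟨K, t, ht, hKt⟩ := hL hx.1
    rw [isOpen_interior.nhdsWithin_eq hx.1] at ht
    refine ⟨_, inter_mem_nhdsWithin _ (interior_mem_nhds.2 ht), ?_⟩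
    have := (hKt.mono interior_subset).ae_differentiableWithinAt_of_mem (μ := volume)
    rw [ae_iff] at this
    refine measure_mono_null ?_ this
    rintro z ⟨hz1, hz2⟩
    simp only [Set.mem_ofPred_eq, Classical.not_imp] at hz1 ⊢
    exact ⟨hz2, fun hz => hz1.2 (hz.differentiableAt (isOpen_interior.mem_nhds hz2))⟩
  filter_upwards [h1, h2] with x hx1 hx2 hxD
  have hi : x ∈ interior D := by
    by_contra h
    exact hx1 ⟨subset_closure hxD, h⟩
  exact ⟨mem_interior_iff_mem_nhds.1 hi, hx2 hi⟩

lemma subgrad {u : Vn n → EReal} (hu : u ∈ ConvSet n) {x : Vn n} (hx : u x ≠ ⊤) (hg : Good u x)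
    (y : Vn n) (b : ℝ) (hy : u y ≤ b) :
    (u x).toReal + inner ℝ (gradient (fun y => (u y).toReal) x) (y - x) ≤ b := by
  obtain ⟨-, hd⟩ := hg hx
  have h1 := (hd.hasFDerivAt.hasLineDerivAt (y - x)).tendsto_slope_zero_right
  rw [inner_gradient_left]
  have h2 : fderiv ℝ (fun y => (u y).toReal) x (y - x) ≤ b - (u x).toReal := by
    refine le_of_tendsto h1 ?_
    have : Set.Ioo (0:ℝ) 1 ∈ 𝓝[>] (0:ℝ) := Ioo_mem_nhdsGT one_pos
    filter_upwards [this] with t ht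
    have h3 := conv_real hu.1 ht.1 ht.2 hy (EReal.coe_toReal hx (hu.2.2.1 x)).ge
    have h4 := EReal.toReal_le_toReal h3 (hu.2.2.1 _) (EReal.coe_ne_top _)
    have h5 : t • y + (1 - t) • x = x + t • (y - x) := by module
    rw [h5, EReal.toReal_coe] at h4
    rw [smul_eq_mul, inv_mul_le_iff₀ ht.1]
    linarith
  linarith

end IVH
namespace IVH

variable {n : ℕ}

lemma epi_lower {uk : ℕ → Vn n → EReal} {u : Vn n → EReal} (h : EpiConverges uk u)
    (x : Vn n) (c : EReal) (hc : c < u x) :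
    ∀ᶠ p : ℕ × Vn n in atTop ×ˢ 𝓝 x, c < uk p.1 p.2 := by
  by_contra hcon
  have hfr : ∀ m : ℕ, ∃ᶠ k in atTop, ∃ y ∈ Metric.ball x (1 / ((m:ℝ) + 1)), uk k y ≤ c := by
    intro m hm
    apply hcon
    have hb : Metric.ball x (1 / ((m:ℝ) + 1)) ∈ 𝓝 x := Metric.ball_mem_nhds _ (by positivity)
    filter_upwards [prod_mem_prod hm hb] with p hp
    by_contra h2
    exact hp.1 ⟨p.2, hp.2, not_lt.1 h2⟩
  obtain ⟨φ, hφ, hP⟩ := extraction_forall_of_frequently hfr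
  choose y hy hyc using hP
  classical
  let xk : ℕ → Vn n := fun k => if hk : ∃ m, φ m = k then y hk.choose else x
  have hxφ : ∀ m, xk (φ m) = y m := by
    intro m
    have hk : ∃ m', φ m' = φ m := ⟨m, rfl⟩
    have : hk.choose = m := hφ.injective hk.choose_spec
    simp only [xk, dif_pos hk, this]
  have hx : Tendsto xk atTop (𝓝 x) := by
    rw [Metric.tendsto_atTop]
    intro ε hε
    obtain ⟨m, hm⟩ := exists_nat_one_div_lt hε
    refine ⟨φ m, fun k hk => ?_⟩
    by_cases h' : ∃ m, φ m = k
    · obtain ⟨m', rfl⟩ := h'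
      rw [hxφ]
      have hmm : m ≤ m' := hφ.le_iff_le.1 hk
      have h1 := hy m'
      rw [Metric.mem_ball] at h1
      refine h1.trans (lt_of_le_of_lt ?_ hm)
      gcongr
    · simp only [xk, dif_neg h', dist_self]; exact hε
  have h1 := (h x).1 xk hx
  have h2 := eventually_lt_of_lt_liminf (hc.trans_le h1)
  obtain ⟨m, hm⟩ := (hφ.tendsto_atTop.eventually h2).exists
  rw [hxφ] at hm
  exact absurd (hyc m) (not_le.2 hm)

lemma epi_upper {uk : ℕ → Vn n → EReal} {u : Vn n → EReal} (huk : ∀ k, uk k ∈ ConvSet n)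
    (h : EpiConverges uk u) (x : Vn n) (c : ℝ) (hc : ∀ᶠ y in 𝓝 x, u y < c) :
    ∀ᶠ p : ℕ × Vn n in atTop ×ˢ 𝓝 x, uk p.1 p.2 ≤ c := by
  obtain ⟨r, hr, hball⟩ := Metric.eventually_nhds_iff_ball.1 hc
  set δ := r / 3 with hδ
  have hδ0 : 0 < δ := by positivity
  obtain ⟨t, htK, htf, htc⟩ := (isCompact_closedBall x (2 * δ)).finite_cover_balls
    (show 0 < δ / 2 by positivity)
  choose v hv hv2 using fun z => (h z).2
  have hev : ∀ᶠ k in atTop, ∀ z ∈ t, dist (v z k) z < δ / 4 ∧ uk k (v z k) < c := by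
    rw [htf.eventually_all]
    intro z hz
    have hz1 : u z < c := hball z (by
      have := htK hz
      rw [Metric.mem_closedBall] at this
      rw [Metric.mem_ball]; linarith)
    exact (((hv z).eventually (Metric.ball_mem_nhds z (show 0 < δ/4 by positivity)))).and
      ((hv2 z).eventually (gt_mem_nhds hz1))
  have hb : Metric.ball x δ ∈ 𝓝 x := Metric.ball_mem_nhds _ hδ0
  filter_upwards [prod_mem_prod hev hb] with p hp
  obtain ⟨k, z⟩ := p
  obtain ⟨hk, hz⟩ := hp
  simp only [Set.mem_ofPred_eq] at hk hz ⊢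
  by_contra hzc
  have hconv : Convex ℝ {y | uk k y ≤ c} := by
    rw [convex_iff_pairwise_pos]
    intro a ha b hb _ α β hα hβ hαβ
    have hβ' : β = 1 - α := by linarith
    subst hβ'
    have := conv_real (huk k).1 hα (by linarith) ha hb
    have e : α * c + (1 - α) * c = c := by ring
    rwa [e] at this
  have hclosed : IsClosed {y | uk k y ≤ c} := (huk k).2.1.isClosed_preimage c
  obtain ⟨f, s, hf1, hf2⟩ := geometric_hahn_banach_closed_point hconv hclosed hzc
  set q := (InnerProductSpace.toDual ℝ (Vn n)).symm f with hq
  have hfq : ∀ w, f w = inner ℝ q w := fun w => by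
    rw [hq, InnerProductSpace.toDual_symm_apply]
  have key : ∀ w : Vn n, ‖w‖ ≤ δ → ∃ w' : Vn n, dist w' (z + w) < 3 * δ / 4 ∧ f w' < s := by
    intro w hw
    have : z + w ∈ Metric.closedBall x (2 * δ) := by
      rw [Metric.mem_closedBall, dist_eq_norm]
      rw [Metric.mem_ball, dist_eq_norm] at hz
      calc ‖z + w - x‖ = ‖(z - x) + w‖ := by congr 1; abel
        _ ≤ ‖z - x‖ + ‖w‖ := norm_add_le _ _
        _ ≤ 2 * δ := by linarith
    obtain ⟨z', hz', hz2⟩ := Set.mem_iUnion₂.1 (htc this)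
    refine ⟨v z' k, ?_, hf1 _ (hk z' hz').2.le⟩
    rw [Metric.mem_ball, dist_comm] at hz2
    have := (hk z' hz').1
    have := dist_triangle (v z' k) z' (z + w)
    linarith
  by_cases hq0 : q = 0
  · obtain ⟨w', -, hw'⟩ := key 0 (by simpa using hδ0.le)
    rw [hfq, hq0, inner_zero_left] at hw' hf2
    linarith
  have hqp : 0 < ‖q‖ := norm_pos_iff.2 hq0
  obtain ⟨w', hw1, hw2⟩ := key ((δ / ‖q‖) • q) (by
    rw [norm_smul, Real.norm_of_nonneg (by positivity)]; field_simp; rfl)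
  set d := w' - (z + (δ / ‖q‖) • q) with hd
  have hw3 : w' = z + (δ / ‖q‖) • q + d := by rw [hd]; abel
  rw [dist_eq_norm, ← hd] at hw1
  have hdd := abs_le.1 (abs_real_inner_le_norm q d)
  rw [hfq] at hw2 hf2
  rw [hw3, inner_add_right, inner_add_right, inner_smul_right, real_inner_self_eq_norm_sq] at hw2
  have e1 : δ / ‖q‖ * ‖q‖ ^ 2 = δ * ‖q‖ := by field_simp
  rw [e1] at hw2
  have : ‖q‖ * ‖d‖ ≤ ‖q‖ * (3 * δ / 4) := by gcongr
  nlinarith [mul_pos hqp hδ0]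

end IVH
namespace IVH

variable {n : ℕ}

/-- The integrand, extended by zero. -/
def FF (ζ : Vn n → ℝ) (u : Vn n → EReal) : Vn n → ℝ :=
  Set.indicator {x | u x ≠ ⊤} (fun x => ζ (gradient (fun y => (u y).toReal) x))

lemma measurableSet_dom {u : Vn n → EReal} (hu : u ∈ ConvSet n) :
    MeasurableSet {x | u x ≠ ⊤} :=
  (hu.2.1.measurable (measurableSet_singleton ⊤)).compl

lemma measurable_FF {ζ : Vn n → ℝ} (hζ : Continuous ζ) {u : Vn n → EReal} (hu : u ∈ ConvSet n) :
    Measurable (FF ζ u) := by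
  refine Measurable.indicator ?_ (measurableSet_dom hu)
  refine hζ.measurable.comp ?_
  exact (InnerProductSpace.toDual ℝ (Vn n)).symm.continuous.measurable.comp (measurable_fderiv ℝ _)

lemma unif_bound {uk : ℕ → Vn n → EReal} {u : Vn n → EReal} (huk : ∀ k, uk k ∈ ConvSet n)
    (hu : u ∈ ConvSc n) (h : EpiConverges uk u) (R : ℝ) (hR : 0 ≤ R) :
    ∃ B : ℝ, ∀ᶠ k in atTop, ∀ x, uk k x ≠ ⊤ → Good (uk k) x →
      ‖gradient (fun y => (uk k y).toReal) x‖ ≤ R → ‖x‖ ≤ B := by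
  obtain ⟨y, hy⟩ := hu.1.2.2.2
  set a := (u y).toReal with ha
  have hya : u y = a := (EReal.coe_toReal hy (hu.1.2.2.1 y)).symm
  obtain ⟨R', hR'⟩ := hu.2 (R + 1)
  set r := max (max 1 (R' + 1 + ‖y‖)) (a + 2 + (R + 1) * (1 + ‖y‖)) with hr
  have r1 : 1 ≤ r := (le_max_left _ _).trans (le_max_left _ _)
  have r2 : R' + 1 + ‖y‖ ≤ r := (le_max_right _ _).trans (le_max_left _ _)
  have r3 : a + 2 + (R + 1) * (1 + ‖y‖) ≤ r := le_max_right _ _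
  obtain ⟨yk, hyk, hyk2⟩ := (h y).2
  set K : Set (Vn n) := Metric.closedBall y (r + 1) ∩ {z | r - 1 ≤ dist z y} with hK
  have hKc : IsCompact K := (isCompact_closedBall _ _).inter_right
    (isClosed_le continuous_const (continuous_id.dist continuous_const))
  have hlow : ∀ z ∈ K, {p : ℕ × Vn n | ((a + 1 + R * r : ℝ) : EReal) < uk p.1 p.2} ∈
      atTop ×ˢ 𝓝 z := by
    intro z hz
    refine epi_lower h z _ ?_
    have hz1 : r - 1 ≤ dist z y := hz.2
    have hz2 : r - 1 - ‖y‖ ≤ ‖z‖ := by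
      rw [dist_eq_norm] at hz1
      have := norm_sub_le z y
      linarith
    refine lt_of_lt_of_le ?_ (hR' z (by linarith))
    rw [EReal.coe_lt_coe_iff]
    have : (R + 1) * (r - 1 - ‖y‖) ≤ (R + 1) * ‖z‖ := by gcongr
    nlinarith
  have hlow2 := hKc.mem_prod_nhdsSet_of_forall hlow
  obtain ⟨S, hS, T, hT, hST⟩ := mem_prod_iff.1 hlow2
  refine ⟨r + 1 + ‖y‖, ?_⟩
  have e1 : ∀ᶠ k in atTop, uk k (yk k) < ((a + 1 : ℝ) : EReal) := by
    refine hyk2.eventually (gt_mem_nhds ?_)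
    rw [hya, EReal.coe_lt_coe_iff]; linarith
  have e2 : ∀ᶠ k in atTop, dist (yk k) y < 1 := hyk.eventually (Metric.ball_mem_nhds y one_pos)
  filter_upwards [hS, e1, e2] with k hkS hk1 hk2 x hx hg hp
  have hd : dist x (yk k) < r := by
    by_contra hcon
    push Not at hcon
    set b := (uk k (yk k)).toReal with hb
    have hbk : uk k (yk k) = b :=
      (EReal.coe_toReal (ne_top_of_lt hk1) ((huk k).2.2.1 _)).symm
    have hb1 : b < a + 1 := by rw [hbk, EReal.coe_lt_coe_iff] at hk1; exact hk1
    have hsub := subgrad (huk k) hx hg (yk k) b hbk.le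
    set d := dist x (yk k) with hdd
    have hin : -(R * d) ≤ inner ℝ (gradient (fun y => (uk k y).toReal) x) (yk k - x) := by
      have h1 := (abs_le.1 (abs_real_inner_le_norm (gradient (fun y => (uk k y).toReal) x) (yk k - x))).1
      rw [← dist_eq_norm, dist_comm, ← hdd] at h1
      have : ‖gradient (fun y => (uk k y).toReal) x‖ * d ≤ R * d := by gcongr
      linarith
    have hxv : uk k x ≤ ((b + R * d : ℝ) : EReal) := by
      rw [← EReal.coe_toReal hx ((huk k).2.2.1 x), EReal.coe_le_coe_iff]; linarith
    have hd0 : 0 < d := by linarith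
    set z := yk k + (r / d) • (x - yk k) with hz
    have hzd : dist z (yk k) = r := by
      rw [hz, dist_eq_norm, add_sub_cancel_left, norm_smul, ← dist_eq_norm, ← hdd,
        Real.norm_of_nonneg (by positivity)]
      field_simp
    have hzv : uk k z ≤ ((b + R * r : ℝ) : EReal) := by
      rcases hcon.eq_or_lt with heq | hlt
      · have : z = x := by rw [hz, heq, div_self hd0.ne']; simp
        rw [this, heq]; exact hxv
      · have := conv_real (huk k).1 (t := r / d) (by positivity) (by rw [div_lt_one hd0]; exact hlt)
          hxv hbk.le
        have e : (r / d) • x + (1 - r / d) • yk k = z := by rw [hz]; module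
        rw [e] at this
        convert this using 2
        field_simp
        ring
    have hzK : z ∈ K := by
      have t1 := dist_triangle z (yk k) y
      have t2 := dist_triangle z y (yk k)
      rw [dist_comm y] at t2
      refine ⟨?_, ?_⟩
      · rw [Metric.mem_closedBall]; linarith
      · change r - 1 ≤ dist z y
        linarith
    have := hST (Set.mk_mem_prod hkS (subset_of_mem_nhdsSet hT hzK))
    have h3 := lt_of_lt_of_le (this : _ < uk k z) hzv
    rw [EReal.coe_lt_coe_iff] at h3
    linarith
  have t1 := dist_triangle x (yk k) y
  have t2 := norm_le_norm_add_norm_sub' x y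
  rw [← dist_eq_norm] at t2
  linarith

lemma lim_out {ζ : Vn n → ℝ} {R : ℝ} (hR : 0 ≤ R) (hζR : ∀ p, ζ p ≠ 0 → ‖p‖ ≤ R)
    {uk : ℕ → Vn n → EReal} {u : Vn n → EReal} (huk : ∀ k, uk k ∈ ConvSet n)
    (hu : u ∈ ConvSet n) (h : EpiConverges uk u) {x : Vn n} (hx : u x = ⊤)
    (hg : ∀ k, Good (uk k) x) : ∀ᶠ k in atTop, FF ζ (uk k) x = 0 := by
  obtain ⟨y, hy⟩ := hu.2.2.2
  set a := (u y).toReal with ha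
  have hya : u y = a := (EReal.coe_toReal hy (hu.2.2.1 y)).symm
  obtain ⟨yk, hyk, hyk2⟩ := (h y).2
  have e1 : ∀ᶠ k in atTop, uk k (yk k) < ((a + 1 : ℝ) : EReal) := by
    refine hyk2.eventually (gt_mem_nhds ?_)
    rw [hya, EReal.coe_lt_coe_iff]; linarith
  have e2 : ∀ᶠ k in atTop, dist (yk k) y < 1 := hyk.eventually (Metric.ball_mem_nhds y one_pos)
  have e3 : ∀ᶠ k in atTop, ((a + 1 + R * (dist x y + 1) : ℝ) : EReal) < uk k x := by
    have := epi_lower h x ((a + 1 + R * (dist x y + 1) : ℝ) : EReal) (by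
      rw [hx]; exact EReal.coe_lt_top _)
    exact (tendsto_id.prodMk (tendsto_const_nhds (x := x))).eventually this
  filter_upwards [e1, e2, e3] with k h1 h2 h3
  by_contra hne
  have hxk : uk k x ≠ ⊤ := by
    intro htop; apply hne; simp [FF, htop]
  have hz : ζ (gradient (fun y => (uk k y).toReal) x) ≠ 0 := by
    simpa [FF, hxk] using hne
  have hp := hζR _ hz
  have hsub := subgrad (huk k) hxk (hg k) (yk k) (a + 1) h1.le
  have h4 := (abs_le.1 (abs_real_inner_le_norm (gradient (fun y => (uk k y).toReal) x) (yk k - x))).1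
  have h5 : ‖yk k - x‖ ≤ dist x y + 1 := by
    rw [← dist_eq_norm]
    have := dist_triangle (yk k) y x
    rw [dist_comm y x] at this
    linarith
  have h6 : ‖gradient (fun y => (uk k y).toReal) x‖ * ‖yk k - x‖ ≤ R * (dist x y + 1) := by gcongr
  rw [← EReal.coe_toReal hxk ((huk k).2.2.1 x), EReal.coe_lt_coe_iff] at h3
  linarith

lemma lim_in {ζ : Vn n → ℝ} (hζ : Continuous ζ)
    {uk : ℕ → Vn n → EReal} {u : Vn n → EReal} (huk : ∀ k, uk k ∈ ConvSet n)
    (hu : u ∈ ConvSet n) (h : EpiConverges uk u) {x : Vn n} (hx : u x ≠ ⊤)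
    (hgu : Good u x) (hg : ∀ k, Good (uk k) x) :
    Tendsto (fun k => FF ζ (uk k) x) atTop (𝓝 (FF ζ u x)) := by
  obtain ⟨hnb, hd⟩ := hgu hx
  set p := gradient (fun y => (u y).toReal) x with hp
  have hgr : HasGradientAt (fun y => (u y).toReal) p x := hd.hasGradientAt
  set a := (u x).toReal with ha
  have hxa : u x = a := (EReal.coe_toReal hx (hu.2.2.1 x)).symm
  -- main estimate
  have main : ∀ ε > 0, ∀ᶠ k in atTop, uk k x ≠ ⊤ ∧
      ‖gradient (fun y => (uk k y).toReal) x - p‖ ≤ 4 * ε := by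
    intro ε hε
    have h1 := (hasGradientAt_iff_isLittleO.1 hgr).def hε
    obtain ⟨s, hs, hball⟩ := Metric.eventually_nhds_iff_ball.1 (h1.and hnb)
    set t := s / 2 with ht
    have ht0 : 0 < t := by positivity
    have hup : ∀ y ∈ Metric.closedBall x t,
        {q : ℕ × Vn n | uk q.1 q.2 ≤ ((a + inner ℝ p (q.2 - x) + 3 * ε * t : ℝ) : EReal)} ∈
          atTop ×ˢ 𝓝 y := by
      intro y hy
      have hys : y ∈ Metric.ball x s := by
        rw [Metric.mem_closedBall] at hy; rw [Metric.mem_ball]; linarith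
      have hcts : Continuous fun z : Vn n => a + inner ℝ p (z - x) := by fun_prop
      have hcts2 : Continuous fun z : Vn n => dist z x := by fun_prop
      set c := a + inner ℝ p (y - x) + (5/2) * ε * t with hc
      have hev : ∀ᶠ z in 𝓝 y, u z < (c : EReal) := by
        have c1 : ∀ᶠ z in 𝓝 y, a + inner ℝ p (z - x) < a + inner ℝ p (y - x) + (1/2) * ε * t :=
          hcts.continuousAt.eventually (gt_mem_nhds (by
            have : 0 < (1/2) * ε * t := by positivity
            linarith))
        filter_upwards [c1, Metric.isOpen_ball.mem_nhds hys] with z hz1 hz3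
        obtain ⟨b1, b2⟩ := hball z hz3
        rw [← EReal.coe_toReal b2 (hu.2.2.1 z), EReal.coe_lt_coe_iff]
        have b3 := (abs_le.1 b1).2
        have b4 : ‖z - x‖ < 2 * t := by
          rw [← dist_eq_norm]; rw [Metric.mem_ball] at hz3; linarith
        have b5 : ε * ‖z - x‖ < ε * (2 * t) := by gcongr
        change (u z).toReal - (u x).toReal - inner ℝ p (z - x) ≤ _ at b3
        linarith
      have hE := epi_upper huk h y c hev
      have c2 : ∀ᶠ z in 𝓝 y, a + inner ℝ p (y - x) - (1/2) * ε * t < a + inner ℝ p (z - x) :=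
        hcts.continuousAt.eventually (lt_mem_nhds (by
            have : 0 < (1/2) * ε * t := by positivity
            linarith))
      filter_upwards [hE, tendsto_snd.eventually c2] with q hq1 hq2
      refine hq1.trans ?_
      rw [EReal.coe_le_coe_iff]
      linarith
    have hup2 := (isCompact_closedBall x t).mem_prod_nhdsSet_of_forall hup
    obtain ⟨S, hS, T, hT, hST⟩ := mem_prod_iff.1 hup2
    have e3 : ∀ᶠ k in atTop, ((a - ε * t : ℝ) : EReal) < uk k x := by
      have := epi_lower h x ((a - ε * t : ℝ) : EReal) (by
        rw [hxa, EReal.coe_lt_coe_iff]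
        have : 0 < ε * t := by positivity
        linarith)
      exact (tendsto_id.prodMk (tendsto_const_nhds (x := x))).eventually this
    filter_upwards [hS, e3] with k hkS hk3
    have hle : ∀ y ∈ Metric.closedBall x t,
        uk k y ≤ ((a + inner ℝ p (y - x) + 3 * ε * t : ℝ) : EReal) := fun y hy =>
      hST (Set.mk_mem_prod hkS (subset_of_mem_nhdsSet hT hy))
    have hxk : uk k x ≠ ⊤ := ne_top_of_le_ne_top (EReal.coe_ne_top _)
      (hle x (Metric.mem_closedBall_self ht0.le))
    refine ⟨hxk, ?_⟩
    rw [← EReal.coe_toReal hxk ((huk k).2.2.1 x), EReal.coe_lt_coe_iff] at hk3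
    set q := gradient (fun y => (uk k y).toReal) x with hq
    by_cases hq0 : q - p = 0
    · rw [hq0, norm_zero]; positivity
    have hn : 0 < ‖q - p‖ := norm_pos_iff.2 hq0
    set y := x + (t / ‖q - p‖) • (q - p) with hy
    have hyx : y - x = (t / ‖q - p‖) • (q - p) := by rw [hy]; abel
    have hyb : y ∈ Metric.closedBall x t := by
      rw [Metric.mem_closedBall, dist_eq_norm, hyx, norm_smul, Real.norm_of_nonneg (by positivity)]
      field_simp; rfl
    have hsub := subgrad (huk k) hxk (hg k) y _ (hle y hyb)
    rw [← hq] at hsub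
    have e : inner ℝ q (y - x) - inner ℝ p (y - x) = t * ‖q - p‖ := by
      rw [← inner_sub_left, hyx, inner_smul_right, real_inner_self_eq_norm_sq]
      field_simp
    have : t * ‖q - p‖ ≤ t * (4 * ε) := by linarith
    exact le_of_mul_le_mul_left this ht0
  have htend : Tendsto (fun k => gradient (fun y => (uk k y).toReal) x) atTop (𝓝 p) := by
    rw [Metric.tendsto_nhds]
    intro ε hε
    filter_upwards [main (ε / 8) (by positivity)] with k hk
    rw [dist_eq_norm]; linarith [hk.2]
  have hFu : FF ζ u x = ζ p := by simp [FF, hx, hp]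
  rw [hFu]
  refine ((hζ.tendsto p).comp htend).congr' ?_
  filter_upwards [main 1 one_pos] with k hk
  simp [FF, hk.1]

end IVH
namespace IVH

variable {n : ℕ}

lemma epi_const {u : Vn n → EReal} (hu : LowerSemicontinuous u) : EpiConverges (fun _ => u) u := by
  intro x
  refine ⟨fun xk hxk => ?_, fun _ => x, tendsto_const_nhds, tendsto_const_nhds⟩
  refine le_of_forall_lt fun c hc => ?_
  obtain ⟨d, hcd, hd⟩ := exists_between hc
  refine hcd.trans_le ?_
  refine le_liminf_of_le (by isBoundedDefault) ?_
  filter_upwards [hxk.eventually (hu x d hd)] with k hk using hk.le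

lemma FF_bound {ζ : Vn n → ℝ} {C R : ℝ} (hC : ∀ p, ‖ζ p‖ ≤ C) (hR : ∀ p, ζ p ≠ 0 → ‖p‖ ≤ R)
    {u : Vn n → EReal} {B : ℝ} (hB : ∀ x, u x ≠ ⊤ → Good u x →
      ‖gradient (fun y => (u y).toReal) x‖ ≤ R → ‖x‖ ≤ B) {x : Vn n} (hg : Good u x) :
    ‖FF ζ u x‖ ≤ (Metric.closedBall (0 : Vn n) B).indicator (fun _ => C) x := by
  have hC0 : 0 ≤ C := (norm_nonneg _).trans (hC 0)
  by_cases hx : u x = ⊤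
  · have : FF ζ u x = 0 := by simp [FF, hx]
    rw [this, norm_zero]
    exact Set.indicator_nonneg (fun _ _ => hC0) _
  have hF : FF ζ u x = ζ (gradient (fun y => (u y).toReal) x) := by simp [FF, hx]
  rw [hF]
  by_cases hz : ζ (gradient (fun y => (u y).toReal) x) = 0
  · rw [hz, norm_zero]
    exact Set.indicator_nonneg (fun _ _ => hC0) _
  have := hB x hx hg (hR _ hz)
  rw [Set.indicator_of_mem (by simpa using this)]
  exact hC _

lemma integrable_bd (B C : ℝ) :
    Integrable ((Metric.closedBall (0 : Vn n) B).indicator (fun _ => C)) := by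
  rw [integrable_indicator_iff measurableSet_closedBall]
  exact integrableOn_const (measure_closedBall_lt_top).ne

lemma exists_bounds {ζ : Vn n → ℝ} (hζc : Continuous ζ) (hζs : HasCompactSupport ζ) :
    ∃ C R : ℝ, 0 ≤ R ∧ (∀ p, ‖ζ p‖ ≤ C) ∧ (∀ p, ζ p ≠ 0 → ‖p‖ ≤ R) := by
  obtain ⟨C, hC⟩ := hζs.exists_bound_of_continuous hζc
  obtain ⟨R, hR⟩ := hζs.isCompact.isBounded.subset_closedBall 0
  refine ⟨C, max R 0, le_max_right _ _, hC, fun p hp => ?_⟩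
  have := hR (subset_tsupport ζ hp)
  rw [mem_closedBall_zero_iff] at this
  exact this.trans (le_max_left _ _)

lemma integrable_FF {ζ : Vn n → ℝ} (hζc : Continuous ζ) (hζs : HasCompactSupport ζ)
    {u : Vn n → EReal} (hu : u ∈ ConvSc n) : Integrable (FF ζ u) := by
  obtain ⟨C, R, hR0, hC, hR⟩ := exists_bounds hζc hζs
  obtain ⟨B, hB⟩ := unif_bound (fun _ => hu.1) hu (epi_const hu.1.2.1) R hR0
  obtain ⟨k, hB⟩ := hB.exists
  refine (integrable_bd B C).mono' (measurable_FF hζc hu.1).aestronglyMeasurable ?_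
  filter_upwards [ae_good hu.1] with x hx
  exact FF_bound hC hR hB hx

lemma tendsto_FF {ζ : Vn n → ℝ} (hζc : Continuous ζ) (hζs : HasCompactSupport ζ)
    {uk : ℕ → Vn n → EReal} {u : Vn n → EReal} (huk : ∀ k, uk k ∈ ConvSc n)
    (hu : u ∈ ConvSc n) (h : EpiConverges uk u) :
    Tendsto (fun k => ∫ x, FF ζ (uk k) x) atTop (𝓝 (∫ x, FF ζ u x)) := by
  obtain ⟨C, R, hR0, hC, hR⟩ := exists_bounds hζc hζs
  obtain ⟨B, hB⟩ := unif_bound (fun k => (huk k).1) hu h R hR0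
  refine tendsto_integral_filter_of_dominated_convergence _
    (Eventually.of_forall fun k => (measurable_FF hζc (huk k).1).aestronglyMeasurable) ?_
    (integrable_bd B C) ?_
  · filter_upwards [hB] with k hk
    filter_upwards [ae_good (huk k).1] with x hx
    exact FF_bound hC hR hk hx
  · filter_upwards [ae_good hu.1, ae_all_iff.2 fun k => ae_good (huk k).1] with x hx hxk
    by_cases hxt : u x = ⊤
    · have : FF ζ u x = 0 := by simp [FF, hxt]
      rw [this]
      refine tendsto_const_nhds.congr' ?_
      filter_upwards [lim_out hR0 hR (fun k => (huk k).1) hu.1 h hxt hxk] with k hk using hk.symm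
    · exact lim_in hζc (fun k => (huk k).1) hu.1 h hxt hx hxk

lemma FF_touch (ζ : Vn n → ℝ) {u v : Vn n → EReal} (hu : u ∈ ConvSet n)
    {x : Vn n} (hgu : Good u x) (hgv : Good v x)
    (hle : u ≤ v) (hx : u x = v x) : FF ζ u x = FF ζ v x := by
  by_cases hxt : u x = ⊤
  · have hv : v x = ⊤ := hx ▸ hxt
    simp [FF, hxt, hv]
  have hvt : v x ≠ ⊤ := hx ▸ hxt
  obtain ⟨hun, hud⟩ := hgu hxt
  obtain ⟨hvn, hvd⟩ := hgv hvt
  have hmin : IsLocalMin (fun y => (v y).toReal - (u y).toReal) x := by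
    filter_upwards [hvn] with y hy
    have := EReal.toReal_le_toReal (hle y) (hu.2.2.1 y) hy
    rw [hx, sub_self]
    linarith
  have h0 := hmin.fderiv_eq_zero
  rw [fderiv_fun_sub hvd hud, sub_eq_zero] at h0
  have : gradient (fun y => (u y).toReal) x = gradient (fun y => (v y).toReal) x := by
    rw [gradient, gradient, h0]
  simp [FF, hxt, hvt, this]

lemma valuation_FF {ζ : Vn n → ℝ} (hζc : Continuous ζ) (hζs : HasCompactSupport ζ)
    {u v : Vn n → EReal} (hu : u ∈ ConvSc n) (hv : v ∈ ConvSc n) (hs : u ⊔ v ∈ ConvSc n)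
    (hi : u ⊓ v ∈ ConvSc n) :
    (∫ x, FF ζ (u ⊔ v) x) + ∫ x, FF ζ (u ⊓ v) x = (∫ x, FF ζ u x) + ∫ x, FF ζ v x := by
  rw [← integral_add (integrable_FF hζc hζs hs) (integrable_FF hζc hζs hi),
    ← integral_add (integrable_FF hζc hζs hu) (integrable_FF hζc hζs hv)]
  refine integral_congr_ae ?_
  filter_upwards [ae_good hu.1, ae_good hv.1, ae_good hs.1, ae_good hi.1] with x h1 h2 h3 h4
  rcases le_total (u x) (v x) with h | h
  · rw [FF_touch ζ hi.1 h4 h1 inf_le_left (inf_eq_left.2 h),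
      ← FF_touch ζ hv.1 h2 h3 le_sup_right (sup_eq_right.2 h).symm, add_comm]
  · rw [FF_touch ζ hi.1 h4 h2 inf_le_right (inf_eq_right.2 h),
      ← FF_touch ζ hu.1 h1 h3 le_sup_left (sup_eq_left.2 h).symm]

lemma trans_mem {u : Vn n → EReal} (hu : u ∈ ConvSc n) (x₀ : Vn n) (c : ℝ) :
    (fun x => u (x - x₀) + (c : EReal)) ∈ ConvSc n := by
  obtain ⟨⟨hc, hl, hb, ⟨y, hy⟩⟩, hsc⟩ := hu
  have hb' : ∀ x, u (x - x₀) + (c : EReal) ≠ ⊥ := fun x => by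
    rw [EReal.add_ne_bot_iff]; exact ⟨hb _, EReal.coe_ne_bot _⟩
  have hsub : ∀ (z : Vn n) (a : ℝ), u (z - x₀) + (c : EReal) = a → u (z - x₀) = ((a - c : ℝ) : EReal) := by
    intro z a h
    induction hz : u (z - x₀) using EReal.rec with
    | bot => exact absurd hz (hb _)
    | coe r =>
      rw [hz, ← EReal.coe_add, EReal.coe_eq_coe_iff] at h
      rw [EReal.coe_eq_coe_iff]; linarith
    | top => rw [hz, EReal.top_add_coe] at h; exact absurd h.symm (EReal.coe_ne_top _)
  refine ⟨⟨isConvexFn_of_real hb' ?_, ?_, hb', y + x₀, ?_⟩, ?_⟩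
  · intro x y a b t ht ht1 hx hy
    have := conv_real hc ht ht1 (hsub x a hx).le (hsub y b hy).le
    have e : t • (x - x₀) + (1 - t) • (y - x₀) = t • x + (1 - t) • y - x₀ := by module
    rw [e] at this
    refine (add_le_add_left this (c : EReal)).trans ?_
    rw [← EReal.coe_add, EReal.coe_le_coe_iff]
    linarith
  · have h1 : LowerSemicontinuous fun x => u (x - x₀) :=
      fun x d hd => (continuous_id.sub continuous_const).continuousAt.eventually (hl (x - x₀) d hd)
    refine h1.add' lowerSemicontinuous_const fun x => ?_
    exact EReal.continuousAt_add (Or.inr (EReal.coe_ne_bot _)) (Or.inr (EReal.coe_ne_top _))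
  · simp only [add_sub_cancel_right]
    rw [← EReal.coe_toReal hy (hb y), ← EReal.coe_add]
    exact EReal.coe_ne_top _
  · intro M
    obtain ⟨R, hR⟩ := hsc (|M| + 1)
    refine ⟨max (R + ‖x₀‖) ((|M| + 1) * ‖x₀‖ - c), fun x hx => ?_⟩
    have x1 := (le_max_left _ _).trans hx
    have x2 := (le_max_right _ _).trans hx
    have x3 := norm_sub_norm_le x x₀
    refine le_trans ?_ (add_le_add_left (hR (x - x₀) (by linarith)) (c : EReal))
    rw [← EReal.coe_add, EReal.coe_le_coe_iff]
    have h1 : (|M| + 1) * (‖x‖ - ‖x₀‖) ≤ (|M| + 1) * ‖x - x₀‖ := by gcongr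
    have h2 : M * ‖x‖ ≤ |M| * ‖x‖ := by gcongr; exact le_abs_self M
    linarith

lemma trans_FF (ζ : Vn n → ℝ) {u : Vn n → EReal} (hu : u ∈ ConvSc n) (x₀ : Vn n) (c : ℝ) :
    ∫ x, FF ζ (fun x => u (x - x₀) + (c : EReal)) x = ∫ x, FF ζ u x := by
  rw [← integral_sub_right_eq_self (FF ζ u) x₀]
  refine integral_congr_ae ?_
  filter_upwards [ae_good (trans_mem hu x₀ c).1] with x hx
  have hb := hu.1.2.2.1
  by_cases ht : u (x - x₀) = ⊤
  · have h2 : u (x - x₀) + (c : EReal) = ⊤ := by rw [ht, EReal.top_add_coe]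
    simp [FF, ht]
  have htc : ∀ y, u (y - x₀) + (c : EReal) ≠ ⊤ ↔ u (y - x₀) ≠ ⊤ := by
    intro y
    induction u (y - x₀) using EReal.rec with
    | bot => simp
    | coe r => rw [← EReal.coe_add]; simp [-EReal.coe_add]
    | top => simp
  have ht2 := (htc x).2 ht
  obtain ⟨hn, -⟩ := hx ht2
  have heq : (fun y => (u (y - x₀) + (c : EReal)).toReal) =ᶠ[𝓝 x]
      fun y => (fun z => (u z).toReal) (y - x₀) + c := by
    filter_upwards [hn] with y hy
    have := (htc y).1 hy
    rw [EReal.toReal_add this (hb _) (EReal.coe_ne_top _) (EReal.coe_ne_bot _), EReal.toReal_coe]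
  have hgrad : gradient (fun y => (u (y - x₀) + (c : EReal)).toReal) x =
      gradient (fun z => (u z).toReal) (x - x₀) := by
    rw [heq.gradient_eq, gradient, gradient, fderiv_add_const]
    rw [fderiv_comp_sub (f := fun z => (u z).toReal)]
  simp only [FF]
  rw [Set.indicator_of_mem (show x ∈ {x | u (x - x₀) + (c : EReal) ≠ ⊤} from ht2),
    Set.indicator_of_mem (show x - x₀ ∈ {x | u x ≠ ⊤} from ht), hgrad]

lemma coe_mul_ne_top {l : ℝ} (hl : 0 < l) (a : EReal) : (l : EReal) * a ≠ ⊤ ↔ a ≠ ⊤ := by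
  induction a using EReal.rec with
  | bot => simp [EReal.coe_mul_bot_of_pos hl]
  | coe r => rw [← EReal.coe_mul]; simp [-EReal.coe_mul]
  | top => simp [EReal.coe_mul_top_of_pos hl]

lemma coe_mul_ne_bot {l : ℝ} (hl : 0 < l) (a : EReal) : (l : EReal) * a ≠ ⊥ ↔ a ≠ ⊥ := by
  induction a using EReal.rec with
  | bot => simp [EReal.coe_mul_bot_of_pos hl]
  | coe r => rw [← EReal.coe_mul]; simp [-EReal.coe_mul]
  | top => simp [EReal.coe_mul_top_of_pos hl]

lemma mul_mem {u : Vn n → EReal} (hu : u ∈ ConvSc n) {l : ℝ} (hl : 0 < l) :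
    (fun x => (l : EReal) * u (l⁻¹ • x)) ∈ ConvSc n := by
  obtain ⟨⟨hc, hlsc, hb, ⟨y, hy⟩⟩, hsc⟩ := hu
  have hl0 : (0 : EReal) ≤ (l : EReal) := by exact_mod_cast hl.le
  have hb' : ∀ x, (l : EReal) * u (l⁻¹ • x) ≠ ⊥ := fun x => (coe_mul_ne_bot hl _).2 (hb _)
  have hdiv : ∀ (z : Vn n) (a : ℝ), (l : EReal) * u (l⁻¹ • z) = a →
      u (l⁻¹ • z) = ((a / l : ℝ) : EReal) := by
    intro z a h
    have h1 := (coe_mul_ne_top hl (u (l⁻¹ • z))).1 (by rw [h]; exact EReal.coe_ne_top _)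
    rw [← EReal.coe_toReal h1 (hb _)] at h ⊢
    rw [← EReal.coe_mul, EReal.coe_eq_coe_iff] at h
    rw [EReal.coe_eq_coe_iff, ← h]
    field_simp
  refine ⟨⟨isConvexFn_of_real hb' ?_, ?_, hb', l • y, ?_⟩, ?_⟩
  · intro x y a b t ht ht1 hx hy
    have := conv_real hc ht ht1 (hdiv x a hx).le (hdiv y b hy).le
    have e : t • l⁻¹ • x + (1 - t) • l⁻¹ • y = l⁻¹ • (t • x + (1 - t) • y) := by module
    rw [e] at this
    refine (mul_le_mul_of_nonneg_left this hl0).trans ?_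
    rw [← EReal.coe_mul, EReal.coe_le_coe_iff]
    apply le_of_eq
    field_simp
  · have h1 : LowerSemicontinuous fun x => u (l⁻¹ • x) :=
      fun x d hd => (continuous_const_smul l⁻¹).continuousAt.eventually (hlsc (l⁻¹ • x) d hd)
    refine Continuous.comp_lowerSemicontinuous (g := fun a : EReal => (l : EReal) * a) ?_ h1 ?_
    · rw [continuous_iff_continuousAt]
      intro a
      have hl1 : (l : EReal) ≠ 0 := by exact_mod_cast hl.ne'
      exact EReal.Tendsto.const_mul tendsto_id (Or.inl (EReal.coe_ne_bot _))
        (Or.inl (EReal.coe_ne_top _))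
    · exact fun a b hab => mul_le_mul_of_nonneg_left hab hl0
  · simp only [inv_smul_smul₀ hl.ne']
    exact (coe_mul_ne_top hl _).2 hy
  · intro M
    obtain ⟨R, hR⟩ := hsc M
    refine ⟨l * R, fun x hx => ?_⟩
    have hn : ‖l⁻¹ • x‖ = l⁻¹ * ‖x‖ := by
      rw [norm_smul, Real.norm_of_nonneg (by positivity)]
    have := hR (l⁻¹ • x) (by rw [hn, inv_mul_eq_div, le_div_iff₀ hl]; linarith)
    refine le_trans ?_ (mul_le_mul_of_nonneg_left this hl0)
    rw [← EReal.coe_mul, EReal.coe_le_coe_iff, hn]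
    apply le_of_eq
    field_simp

lemma mul_FF (ζ : Vn n → ℝ) (u : Vn n → EReal) {l : ℝ} (hl : 0 < l) :
    ∫ x, FF ζ (fun x => (l : EReal) * u (l⁻¹ • x)) x = l ^ (n : ℝ) * ∫ x, FF ζ u x := by
  have h := Measure.integral_comp_inv_smul (volume : Measure (Vn n)) (FF ζ u) l
  rw [finrank_euclideanSpace_fin, abs_of_pos (by positivity), smul_eq_mul] at h
  rw [Real.rpow_natCast, ← h]
  congr 1
  ext x
  have hgrad : gradient (fun y => ((l : EReal) * u (l⁻¹ • y)).toReal) x =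
      gradient (fun z => (u z).toReal) (l⁻¹ • x) := by
    simp only [EReal.toReal_mul, EReal.toReal_coe]
    rw [gradient, gradient]
    have h1 : fderiv ℝ (fun y => l * (u (l⁻¹ • y)).toReal) x =
        l • fderiv ℝ (fun y => (u (l⁻¹ • y)).toReal) x := by
      have := fderiv_const_smul_field (𝕜 := ℝ) (f := fun y : Vn n => (u (l⁻¹ • y)).toReal) l
      exact congrFun this x
    have h2 := fderiv_comp_smul (𝕜 := ℝ) (f := fun y : Vn n => (u y).toReal) (x := x) l⁻¹
    rw [h1, h2, smul_inv_smul₀ hl.ne']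
  simp only [FF, Set.indicator_apply, Set.mem_ofPred_eq, coe_mul_ne_top hl, hgrad]

lemma Z_eq {ζ : Vn n → ℝ} {u : Vn n → EReal} (hu : u ∈ ConvSc n) :
    ∫ x in {x : Vn n | u x ≠ ⊤}, ζ (gradient (fun y => (u y).toReal) x) = ∫ x, FF ζ u x :=
  (integral_indicator (measurableSet_dom hu.1)).symm

end IVH

/-- **Existence of `n`-epi-homogeneous valuations** (Proposition 4.3): for
`ζ ∈ C_c(ℝⁿ)`, the functional `Z(u) = ∫_{dom u} ζ(∇u(x)) dx` is a continuous
and epi-translation invariant valuation on `Conv_sc(ℝⁿ)` that is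
epi-homogeneous of degree `n`.
(The gradient of `u` is expressed through the gradient of the real-valued
function `x ↦ (u x).toReal`, which agrees with `∇u` a.e. on `dom u`.) -/
theorem integral_valuation_n_homogeneous (n : ℕ) (ζ : Vn n → ℝ)
    (hζc : Continuous ζ) (hζs : HasCompactSupport ζ)
    (Z : (Vn n → EReal) → ℝ)
    (hZ : ∀ u ∈ ConvSc n,
      Z u = ∫ x in {x : Vn n | u x ≠ ⊤},
        ζ (gradient (fun y => (u y).toReal) x)) :
    ContinuousVal (ConvSc n) Z ∧ IsValuation (ConvSc n) Z ∧
      EpiTranslationInvariant (ConvSc n) Z ∧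
      EpiHomogeneous (ConvSc n) Z (n : ℝ) := by
  have hZ' : ∀ u ∈ ConvSc n, Z u = ∫ x, IVH.FF ζ u x := fun u hu => (hZ u hu).trans (IVH.Z_eq hu)
  refine ⟨?_, ?_, ?_, ?_⟩
  · intro uk u huk hu h
    rw [hZ' u hu]
    simp only [hZ' _ (huk _)]
    exact IVH.tendsto_FF hζc hζs huk hu h
  · intro u v hu hv hs hi
    rw [hZ' _ hu, hZ' _ hv, hZ' _ hs, hZ' _ hi]
    exact IVH.valuation_FF hζc hζs hu hv hs hi
  · intro u hu x₀ c
    rw [hZ' _ hu, hZ' _ (IVH.trans_mem hu x₀ c)]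
    exact IVH.trans_FF ζ hu x₀ c
  · intro u hu l hl
    have he : epiMul l u = fun x => (l : EReal) * u (l⁻¹ • x) := by
      simp [epiMul, hl.ne']
    rw [he, hZ' _ hu, hZ' _ (IVH.mul_mem hu hl)]
    exact IVH.mul_FF ζ u hl
end
end

section
/- Let Z : Conv_sc(ℝⁿ) → ℝ be a continuous and epi-translation invariant valuation that is epi-homogeneous of degree m ∈ {1,…,n}. Then there exists a symmetric function Z̄ : (Conv_sc(ℝⁿ))^m → ℝ such that for every k ∈ ℕ, all u₁,…,u_k ∈ Conv_sc(ℝⁿ) and all λ₁,…,λ_k ≥ 0, Z(λ₁ ⊡ u₁ □ ⋯ □ λ_k ⊡ u_k) = Σ over all (i₁,…,i_k) with i_j ∈ {0,…,m} and i₁+⋯+i_k = m of the multinomial coefficient m!/(i₁!⋯i_k!) times λ₁^{i₁}⋯λ_k^{i_k} Z̄(u₁[i₁],…,u_k[i_k]), where u_j[i_j] means the argument u_j is repeated i_j times. Moreover, Z̄ is epi-additive in each variable (i.e. Z̄(α ⊡ u □ β ⊡ u', u₂,…,u_m) = α Z̄(u, u₂,…,u_m) + β Z̄(u', u₂,…,u_m)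 for all α, β > 0), and for every i ∈ {1,…,m} and all fixed u_{i+1},…,u_m ∈ Conv_sc(ℝⁿ), the map u ↦ Z̄(u[i], u_{i+1},…,u_m) is a continuous, epi-translation invariant valuation on Conv_sc(ℝⁿ) that is epi-homogeneous of degree i. -/
open Filter Topology MeasureTheory

noncomputable section

/-- Inf-convolution of two functions. -/
def infConv {n : ℕ} (u v : Vn n → EReal) : Vn n → EReal :=
  fun z => ⨅ x : Vn n, (u x + v (z - x))

/-- Iterated inf-convolution of a finite family of functions. -/
def infConvFamily {n : ℕ} {k : ℕ} (u : Fin k → Vn n → EReal) : Vn n → EReal :=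
  fun z => ⨅ (f : Fin k → Vn n) (_ : ∑ i, f i = z), ∑ i, u i (f i)

/-- The `m`-tuple `(u₁[d₁], …, u_k[d_k])` in which the argument `u j` is
repeated `d j` times (assuming `∑ j, d j = m`). -/
def repTuple {n : ℕ} (k m : ℕ) (d : Fin k → ℕ) (u : Fin k → Vn n → EReal) :
    Fin m → Vn n → EReal :=
  fun x => ((List.finRange k).flatMap fun j => List.replicate (d j) (u j)).getD
    (x : ℕ) (fun _ => ⊤)

/-- The `m`-tuple `(u[i], w_{i+1}, …, w_m)` in which `u` is repeated `i`
times, followed by the entries of `rest`. -/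
def repConcat {n : ℕ} (m i : ℕ) (u : Vn n → EReal)
    (rest : Fin (m - i) → Vn n → EReal) : Fin m → Vn n → EReal :=
  fun x => if h : (x : ℕ) < i then u
    else rest ⟨(x : ℕ) - i, by have := x.isLt; omega⟩

/-! ### Convex functions on the dual side -/

/-- Real-valued convex functions on `ℝⁿ`. -/
def Cvx {n : ℕ} (v : Vn n → ℝ) : Prop := ConvexOn ℝ Set.univ v

lemma Cvx.add {n : ℕ} {v w : Vn n → ℝ} (hv : Cvx v) (hw : Cvx w) : Cvx (v + w) :=
  ConvexOn.add hv hw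

lemma Cvx.smul {n : ℕ} {v : Vn n → ℝ} (hv : Cvx v) {c : ℝ} (hc : 0 ≤ c) : Cvx (c • v) :=
  ConvexOn.smul hc hv

lemma Cvx.zero {n : ℕ} : Cvx (0 : Vn n → ℝ) := convexOn_const (0 : ℝ) convex_univ

/-- Affine functions. -/
def IsAff {n : ℕ} (p : Vn n → ℝ) : Prop := ∃ (a : Vn n) (c : ℝ), p = fun y => inner ℝ a y + c

lemma IsAff.cvx {n : ℕ} {p : Vn n → ℝ} (hp : IsAff p) : Cvx p := by
  obtain ⟨a, c, rfl⟩ := hp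
  refine ⟨convex_univ, ?_⟩
  intro x _ y _ s t _ _ hst
  simp only [inner_add_right, inner_smul_right, smul_eq_mul]
  have : c = s * c + t * c := by rw [← add_mul, hst, one_mul]
  nlinarith

lemma IsAff.add {n : ℕ} {p q : Vn n → ℝ} (hp : IsAff p) (hq : IsAff q) : IsAff (p + q) := by
  obtain ⟨a, c, rfl⟩ := hp
  obtain ⟨b, d, rfl⟩ := hq
  refine ⟨a + b, c + d, ?_⟩
  funext y
  simp only [Pi.add_apply, inner_add_left]
  ring

lemma IsAff.smul {n : ℕ} {p : Vn n → ℝ} (hp : IsAff p) (r : ℝ) : IsAff (r • p) := by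
  obtain ⟨a, c, rfl⟩ := hp
  refine ⟨r • a, r * c, ?_⟩
  funext y
  simp only [Pi.smul_apply, smul_eq_mul, real_inner_smul_left]
  ring

lemma IsAff.zero {n : ℕ} : IsAff (0 : Vn n → ℝ) := ⟨0, 0, by funext y; simp⟩

/-- The properties of the functional transported to the dual side. -/
structure DualVal (n m : ℕ) (Y : (Vn n → ℝ) → ℝ) : Prop where
  val : ∀ a b : Vn n → ℝ, Cvx a → Cvx b → Cvx (a ⊓ b) → Y (a ⊔ b) + Y (a ⊓ b) = Y a + Y b
  inv : ∀ v p : Vn n → ℝ, Cvx v → IsAff p → Y (v + p) = Y v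
  cont : ∀ (vk : ℕ → Vn n → ℝ) (v : Vn n → ℝ), (∀ k, Cvx (vk k)) → Cvx v →
    (∀ y, Tendsto (fun k => vk k y) atTop (𝓝 (v y))) → Tendsto (fun k => Y (vk k)) atTop (𝓝 (Y v))
  hom : ∀ v : Vn n → ℝ, Cvx v → ∀ l : ℝ, 0 < l → Y (l • v) = l ^ m * Y v

/-- Iterated finite differences. -/
def DD {n : ℕ} (Y : (Vn n → ℝ) → ℝ) : List (Vn n → ℝ) → (Vn n → ℝ) → ℝ
  | [], w => Y w
  | h :: t, w => DD Y t (w + h) - DD Y t w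

section
variable {n : ℕ} {Y : (Vn n → ℝ) → ℝ}

lemma DD_perm {t t' : List (Vn n → ℝ)} (h : t.Perm t') : ∀ w, DD Y t w = DD Y t' w := by
  induction h with
  | nil => intro w; rfl
  | cons x _ ih => intro w; simp only [DD, ih]
  | swap x y l =>
    intro w
    simp only [DD]
    rw [add_right_comm w y x]
    ring
  | trans _ _ ih1 ih2 => intro w; rw [ih1, ih2]

variable {m : ℕ}

lemma DD_tendsto (hY : DualVal n m Y) {ι : Type*} (I : List ι) (F : ℕ → ι → Vn n → ℝ) (G : ι → Vn n → ℝ)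
    (hF : ∀ k i, Cvx (F k i)) (hG : ∀ i, Cvx (G i))
    (hlim : ∀ i y, Tendsto (fun k => F k i y) atTop (𝓝 (G i y))) :
    ∀ (wk : ℕ → Vn n → ℝ) (w : Vn n → ℝ), (∀ k, Cvx (wk k)) → Cvx w →
      (∀ y, Tendsto (fun k => wk k y) atTop (𝓝 (w y))) →
      Tendsto (fun k => DD Y (I.map (F k)) (wk k)) atTop (𝓝 (DD Y (I.map G) w)) := by
  induction I with
  | nil => intro wk w h1 h2 h3; exact hY.cont wk w h1 h2 h3
  | cons i I ih =>
    intro wk w h1 h2 h3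
    simp only [List.map_cons, DD]
    refine Tendsto.sub (ih _ _ (fun k => (h1 k).add (hF k i)) (h2.add (hG i)) ?_) (ih _ _ h1 h2 h3)
    intro y
    exact (h3 y).add (hlim i y)

lemma DD_aff (hY : DualVal n m Y) {ι : Type*} (I : List ι) (F P : ι → Vn n → ℝ)
    (hF : ∀ i, Cvx (F i)) (hP : ∀ i, IsAff (P i)) :
    ∀ (w p : Vn n → ℝ), Cvx w → IsAff p →
      DD Y (I.map (fun i => F i + P i)) (w + p) = DD Y (I.map F) w := by
  induction I with
  | nil => intro w p h1 h2; exact hY.inv w p h1 h2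
  | cons i I ih =>
    intro w p h1 h2
    simp only [List.map_cons, DD]
    rw [ih w p h1 h2, ← ih (w + F i) (p + P i) (h1.add (hF i)) (h2.add (hP i)),
      add_add_add_comm w p]

lemma DD_val (hY : DualVal n m Y) (I : List (Option (Vn n → ℝ))) (hI : ∀ o ∈ I, ∀ r ∈ o, Cvx r)
    (a b : Vn n → ℝ) (ha : Cvx a) (hb : Cvx b) (hab : Cvx (a ⊓ b)) (hab' : Cvx (a ⊔ b)) :
    ∀ (c : ℕ) (w : Vn n → ℝ), Cvx w →
      DD Y (I.map (fun o => o.getD (a ⊔ b))) (w + (c : ℝ) • (a ⊔ b)) +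
        DD Y (I.map (fun o => o.getD (a ⊓ b))) (w + (c : ℝ) • (a ⊓ b)) =
      DD Y (I.map (fun o => o.getD a)) (w + (c : ℝ) • a) +
        DD Y (I.map (fun o => o.getD b)) (w + (c : ℝ) • b) := by
  induction I with
  | nil =>
    intro c w hw
    have hc : (0 : ℝ) ≤ c := Nat.cast_nonneg c
    have e1 : w + (c : ℝ) • (a ⊔ b) = (w + (c : ℝ) • a) ⊔ (w + (c : ℝ) • b) := by
      funext y
      simp only [Pi.add_apply, Pi.smul_apply, Pi.sup_apply, smul_eq_mul]
      rw [mul_max_of_nonneg _ _ hc, max_add_add_left]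
    have e2 : w + (c : ℝ) • (a ⊓ b) = (w + (c : ℝ) • a) ⊓ (w + (c : ℝ) • b) := by
      funext y
      simp only [Pi.add_apply, Pi.smul_apply, Pi.inf_apply, smul_eq_mul]
      rw [mul_min_of_nonneg _ _ hc, min_add_add_left]
    simp only [List.map_nil, DD]
    have e3 : Cvx ((w + (c : ℝ) • a) ⊓ (w + (c : ℝ) • b)) := by
      rw [← e2]; exact hw.add (hab.smul hc)
    rw [e1, e2]
    exact hY.val _ _ (hw.add (ha.smul hc)) (hw.add (hb.smul hc)) e3
  | cons o I ih =>
    intro c w hw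
    have ih' := ih (fun o ho => hI o (List.mem_cons_of_mem _ ho))
    cases o with
    | none =>
      simp only [List.map_cons, DD, Option.getD_none]
      have e : ∀ u : Vn n → ℝ, w + (c : ℝ) • u + u = w + ((c + 1 : ℕ) : ℝ) • u := by
        intro u
        rw [Nat.cast_succ, add_smul, one_smul, add_assoc]
      simp only [e]
      linarith [ih' c w hw, ih' (c + 1) w hw]
    | some r =>
      simp only [List.map_cons, DD, Option.getD_some]
      have hr : Cvx r := hI (some r) List.mem_cons_self r rfl
      simp only [add_right_comm w _ r]
      linarith [ih' c w hw, ih' c (w + r) (hw.add hr)]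

lemma Y_zero (hY : DualVal n m Y) (hm : 1 ≤ m) : Y 0 = 0 := by
  have h := hY.hom 0 Cvx.zero (1 / 2) (by norm_num)
  rw [smul_zero] at h
  have h2 : ((1 : ℝ) / 2) ^ m < 1 := pow_lt_one₀ (by norm_num) (by norm_num) (by omega)
  have h3 : (1 - ((1 : ℝ) / 2) ^ m) * Y 0 = 0 := by linarith
  rcases mul_eq_zero.1 h3 with h4 | h4
  · linarith
  · exact h4

/-- Ridge functions. -/
lemma ridge_cvx (hY : DualVal n m Y) {p : Vn n → ℝ} (hp : IsAff p) : Cvx (0 ⊔ p) := ConvexOn.sup Cvx.zero hp.cvx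

lemma half_ridge (p : Vn n → ℝ) : (1 / 2 : ℝ) • (0 ⊔ p) = 0 ⊔ ((1 / 2 : ℝ) • p) := by
  funext y
  simp only [Pi.smul_apply, Pi.sup_apply, Pi.zero_apply, smul_eq_mul]
  rw [mul_max_of_nonneg _ _ (by norm_num), mul_zero]

lemma Y_half (hY : DualVal n m Y) {p : Vn n → ℝ} (hp : IsAff p) {w : Vn n → ℝ} (hw : Cvx w) :
    Y (w + (0 ⊔ p)) + Y w = 2 * Y (w + (1 / 2 : ℝ) • (0 ⊔ p)) := by
  set q : Vn n → ℝ := (1 / 2 : ℝ) • p with hq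
  have hqa : IsAff q := hp.smul _
  have hg : Cvx (w + (0 ⊔ q)) := hw.add (ridge_cvx hY hqa)
  have e1 : w + (0 ⊔ p) = (w + (0 ⊔ q)) ⊔ (w + (0 ⊔ q) + q) := by
    funext y
    simp only [hq, Pi.add_apply, Pi.smul_apply, Pi.sup_apply, Pi.zero_apply, smul_eq_mul]
    rcases le_total 0 (p y) with h | h
    · rw [max_eq_right h, max_eq_right (a := (0 : ℝ)) (by linarith), max_eq_right (by linarith)]
      ring
    · rw [max_eq_left h, max_eq_left (a := (0 : ℝ)) (by linarith), max_eq_left (by linarith)]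
  have e2 : w + q = (w + (0 ⊔ q)) ⊓ (w + (0 ⊔ q) + q) := by
    funext y
    simp only [Pi.add_apply, Pi.inf_apply, Pi.sup_apply, Pi.zero_apply]
    rcases le_total 0 (q y) with h | h
    · rw [max_eq_right h, min_eq_left (by linarith)]
    · rw [max_eq_left h, min_eq_right (by linarith)]; ring
  have h := hY.val (w + (0 ⊔ q)) (w + (0 ⊔ q) + q) hg (hg.add hqa.cvx)
    (by rw [← e2]; exact hw.add hqa.cvx)
  rw [← e1, ← e2, hY.inv _ _ hw hqa, hY.inv _ _ hg hqa] at h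
  rw [half_ridge, h]
  ring

lemma DD_half (hY : DualVal n m Y) {p : Vn n → ℝ} (hp : IsAff p) (t : List (Vn n → ℝ)) (ht : ∀ h ∈ t, Cvx h) :
    ∀ w : Vn n → ℝ, Cvx w →
    DD Y t (w + (0 ⊔ p)) + DD Y t w = 2 * DD Y t (w + (1 / 2 : ℝ) • (0 ⊔ p)) := by
  induction t with
  | nil => intro w hw; exact Y_half hY hp hw
  | cons h t ih =>
    intro w hw
    have ih' := ih (fun h' hh => ht h' (List.mem_cons_of_mem _ hh))
    simp only [DD, add_right_comm w _ h]
    linarith [ih' w hw, ih' (w + h) (hw.add (ht h List.mem_cons_self))]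

lemma DD_map_half (hY : DualVal n m Y) (t : List (Vn n → ℝ)) (ht : ∀ h ∈ t, ∃ p, IsAff p ∧ h = 0 ⊔ p) :
    ∀ w : Vn n → ℝ, Cvx w →
    2 ^ t.length * DD Y (t.map (fun h => (1 / 2 : ℝ) • h)) w = DD Y t w := by
  induction t with
  | nil => intro w hw; simp [DD]
  | cons h t ih =>
    intro w hw
    have ih' := ih (fun h' hh => ht h' (List.mem_cons_of_mem _ hh))
    obtain ⟨p, hp, rfl⟩ := ht h List.mem_cons_self
    have htc : ∀ h ∈ t, Cvx h := by
      intro h' hh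
      obtain ⟨q, hq, rfl⟩ := ht h' (List.mem_cons_of_mem _ hh)
      exact ridge_cvx hY hq
    simp only [List.map_cons, DD, List.length_cons, pow_succ]
    have h1 := ih' w hw
    have h2 := ih' (w + (1 / 2 : ℝ) • (0 ⊔ p)) (hw.add ((ridge_cvx hY hp).smul (by norm_num)))
    have h3 := DD_half hY hp t htc w hw
    linear_combination 2 * h2 - 2 * h1 - h3

lemma DD_hom_half (hY : DualVal n m Y) (t : List (Vn n → ℝ)) (ht : ∀ h ∈ t, Cvx h) :
    ∀ w : Vn n → ℝ, Cvx w →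
    DD Y (t.map (fun h => (1 / 2 : ℝ) • h)) ((1 / 2 : ℝ) • w) = (1 / 2) ^ m * DD Y t w := by
  induction t with
  | nil => intro w hw; exact hY.hom w hw _ (by norm_num)
  | cons h t ih =>
    intro w hw
    have ih' := ih (fun h' hh => ht h' (List.mem_cons_of_mem _ hh))
    simp only [List.map_cons, DD]
    rw [← smul_add, ih' w hw, ih' (w + h) (hw.add (ht h List.mem_cons_self))]
    ring

lemma DD_ridge_vanish (hY : DualVal n m Y) (t : List (Vn n → ℝ)) (ht : ∀ h ∈ t, ∃ p, IsAff p ∧ h = 0 ⊔ p)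
    (hlen : t.length = m + 1) (w : Vn n → ℝ) (hw : Cvx w) : DD Y t w = 0 := by
  have htc : ∀ h ∈ t, Cvx h := by
    intro h' hh
    obtain ⟨q, hq, rfl⟩ := ht h' hh
    exact ridge_cvx hY hq
  have step : ∀ w : Vn n → ℝ, Cvx w → DD Y t w = (1 / 2) * DD Y t ((1 / 2 : ℝ) • w) := by
    intro w hw
    have h1 := DD_map_half hY t ht ((1 / 2 : ℝ) • w) (hw.smul (by norm_num))
    have h2 := DD_hom_half hY t htc w hw
    rw [h2, hlen, pow_succ] at h1
    rw [← h1]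
    have : (2 : ℝ) ^ m * (1 / 2) ^ m = 1 := by rw [← mul_pow]; norm_num
    linear_combination (- DD Y t w) * this
  have iter : ∀ k : ℕ, DD Y t w = (1 / 2) ^ k * DD Y t (((1 / 2 : ℝ) ^ k) • w) := by
    intro k
    induction k with
    | zero => simp
    | succ k ih =>
      rw [ih, step _ (hw.smul (by positivity)), smul_smul, pow_succ']
      ring
  have hp : Tendsto (fun k : ℕ => (1 / 2 : ℝ) ^ k) atTop (𝓝 0) :=
    tendsto_pow_atTop_nhds_zero_of_lt_one (by norm_num) (by norm_num)
  have hl : Tendsto (fun k : ℕ => DD Y t (((1 / 2 : ℝ) ^ k) • w)) atTop (𝓝 (DD Y t 0)) := by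
    have := DD_tendsto hY (t.attach) (fun _ i => i.1) (fun i => i.1)
      (fun _ i => htc _ i.2) (fun i => htc _ i.2) (fun i y => tendsto_const_nhds)
      (fun k => ((1 / 2 : ℝ) ^ k) • w) 0 (fun k => hw.smul (by positivity)) Cvx.zero
      (by
        intro y
        simpa using hp.mul_const (w y))
    simpa using this
  have h0 : Tendsto (fun _ : ℕ => DD Y t w) atTop (𝓝 (0 * DD Y t 0)) :=
    (hp.mul hl).congr (fun k => (iter k).symm)
  simpa using tendsto_nhds_unique tendsto_const_nhds h0

end

/-- The closure properties used in the density argument. -/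
structure Dens {n : ℕ} (A : Set (Vn n → ℝ)) : Prop where
  cvx : ∀ f ∈ A, Cvx f
  aff : ∀ p, IsAff p → p ∈ A
  ridge : ∀ p, IsAff p → 0 ⊔ p ∈ A
  add : ∀ f ∈ A, ∀ g ∈ A, f + g ∈ A
  lim : ∀ (fk : ℕ → Vn n → ℝ) (f : Vn n → ℝ), (∀ k, fk k ∈ A) → Cvx f →
    (∀ y, Tendsto (fun k => fk k y) atTop (𝓝 (f y))) → f ∈ A
  sub : ∀ v g, Cvx v → g ∈ A → v + g ∈ A → v ∈ A

section
variable {n : ℕ} {A : Set (Vn n → ℝ)}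

lemma nodes (hA : Dens A) (φ : ℝ → ℝ) (hφ : ConvexOn ℝ Set.univ φ) (r0 δ : ℝ) (hδ : 0 < δ) (p : ℕ) :
    ∃ ψ : ℝ → ℝ, (∀ a : Vn n, (fun y => ψ (inner ℝ a y)) ∈ A) ∧
      (∀ i ≤ p, ∀ s, r0 + i * δ ≤ s → s ≤ r0 + (i + 1) * δ →
        ψ s = φ (r0 + i * δ) +
          (φ (r0 + (i + 1) * δ) - φ (r0 + i * δ)) / δ * (s - (r0 + i * δ))) ∧
      (∀ s, r0 + p * δ ≤ s → ψ s = φ (r0 + p * δ) +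
          (φ (r0 + (p + 1) * δ) - φ (r0 + p * δ)) / δ * (s - (r0 + p * δ))) := by
  induction p with
  | zero =>
    refine ⟨fun s => φ r0 + (φ (r0 + δ) - φ r0) / δ * (s - r0), ?_, ?_, ?_⟩
    · intro a
      refine hA.aff _ ⟨((φ (r0 + δ) - φ r0) / δ) • a, φ r0 - (φ (r0 + δ) - φ r0) / δ * r0, ?_⟩
      funext y
      rw [real_inner_smul_left]
      ring
    · intro i hi s _ _
      obtain rfl : i = 0 := by omega
      simp
    · intro s _
      simp
  | succ p ih =>
    obtain ⟨ψ, h1, h2, h3⟩ := ih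
    set r : ℝ := r0 + (p + 1) * δ with hr
    set c : ℝ := (φ (r0 + (p + 1 + 1) * δ) - φ r) / δ - (φ r - φ (r0 + p * δ)) / δ with hc
    have hc0 : 0 ≤ c := by
      have := hφ.2 (Set.mem_univ (r0 + p * δ)) (Set.mem_univ (r0 + (p + 1 + 1) * δ))
        (show (0 : ℝ) ≤ 1 / 2 by norm_num) (show (0 : ℝ) ≤ 1 / 2 by norm_num) (by norm_num)
      simp only [smul_eq_mul] at this
      have e : 1 / 2 * (r0 + p * δ) + 1 / 2 * (r0 + (p + 1 + 1) * δ) = r := by rw [hr]; ring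
      rw [e] at this
      rw [hc, ← sub_div]
      apply div_nonneg _ hδ.le
      linarith
    refine ⟨fun s => ψ s + c * max 0 (s - r), ?_, ?_, ?_⟩
    · intro a
      have := hA.add _ (h1 a) _ (hA.ridge (fun y => inner ℝ (c • a) y + (-c * r)) ⟨_, _, rfl⟩)
      convert this using 1
      funext y
      simp only [Pi.add_apply, Pi.sup_apply, Pi.zero_apply, real_inner_smul_left]
      rw [mul_max_of_nonneg _ _ hc0, mul_zero]
      ring_nf
    · intro i hi s hs1 hs2
      rcases Nat.lt_or_ge p i with h | h
      · obtain rfl : i = p + 1 := by omega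
        push_cast at hs1 hs2 ⊢
        have hpr : r0 + p * δ ≤ s := by nlinarith
        rw [h3 s hpr, max_eq_right (by linarith), ← hr]
        rw [hc]
        have : r0 + p * δ = r - δ := by rw [hr]; ring
        rw [this]
        field_simp
        ring
      · have hir : r0 + (i + 1) * δ ≤ r := by
          rw [hr]
          have : (i : ℝ) ≤ p := by exact_mod_cast h
          nlinarith
        beta_reduce
        rw [max_eq_left (a := (0 : ℝ)) (b := s - r) (by linarith), mul_zero, add_zero]
        exact h2 i h s hs1 hs2
    · intro s hs1
      push_cast at hs1 ⊢
      have hpr : r0 + p * δ ≤ s := by nlinarith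
      rw [h3 s hpr, max_eq_right (by linarith), ← hr]
      rw [hc]
      have : r0 + p * δ = r - δ := by rw [hr]; ring
      rw [this]
      field_simp
      ring

lemma oneD (hA : Dens A) (φ : ℝ → ℝ) (hφ : ConvexOn ℝ Set.univ φ) (a : Vn n) :
    (fun y => φ (inner ℝ a y)) ∈ A := by
  have hcont : Continuous φ := by
    rw [← continuousOn_univ]
    exact hφ.continuousOn isOpen_univ
  have H : ∀ k : ℕ, ∃ ψ : ℝ → ℝ, (∀ a : Vn n, (fun y => ψ (inner ℝ a y)) ∈ A) ∧
      ∀ s : ℝ, |s| < k → ∃ s1 s2 t : ℝ, |s1 - s| ≤ 1 / ((k : ℝ) + 1) ∧ |s2 - s| ≤ 1 / ((k : ℝ) + 1) ∧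
        0 ≤ t ∧ t ≤ 1 ∧ ψ s = (1 - t) * φ s1 + t * φ s2 := by
    intro k
    have hk : (0 : ℝ) < (k : ℝ) + 1 := by positivity
    obtain ⟨ψ, h1, h2, -⟩ := nodes hA φ hφ (-k) (1 / ((k : ℝ) + 1)) (by positivity) (2 * k * (k + 1))
    refine ⟨ψ, h1, ?_⟩
    intro s hs
    rw [abs_lt] at hs
    set i : ℕ := ⌊(s + k) * (k + 1)⌋₊ with hi
    have hnn : 0 ≤ (s + k) * ((k : ℝ) + 1) := mul_nonneg (by linarith) hk.le
    have hi1 : (i : ℝ) ≤ (s + k) * (k + 1) := Nat.floor_le hnn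
    have hi2 : (s + k) * (k + 1) < i + 1 := Nat.lt_floor_add_one _
    have hip : i ≤ 2 * k * (k + 1) := by
      have : (i : ℝ) ≤ 2 * k * (k + 1) := by nlinarith
      exact_mod_cast this
    have a1 : -(k : ℝ) + i * (1 / ((k : ℝ) + 1)) ≤ s := by
      have : (i : ℝ) / (k + 1) ≤ s + k := by rw [div_le_iff₀ hk]; exact hi1
      rw [mul_one_div]; linarith
    have a2 : s ≤ -(k : ℝ) + (i + 1) * (1 / ((k : ℝ) + 1)) := by
      have : s + k ≤ ((i : ℝ) + 1) / (k + 1) := by rw [le_div_iff₀ hk]; exact hi2.le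
      rw [mul_one_div]; linarith
    set δ := 1 / ((k : ℝ) + 1) with hδ
    have hδ0 : 0 < δ := by positivity
    refine ⟨-(k : ℝ) + i * δ, -(k : ℝ) + (i + 1) * δ, (s - (-(k : ℝ) + i * δ)) / δ, ?_, ?_, ?_, ?_, ?_⟩
    · rw [abs_le]; constructor <;> nlinarith
    · rw [abs_le]; constructor <;> nlinarith
    · apply div_nonneg _ hδ0.le; linarith
    · rw [div_le_one hδ0]; nlinarith
    · rw [h2 i hip s a1 a2]
      field_simp
      ring
  choose ψ h1 h2 using H
  refine hA.lim (fun k y => ψ k (inner ℝ a y)) _ (fun k => h1 k a) ?_ ?_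
  · exact hφ.comp_linearMap (innerₛₗ ℝ a)
  · intro y
    set s := inner ℝ a y
    rw [Metric.tendsto_atTop]
    intro ε hε
    obtain ⟨η, hη, hηε⟩ := Metric.continuous_iff.1 hcont s (ε / 2) (by positivity)
    obtain ⟨N1, hN1⟩ := exists_nat_gt |s|
    obtain ⟨N2, hN2⟩ := exists_nat_one_div_lt hη
    refine ⟨max N1 N2, fun k hk => ?_⟩
    have hk1 : |s| < k := hN1.trans_le (by exact_mod_cast (le_max_left _ _).trans hk)
    have hk2 : 1 / ((k : ℝ) + 1) < η := by
      refine lt_of_le_of_lt ?_ hN2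
      apply one_div_le_one_div_of_le (by positivity)
      have : (N2 : ℝ) ≤ k := by exact_mod_cast (le_max_right _ _).trans hk
      linarith
    obtain ⟨s1, s2, t, b1, b2, t0, t1, e⟩ := h2 k s hk1
    have c1 := hηε s1 (by rw [Real.dist_eq]; linarith)
    have c2 := hηε s2 (by rw [Real.dist_eq]; linarith)
    rw [Real.dist_eq, abs_lt] at c1 c2
    rw [Real.dist_eq, e, abs_lt]
    constructor <;> nlinarith

lemma trig_cvx (α β : ℝ) :
    ConvexOn ℝ Set.univ (fun s : ℝ => α * Real.cos s + β * Real.sin s + (|α| + |β|) * s ^ 2 / 2) := by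
  have d1 : ∀ s : ℝ, HasDerivAt
      (fun s : ℝ => α * Real.cos s + β * Real.sin s + (|α| + |β|) * s ^ 2 / 2)
      (α * -Real.sin s + β * Real.cos s + (|α| + |β|) * s) s := by
    intro s
    have := (((Real.hasDerivAt_cos s).const_mul α).add ((Real.hasDerivAt_sin s).const_mul β)).add
      ((((hasDerivAt_id s).pow 2).const_mul (|α| + |β|)).div_const 2)
    refine this.congr_deriv ?_
    simp
    ring
  have d2 : ∀ s : ℝ, HasDerivAt
      (fun s : ℝ => α * -Real.sin s + β * Real.cos s + (|α| + |β|) * s)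
      (α * -Real.cos s + β * -Real.sin s + (|α| + |β|)) s := by
    intro s
    have := (((Real.hasDerivAt_sin s).neg.const_mul α).add ((Real.hasDerivAt_cos s).const_mul β)).add
      ((hasDerivAt_id s).const_mul (|α| + |β|))
    refine this.congr_deriv ?_
    simp
  have e1 : deriv (fun s : ℝ => α * Real.cos s + β * Real.sin s + (|α| + |β|) * s ^ 2 / 2) =
      fun s => α * -Real.sin s + β * Real.cos s + (|α| + |β|) * s := funext fun s => (d1 s).deriv
  refine convexOn_univ_of_deriv2_nonneg (fun s => (d1 s).differentiableAt) ?_ ?_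
  · rw [e1]; exact fun s => (d2 s).differentiableAt
  · intro s
    simp only [Function.iterate_succ, Function.iterate_zero, Function.comp, id]
    rw [e1, (d2 s).deriv]
    have h1 : |α * Real.cos s| ≤ |α| := by
      rw [abs_mul]
      exact mul_le_of_le_one_right (abs_nonneg _) (Real.abs_cos_le_one s)
    have h2 : |β * Real.sin s| ≤ |β| := by
      rw [abs_mul]
      exact mul_le_of_le_one_right (abs_nonneg _) (Real.abs_sin_le_one s)
    have := le_abs_self (α * Real.cos s)
    have := le_abs_self (β * Real.sin s)
    linarith

lemma sq_cvx (c : ℝ) (hc : 0 ≤ c) : ConvexOn ℝ Set.univ (fun s : ℝ => c * s ^ 2 / 2) := by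
  have := (Even.convexOn_pow (𝕜 := ℝ) (n := 2) even_two).smul (c := c / 2) (by positivity)
  have e : (fun s : ℝ => c * s ^ 2 / 2) = fun s : ℝ => (c / 2) • s ^ 2 := by
    funext s
    simp only [smul_eq_mul]
    ring
  rw [e]
  exact this

/-- Differences of elements of `A`. -/
def InW (A : Set (Vn n → ℝ)) (f : Vn n → ℝ) : Prop := ∃ g ∈ A, f + g ∈ A

lemma InW.add' (hA : Dens A) {f f' : Vn n → ℝ} (h : InW A f) (h' : InW A f') : InW A (f + f') := by
  obtain ⟨g, hg, h⟩ := h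
  obtain ⟨g', hg', h'⟩ := h'
  refine ⟨g + g', hA.add _ hg _ hg', ?_⟩
  rw [add_add_add_comm]
  exact hA.add _ h _ h'

lemma InW_trig (hA : Dens A) (α β : ℝ) (a : Vn n) :
    InW A (fun x => α * Real.cos (inner ℝ a x) + β * Real.sin (inner ℝ a x)) :=
  ⟨_, oneD hA _ (sq_cvx (|α| + |β|) (by positivity)) a, oneD hA _ (trig_cvx α β) a⟩

lemma InW_zero (hA : Dens A) : InW A (0 : Vn n → ℝ) := ⟨0, hA.aff _ IsAff.zero, by
  rw [add_zero]; exact hA.aff _ IsAff.zero⟩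

lemma sqnorm_mem (hA : Dens A) : (fun x : Vn n => ‖x‖ ^ 2 / 2) ∈ A := by
  have : ∀ s : Finset (Fin n), (fun x : Vn n => ∑ i ∈ s, 1 * (x i) ^ 2 / 2) ∈ A := by
    intro s
    induction s using Finset.induction_on with
    | empty =>
      simp only [Finset.sum_empty]
      exact hA.aff _ IsAff.zero
    | insert i s hi ih =>
      have h := hA.add _ (oneD hA _ (sq_cvx 1 (by norm_num)) (EuclideanSpace.single i (1 : ℝ))) _ ih
      convert h using 1
      funext x
      rw [Finset.sum_insert hi]
      simp [EuclideanSpace.inner_single_left]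
  convert this Finset.univ using 1
  funext x
  rw [EuclideanSpace.norm_sq_eq, Finset.sum_div]
  simp

end

section
variable {n : ℕ} {A : Set (Vn n → ℝ)}

/-- Projection to the torus of period `L`. -/
def toT (L : ℝ) (x : Vn n) : UnitAddTorus (Fin n) := fun i => ((x i / L : ℝ) : UnitAddCircle)

lemma toT_add (L : ℝ) (x y : Vn n) : toT L (x + y) = toT L x + toT L y := by
  funext i
  simp [toT, add_div]

lemma toT_quot {L : ℝ} (hL : 0 < L) : IsOpenQuotientMap (toT (n := n) L) := by
  have h1 : IsOpenQuotientMap (Pi.map (fun (_ : Fin n) (s : ℝ) => (s : UnitAddCircle))) :=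
    IsOpenQuotientMap.piMap (fun i => QuotientAddGroup.isOpenQuotientMap_mk)
  have h2 := ((EuclideanSpace.equiv (Fin n) ℝ).toHomeomorph.trans
    (Homeomorph.smulOfNeZero (L⁻¹) (inv_ne_zero hL.ne'))).isOpenQuotientMap
  have := h1.comp h2
  convert this using 1
  funext x i
  simp [toT, div_eq_inv_mul]

lemma mFourier_toT (L : ℝ) (ν : Fin n → ℤ) (x : Vn n) :
    UnitAddTorus.mFourier ν (toT L x) =
      Complex.exp (((inner ℝ (WithLp.toLp 2 (fun i => 2 * Real.pi * ν i / L) : Vn n) x : ℝ) : ℂ) *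
        Complex.I) := by
  simp only [UnitAddTorus.mFourier, ContinuousMap.coe_mk, toT]
  simp only [fourier_coe_apply, PiLp.inner_apply]
  rw [← Complex.exp_sum]
  congr 1
  push_cast
  rw [Finset.sum_mul]
  apply Finset.sum_congr rfl
  intro i _
  simp
  ring

lemma mFourier_sub (ν : Fin n → ℤ) (z w : UnitAddTorus (Fin n)) :
    UnitAddTorus.mFourier ν (z - w) =
      UnitAddTorus.mFourier ν z * (starRingEnd ℂ) (UnitAddTorus.mFourier ν w) := by
  simp only [UnitAddTorus.mFourier, ContinuousMap.coe_mk, map_prod, ← Finset.prod_mul_distrib]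
  apply Finset.prod_congr rfl
  intro i _
  rw [← fourier_neg]
  simp [fourier_apply, sub_eq_add_neg, AddCircle.toCircle_add, AddCircle.toCircle_neg]

lemma int_cont {E : Type*} [NormedAddCommGroup E] {f : UnitAddTorus (Fin n) → E}
    (hf : Continuous f) : Integrable f :=
  hf.integrable_of_hasCompactSupport (HasCompactSupport.of_compactSpace f)

lemma conv_InW (hA : Dens A) (L : ℝ) (F : UnitAddTorus (Fin n) → ℝ) (hF : Continuous F)
    (k : C(UnitAddTorus (Fin n), ℂ))
    (hk : k ∈ Submodule.span ℂ (Set.range (UnitAddTorus.mFourier (d := Fin n)))) :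
    ∀ c : ℂ, InW A (fun x => (c * ∫ z, (F z : ℂ) * k (z - toT L x)).re) := by
  induction hk using Submodule.span_induction with
  | mem k hk =>
    obtain ⟨ν, rfl⟩ := hk
    intro c
    set C : ℂ := c * ∫ z, (F z : ℂ) * UnitAddTorus.mFourier ν z with hC
    have := InW_trig hA C.re C.im (WithLp.toLp 2 (fun i => 2 * Real.pi * ν i / L) : Vn n)
    convert this using 1
    funext x
    have e : (∫ z, (F z : ℂ) * UnitAddTorus.mFourier ν (z - toT L x)) =
        (∫ z, (F z : ℂ) * UnitAddTorus.mFourier ν z) *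
          (starRingEnd ℂ) (UnitAddTorus.mFourier ν (toT L x)) := by
      rw [← integral_mul_const]
      congr 1
      funext z
      rw [mFourier_sub, mul_assoc]
    rw [e, ← mul_assoc, ← hC, mFourier_toT, Complex.mul_re, Complex.conj_re, Complex.conj_im,
      Complex.exp_ofReal_mul_I_re, Complex.exp_ofReal_mul_I_im]
    ring
  | zero =>
    intro c
    have := InW_zero hA
    convert this using 1
    funext x
    simp
  | add k k' _ _ h h' =>
    intro c
    have := InW.add' hA (h c) (h' c)
    convert this using 1
    funext x
    have e : (∫ z, (F z : ℂ) * (k + k') (z - toT L x)) =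
        (∫ z, (F z : ℂ) * k (z - toT L x)) + ∫ z, (F z : ℂ) * k' (z - toT L x) := by
      rw [← integral_add]
      · simp [mul_add]
      · exact int_cont (by fun_prop)
      · exact int_cont (by fun_prop)
    simp only [Pi.add_apply]
    rw [e, mul_add, Complex.add_re]
  | smul r k _ h =>
    intro c
    have := h (c * r)
    convert this using 1
    funext x
    have e : (∫ z, (F z : ℂ) * (r • k) (z - toT L x)) =
        r * ∫ z, (F z : ℂ) * k (z - toT L x) := by
      rw [← integral_const_mul]
      congr 1
      funext z
      simp
      ring
    rw [e, mul_assoc]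

/-- The kernel. -/
def kC (n : ℕ) : C(UnitAddTorus (Fin n), ℂ) :=
  ∏ i, ((1 / 2 : ℂ) • (1 : C(UnitAddTorus (Fin n), ℂ)) + (1 / 4 : ℂ) •
    (UnitAddTorus.mFourier (Pi.single i 1) + UnitAddTorus.mFourier (-Pi.single i 1)))

def kR (n : ℕ) (z : UnitAddTorus (Fin n)) : ℝ := ∏ i, (1 + (fourier 1 (z i) : ℂ).re) / 2

lemma kC_eq (z : UnitAddTorus (Fin n)) : kC n z = (kR n z : ℂ) := by
  simp only [kC, kR, ContinuousMap.coe_prod, Finset.prod_apply]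
  push_cast
  apply Finset.prod_congr rfl
  intro i _
  simp only [Pi.add_apply, Pi.smul_apply, Pi.one_apply,
    UnitAddTorus.mFourier_neg, UnitAddTorus.mFourier_single, smul_eq_mul, Complex.add_conj]
  push_cast
  ring

lemma kR_cont : Continuous (kR n) := by
  unfold kR
  fun_prop

lemma kR_fac (s : UnitAddCircle) : 0 ≤ (1 + (fourier 1 s : ℂ).re) / 2 ∧
    (1 + (fourier 1 s : ℂ).re) / 2 ≤ 1 ∧ (s ≠ 0 → (1 + (fourier 1 s : ℂ).re) / 2 < 1) := by
  have hn : ‖(fourier 1 s : ℂ)‖ = 1 := by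
    rw [fourier_one]; exact Circle.norm_coe _
  have h := Complex.abs_re_le_norm (fourier 1 s : ℂ)
  rw [hn, abs_le] at h
  refine ⟨by linarith [h.1], by linarith [h.2], fun hs => ?_⟩
  rcases lt_or_eq_of_le h.2 with h2 | h2
  · linarith
  · exfalso
    apply hs
    apply AddCircle.injective_toCircle (T := 1) one_ne_zero
    have : (fourier 1 s : ℂ) = 1 := by
      have h3 : (fourier 1 s : ℂ).re = ‖(fourier 1 s : ℂ)‖ := by rw [hn, h2]
      have h4 := Complex.re_eq_norm.1 h3
      have h5 := (Complex.nonneg_iff.1 h4).2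
      apply Complex.ext
      · rw [h2]; rfl
      · rw [← h5]; rfl
    rw [fourier_one] at this
    rw [AddCircle.toCircle_zero]
    exact Circle.ext this

lemma kR_nonneg (z : UnitAddTorus (Fin n)) : 0 ≤ kR n z :=
  Finset.prod_nonneg fun i _ => (kR_fac (z i)).1

lemma kR_zero : kR n 0 = 1 := by
  simp [kR]

lemma kR_lt (z : UnitAddTorus (Fin n)) (hz : z ≠ 0) : kR n z < kR n 0 := by
  rw [kR_zero]
  obtain ⟨i, hi⟩ := Function.ne_iff.1 hz
  unfold kR
  rw [← Finset.mul_prod_erase _ _ (Finset.mem_univ i)]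
  refine lt_of_le_of_lt (mul_le_of_le_one_right (kR_fac (z i)).1 ?_) ((kR_fac (z i)).2.2 hi)
  exact Finset.prod_le_one (fun j _ => (kR_fac (z j)).1) (fun j _ => (kR_fac (z j)).2.1)

lemma kC_mem (N : ℕ) :
    kC n ^ N ∈ Submodule.span ℂ (Set.range (UnitAddTorus.mFourier (d := Fin n))) := by
  rw [← UnitAddTorus.mFourierSubalgebra_coe]
  change kC n ^ N ∈ (UnitAddTorus.mFourierSubalgebra (Fin n)).toSubalgebra
  apply Subalgebra.pow_mem
  unfold kC
  apply Subalgebra.prod_mem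
  intro i _
  have hm : ∀ ν, UnitAddTorus.mFourier ν ∈
      (UnitAddTorus.mFourierSubalgebra (Fin n)).toSubalgebra := fun ν =>
    Algebra.subset_adjoin ⟨ν, rfl⟩
  exact Subalgebra.add_mem _ (Subalgebra.smul_mem _ (Subalgebra.one_mem _) _)
    (Subalgebra.smul_mem _ (Subalgebra.add_mem _ (hm _) (hm _)) _)

lemma kR_int_pos (N : ℕ) : 0 < ∫ z, kR n z ^ N := by
  have hc : Continuous fun z => kR n z ^ N := kR_cont.pow N
  rw [integral_pos_iff_support_of_nonneg (fun z => pow_nonneg (kR_nonneg z) N) (int_cont hc)]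
  exact hc.isOpen_support.measure_pos volume ⟨0, by simp [kR_zero]⟩

end

section
variable {n : ℕ} {A : Set (Vn n → ℝ)}

lemma Cvx.continuous {v : Vn n → ℝ} (hv : Cvx v) : Continuous v := by
  rw [← continuousOn_univ]
  exact ConvexOn.continuousOn isOpen_univ hv

lemma quad_shift (f : Vn n → ℝ) (y : Vn n) (hp : Cvx (fun x => f x + ‖x‖ ^ 2 / 2)) :
    Cvx (fun x => f (x + y) + ‖x‖ ^ 2 / 2) := by
  have h1 : Cvx (fun x => f (x + y) + ‖x + y‖ ^ 2 / 2) := by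
    have := ConvexOn.translate_left hp y
    simpa [Function.comp_def, Cvx] using this
  have h2 : IsAff (fun x : Vn n => inner ℝ (-y) x + (-(‖y‖ ^ 2 / 2))) := ⟨_, _, rfl⟩
  have := h1.add h2.cvx
  convert this using 1
  funext x
  simp only [Pi.add_apply]
  rw [norm_add_sq_real, inner_neg_left, real_inner_comm y x]
  ring

lemma periodic_mem (hA : Dens A) {L : ℝ} (hL : 0 < L) (f : Vn n → ℝ)
    (hper : ∀ x y : Vn n, toT L x = toT L y → f x = f y)
    (hp : Cvx (fun x => f x + ‖x‖ ^ 2 / 2)) : (fun x => f x + ‖x‖ ^ 2 / 2) ∈ A := by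
  have hfc : Continuous f := by
    have h := hp.continuous.sub (show Continuous (fun x : Vn n => ‖x‖ ^ 2 / 2) by fun_prop)
    convert h using 1
    funext x
    simp
  have hq := toT_quot (n := n) hL
  set out := Function.surjInv hq.surjective with hout
  have hout' : ∀ z, toT L (out z) = z := Function.surjInv_eq hq.surjective
  set F : UnitAddTorus (Fin n) → ℝ := fun z => f (out z) with hF
  have hFf : ∀ x, F (toT L x) = f x := fun x => hper _ _ (hout' _)
  have hFc : Continuous F := by
    rw [hq.isQuotientMap.continuous_iff]
    convert hfc using 1
    funext x
    exact hFf x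
  have hFs : ∀ x z, F (toT L x + z) = f (x + out z) := by
    intro x z
    rw [← hFf, toT_add, hout']
  have htc : Continuous (toT (n := n) L) := hq.continuous
  have hkc := kR_cont (n := n)
  -- the approximations
  set pN : ℕ → Vn n → ℝ := fun N x =>
    (∫ z, kR n z ^ N)⁻¹ • (∫ z, kR n z ^ N • F (toT L x + z)) + ‖x‖ ^ 2 / 2 with hpN
  have hint : ∀ N x, Integrable (fun z => kR n z ^ N • F (toT L x + z)) := fun N x =>
    int_cont (by fun_prop)
  have hint0 : ∀ N, Integrable (fun z => kR n z ^ N) := fun N => int_cont (by fun_prop)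
  refine hA.lim pN _ ?_ hp ?_
  · intro N
    have hc := kR_int_pos (n := n) N
    set c := ∫ z, kR n z ^ N with hcdef
    have hW := conv_InW hA L F hFc (kC n ^ N) (kC_mem N) ((c⁻¹ : ℝ) : ℂ)
    have hWe : ∀ x, ((((c⁻¹ : ℝ) : ℂ) * ∫ z, (F z : ℂ) * (kC n ^ N) (z - toT L x)).re) =
        c⁻¹ • ∫ z, kR n z ^ N • F (toT L x + z) := by
      intro x
      have e1 : (∫ z, kR n z ^ N • F (toT L x + z)) = ∫ z, kR n (z - toT L x) ^ N * F z := by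
        rw [← integral_add_left_eq_self (fun z => kR n (z - toT L x) ^ N * F z) (toT L x)]
        simp
      have e2 : (∫ z, (F z : ℂ) * (kC n ^ N) (z - toT L x)) =
          ((∫ z, kR n (z - toT L x) ^ N * F z : ℝ) : ℂ) := by
        rw [← integral_complex_ofReal]
        congr 1
        funext z
        rw [ContinuousMap.pow_apply, kC_eq]
        push_cast
        ring
      rw [e1, e2, ← Complex.ofReal_mul, Complex.ofReal_re, smul_eq_mul]
    simp only [hWe] at hW
    have hcv : Cvx (pN N) := by
      refine ⟨convex_univ, ?_⟩
      intro x _ y _ a b ha hb hab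
      have key : ∀ x, pN N x = c⁻¹ * ∫ z, kR n z ^ N * (f (x + out z) + ‖x‖ ^ 2 / 2) := by
        intro x
        have : (∫ z, kR n z ^ N * (f (x + out z) + ‖x‖ ^ 2 / 2)) =
            (∫ z, kR n z ^ N • F (toT L x + z)) + c * (‖x‖ ^ 2 / 2) := by
          rw [hcdef, ← integral_mul_const, ← integral_add (hint N x) ((hint0 N).mul_const _)]
          congr 1
          funext z
          rw [hFs, smul_eq_mul]
          ring
        rw [this, mul_add, ← mul_assoc, inv_mul_cancel₀ hc.ne', one_mul]
        rfl
      have hi : ∀ x, Integrable (fun z => kR n z ^ N * (f (x + out z) + ‖x‖ ^ 2 / 2)) := by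
        intro x
        have : (fun z => kR n z ^ N * (f (x + out z) + ‖x‖ ^ 2 / 2)) =
            fun z => kR n z ^ N * (F (toT L x + z) + ‖x‖ ^ 2 / 2) := by
          funext z; rw [hFs]
        rw [this]
        exact int_cont (by fun_prop)
      rw [key, key, key, smul_eq_mul, smul_eq_mul, mul_left_comm a, mul_left_comm b, ← mul_add]
      apply mul_le_mul_of_nonneg_left _ (inv_nonneg.2 hc.le)
      rw [← integral_const_mul, ← integral_const_mul,
        ← integral_add ((hi x).const_mul a) ((hi y).const_mul b)]
      apply integral_mono (hi _) (((hi x).const_mul a).add ((hi y).const_mul b))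
      intro z
      have := (quad_shift f (out z) hp).2 (Set.mem_univ x) (Set.mem_univ y) ha hb hab
      simp only [smul_eq_mul] at this
      have h2 := mul_le_mul_of_nonneg_left this (pow_nonneg (kR_nonneg z) N)
      simp only [Pi.add_apply]
      refine h2.trans (le_of_eq ?_)
      ring
    obtain ⟨g, hg, hfg⟩ := hW
    refine hA.sub _ g hcv hg ?_
    have := hA.add _ hfg _ (sqnorm_mem hA)
    convert this using 1
    funext x
    simp only [Pi.add_apply, hpN]
    ring
  · intro x
    have h := tendsto_setIntegral_pow_smul_of_unique_maximum_of_isCompact_of_continuousOn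
      (μ := (volume : Measure (UnitAddTorus (Fin n)))) (s := Set.univ) (x₀ := 0)
      (g := fun z => F (toT L x + z)) isCompact_univ
      (c := kR n) hkc.continuousOn (fun y _ hy => kR_lt y hy) (fun y _ => kR_nonneg y)
      (by rw [kR_zero]; norm_num) (by simp) (by fun_prop)
    simp only [Measure.restrict_univ, add_zero, hFf] at h
    exact h.add_const _

end

section
variable {n : ℕ} {A : Set (Vn n → ℝ)}

lemma Cvx.iSup {ι : Type*} [Nonempty ι] (F : ι → Vn n → ℝ) (hF : ∀ i, Cvx (F i))
    (hb : ∀ x, BddAbove (Set.range fun i => F i x)) : Cvx (fun x => ⨆ i, F i x) := by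
  refine ⟨convex_univ, ?_⟩
  intro x _ y _ a b ha hb' hab
  apply ciSup_le
  intro i
  refine ((hF i).2 (Set.mem_univ x) (Set.mem_univ y) ha hb' hab).trans ?_
  simp only [smul_eq_mul]
  have h1 := mul_le_mul_of_nonneg_left (le_ciSup (hb x) i) ha
  have h2 := mul_le_mul_of_nonneg_left (le_ciSup (hb y) i) hb'
  linarith

/-- Lattice vectors. -/
def lat (L : ℝ) (γ : Fin n → ℤ) : Vn n := WithLp.toLp 2 (fun i => L * γ i)

lemma lat_add (L : ℝ) (γ δ : Fin n → ℤ) : lat L (γ + δ) = lat L γ + lat L δ := by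
  ext i
  simp [lat, mul_add]

lemma toT_eq {L : ℝ} (hL : 0 < L) (x y : Vn n) (h : toT L x = toT L y) :
    ∃ γ, x = y + lat L γ := by
  have : ∀ i, ∃ γ : ℤ, x i = y i + L * γ := by
    intro i
    have h1 := congrFun h i
    simp only [toT] at h1
    have h2 : (((x i / L - y i / L : ℝ)) : UnitAddCircle) = 0 := by
      rw [AddCircle.coe_sub, h1, sub_self]
    rw [AddCircle.coe_eq_zero_iff] at h2
    obtain ⟨γ, hγ⟩ := h2
    refine ⟨γ, ?_⟩
    simp only [zsmul_eq_mul, mul_one] at hγ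
    rw [hγ]
    field_simp
    ring
  choose γ hγ using this
  refine ⟨γ, ?_⟩
  ext i
  simp [lat, hγ]

lemma lat_norm {L : ℝ} (hL : 0 < L) (γ : Fin n → ℤ) (h : γ ≠ 0) : L ≤ ‖(lat L γ : Vn n)‖ := by
  obtain ⟨i, hi⟩ := Function.ne_iff.1 h
  have h1 := PiLp.norm_apply_le (lat L γ : Vn n) i
  have h2 : ‖(lat L γ : Vn n) i‖ = L * |(γ i : ℝ)| := by
    simp [lat, abs_of_pos hL]
  have h3 : (1 : ℝ) ≤ |(γ i : ℝ)| := by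
    have : (1 : ℤ) ≤ |γ i| := Int.one_le_abs hi
    exact_mod_cast this
  rw [h2] at h1
  nlinarith

lemma lip_mem (hA : Dens A) (v : Vn n → ℝ) (hv : Cvx v) (Λ : ℝ)
    (hΛ : ∀ y h, v (y + h) ≤ v y + Λ * ‖h‖) : v ∈ A := by
  set q : Vn n → ℝ := fun z => v z - ‖z‖ ^ 2 / 2 with hq
  have hqv : Cvx (fun z => q z + ‖z‖ ^ 2 / 2) := by
    convert hv using 1
    funext z
    simp [hq]
  have hqb : ∀ z, q z ≤ v 0 + Λ ^ 2 / 2 := by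
    intro z
    have := hΛ 0 z
    rw [zero_add] at this
    simp only [hq]
    nlinarith [sq_nonneg (Λ - ‖z‖)]
  have hb : ∀ (L : ℝ) (x : Vn n), BddAbove (Set.range fun γ : Fin n → ℤ => q (x + lat L γ)) := by
    intro L x
    refine ⟨v 0 + Λ ^ 2 / 2, ?_⟩
    rintro _ ⟨γ, rfl⟩
    exact hqb _
  set f : ℝ → Vn n → ℝ := fun L x => ⨆ γ : Fin n → ℤ, q (x + lat L γ) with hf
  have hfe : ∀ L x, f L x + ‖x‖ ^ 2 / 2 = ⨆ γ : Fin n → ℤ, (q (x + lat L γ) + ‖x‖ ^ 2 / 2) := by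
    intro L x
    rw [hf]
    exact ciSup_add (hb L x) _
  have hb2 : ∀ (L : ℝ) (x : Vn n),
      BddAbove (Set.range fun γ : Fin n → ℤ => q (x + lat L γ) + ‖x‖ ^ 2 / 2) := by
    intro L x
    refine ⟨v 0 + Λ ^ 2 / 2 + ‖x‖ ^ 2 / 2, ?_⟩
    rintro _ ⟨γ, rfl⟩
    have := hqb (x + lat L γ)
    dsimp only
    linarith
  have hcv : ∀ L, Cvx (fun x => f L x + ‖x‖ ^ 2 / 2) := by
    intro L
    simp only [hfe]
    exact Cvx.iSup _ (fun γ => quad_shift q (lat L γ) hqv) (hb2 L)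
  refine hA.lim (fun k x => f ((k : ℝ) + 1) x + ‖x‖ ^ 2 / 2) v ?_ hv ?_
  · intro k
    have hL : (0 : ℝ) < (k : ℝ) + 1 := by positivity
    refine periodic_mem hA hL _ ?_ (hcv _)
    intro x y hxy
    obtain ⟨δ, rfl⟩ := toT_eq hL x y hxy
    simp only [hf]
    rw [← Equiv.iSup_comp (g := fun γ => q (y + lat ((k : ℝ) + 1) γ)) (Equiv.addLeft δ)]
    simp [lat_add, add_assoc]
  · intro x
    obtain ⟨N, hN⟩ := exists_nat_ge (2 * (Λ + ‖x‖))
    apply tendsto_const_nhds.congr'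
    filter_upwards [eventually_ge_atTop N] with k hk
    have hkN : (N : ℝ) ≤ k := by exact_mod_cast hk
    have hL : (0 : ℝ) < (k : ℝ) + 1 := by positivity
    rw [hfe]
    apply le_antisymm
    · refine le_trans (le_of_eq ?_) (le_ciSup (hb2 _ x) 0)
      have : (lat ((k : ℝ) + 1) 0 : Vn n) = 0 := by ext i; simp [lat]
      simp [this, hq]
    · apply ciSup_le
      intro γ
      by_cases h0 : γ = 0
      · have : (lat ((k : ℝ) + 1) γ : Vn n) = 0 := by ext i; simp [lat, h0]
        simp [this, hq]
      · have h1 := lat_norm hL γ h0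
        set l : Vn n := lat ((k : ℝ) + 1) γ
        have h2 := hΛ x l
        have h3 := abs_real_inner_le_norm x l
        rw [abs_le] at h3
        simp only [hq]
        rw [norm_add_sq_real]
        nlinarith [norm_nonneg l]

/-- Separation of a convex function from a convex set below its graph. -/
lemma sandwich {v : Vn n → ℝ} (hv : Cvx v) (T : Set (Vn n × ℝ)) (hT : Convex ℝ T)
    (hne : T.Nonempty) (h : ∀ p ∈ T, p.2 ≤ v p.1) :
    ∃ (a : Vn n) (c : ℝ), (∀ y, inner ℝ a y - c ≤ v y) ∧ ∀ p ∈ T, p.2 ≤ inner ℝ a p.1 - c := by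
  have hvc := hv.continuous
  set S : Set (Vn n × ℝ) := {p | v p.1 < p.2} with hS
  have hSo : IsOpen S := isOpen_lt (by fun_prop) (by fun_prop)
  have hSc : Convex ℝ S := by
    have := ConvexOn.convex_strict_epigraph hv
    simpa using this
  have hd : Disjoint S T := by
    rw [Set.disjoint_left]
    intro p hp hpT
    exact absurd (h p hpT) (not_le.2 hp)
  obtain ⟨φ, u, h1, h2⟩ := geometric_hahn_banach_open hSc hSo hT hd
  set β := φ (0, 1) with hβ
  set φ1 : Vn n →L[ℝ] ℝ := φ.comp (ContinuousLinearMap.inl ℝ (Vn n) ℝ) with hφ1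
  have hφ : ∀ y r, φ (y, r) = φ1 y + r * β := by
    intro y r
    have : ((y, r) : Vn n × ℝ) = (y, 0) + r • (0, 1) := by simp
    rw [this, map_add, map_smul, smul_eq_mul]
    rfl
  obtain ⟨⟨y0, r0⟩, hp0⟩ := hne
  have hβ0 : β < 0 := by
    have e1 := h1 (y0, v y0 + 1) (by simp [hS])
    have e2 := h2 _ hp0
    have e3 := h _ hp0
    rw [hφ] at e1 e2
    simp only at e3
    by_contra hcon
    push Not at hcon
    nlinarith
  have hb : 0 < -β := by linarith
  have hin : ∀ y, inner ℝ ((-β)⁻¹ • (InnerProductSpace.toDual ℝ (Vn n)).symm φ1) y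
      = (-β)⁻¹ * φ1 y := by
    intro y
    rw [real_inner_smul_left, InnerProductSpace.toDual_symm_apply]
  refine ⟨(-β)⁻¹ • (InnerProductSpace.toDual ℝ (Vn n)).symm φ1, (-β)⁻¹ * u, ?_, ?_⟩
  · intro y
    rw [hin, ← mul_sub, inv_mul_le_iff₀ hb]
    apply le_of_forall_pos_le_add
    intro ε hε
    have := h1 (y, v y + ε / (-β)) (by simp only [hS, Set.mem_ofPred_eq]; have := div_pos hε hb; linarith)
    rw [hφ] at this
    have e : ε / (-β) * (-β) = ε := div_mul_cancel₀ _ hb.ne'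
    nlinarith
  · rintro ⟨y, r⟩ hp
    simp only
    rw [hin, ← mul_sub, le_inv_mul_iff₀ hb]
    have := h2 _ hp
    rw [hφ] at this
    linarith

lemma subgrad {v : Vn n → ℝ} (hv : Cvx v) (x : Vn n) :
    ∃ a : Vn n, ∀ y, v x + inner ℝ a (y - x) ≤ v y := by
  obtain ⟨a, c, h1, h2⟩ := sandwich hv {(x, v x)} (convex_singleton _) ⟨_, rfl⟩ (by
    rintro p rfl; exact le_rfl)
  refine ⟨a, fun y => ?_⟩
  have e1 := h2 _ rfl
  have e2 := h1 y
  rw [inner_sub_right]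
  simp only at e1
  linarith

theorem density (hA : Dens A) (v : Vn n → ℝ) (hv : Cvx v) : v ∈ A := by
  obtain ⟨a0, ha0⟩ := subgrad hv 0
  let I : ℕ → Type := fun j => {p : Vn n × ℝ // ‖p.1‖ ≤ j + ‖a0‖ ∧ ∀ y, inner ℝ p.1 y + p.2 ≤ v y}
  have hne : ∀ j, Nonempty (I j) := fun j => ⟨⟨(a0, v 0), by
    refine ⟨?_, fun y => ?_⟩
    · simp
    · have := ha0 y
      rw [sub_zero] at this
      simp only
      linarith⟩⟩
  have hb : ∀ j y, BddAbove (Set.range fun p : I j => inner ℝ p.1.1 y + p.1.2) := by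
    intro j y
    refine ⟨v y, ?_⟩
    rintro _ ⟨p, rfl⟩
    exact p.2.2 y
  refine hA.lim (fun j y => ⨆ p : I j, (inner ℝ p.1.1 y + p.1.2)) v ?_ hv ?_
  · intro j
    have := hne j
    refine lip_mem hA _ (Cvx.iSup _ (fun p => IsAff.cvx ⟨_, _, rfl⟩) (hb j)) (j + ‖a0‖) ?_
    intro y h
    apply ciSup_le
    intro p
    have h1 := le_ciSup (hb j y) p
    have h2 := real_inner_le_norm p.1.1 h
    have h3 := p.2.1
    rw [inner_add_right]
    have := mul_le_mul_of_nonneg_right h3 (norm_nonneg h)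
    linarith
  · intro y
    obtain ⟨a, ha⟩ := subgrad hv y
    obtain ⟨N, hN⟩ := exists_nat_ge ‖a‖
    apply tendsto_const_nhds.congr'
    filter_upwards [eventually_ge_atTop N] with j hj
    have := hne j
    have hjN : (N : ℝ) ≤ j := by exact_mod_cast hj
    apply le_antisymm
    · have := le_ciSup (hb j y) ⟨(a, v y - inner ℝ a y), by
        refine ⟨?_, fun z => ?_⟩
        · simp only; linarith [norm_nonneg a0]
        · have := ha z
          rw [inner_sub_right] at this
          simp only
          linarith⟩
      simpa using this
    · exact ciSup_le fun p => p.2.2 y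

end

section
variable {n m : ℕ} {Y : (Vn n → ℝ) → ℝ}

lemma DD_vanish_aux (hY : DualVal n m Y) (t1 : List (Vn n → ℝ)) : ∀ t2 : List (Vn n → ℝ),
    (∀ h ∈ t1, Cvx h) → (∀ h ∈ t2, ∃ p, IsAff p ∧ h = 0 ⊔ p) →
    t1.length + t2.length = m + 1 → ∀ w, Cvx w → DD Y (t1 ++ t2) w = 0 := by
  induction t1 with
  | nil =>
    intro t2 _ h2 hl w hw
    exact DD_ridge_vanish hY t2 h2 (by simpa using hl) w hw
  | cons v t1 ih =>
    intro t2 h1 h2 hl w hw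
    have hc : ∀ h ∈ t1 ++ t2, Cvx h := by
      intro h hh
      rcases List.mem_append.1 hh with hh | hh
      · exact h1 h (List.mem_cons_of_mem _ hh)
      · obtain ⟨q, hq, rfl⟩ := h2 h hh
        exact ridge_cvx hY hq
    set A : Set (Vn n → ℝ) :=
      {v | Cvx v ∧ ∀ w, Cvx w → DD Y (t1 ++ t2) (w + v) = DD Y (t1 ++ t2) w} with hA
    have hD : Dens A := by
      refine ⟨fun f hf => hf.1, ?_, ?_, ?_, ?_, ?_⟩
      · intro p hp
        refine ⟨hp.cvx, fun w hw => ?_⟩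
        have := DD_aff hY (t1 ++ t2).attach (fun i => i.1) (fun _ => 0) (fun i => hc _ i.2)
          (fun _ => IsAff.zero) w p hw hp
        simpa using this
      · intro p hp
        refine ⟨ridge_cvx hY hp, fun w hw => ?_⟩
        have := ih ((0 ⊔ p) :: t2) (fun h hh => h1 h (List.mem_cons_of_mem _ hh)) (by
          intro h hh
          rcases List.mem_cons.1 hh with rfl | hh
          · exact ⟨p, hp, rfl⟩
          · exact h2 h hh) (by simp only [List.length_cons] at hl ⊢; omega) w hw
        rw [DD_perm List.perm_middle] at this
        simp only [DD] at this
        linarith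
      · rintro f ⟨hf, hf'⟩ g ⟨hg, hg'⟩
        refine ⟨hf.add hg, fun w hw => ?_⟩
        rw [← add_assoc, hg' _ (hw.add hf), hf' w hw]
      · intro fk f hfk hf hlim
        refine ⟨hf, fun w hw => ?_⟩
        have := DD_tendsto hY (t1 ++ t2).attach (fun _ i => i.1) (fun i => i.1)
          (fun _ i => hc _ i.2) (fun i => hc _ i.2) (fun i y => tendsto_const_nhds)
          (fun k => w + fk k) (w + f) (fun k => hw.add (hfk k).1) (hw.add hf)
          (fun y => tendsto_const_nhds.add (hlim y))
        simp only [List.attach_map_subtype_val] at this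
        refine tendsto_nhds_unique this ?_
        simp only [(hfk _).2 w hw]
        exact tendsto_const_nhds
      · rintro v g hv ⟨hg, hg'⟩ ⟨_, hvg⟩
        refine ⟨hv, fun w hw => ?_⟩
        rw [← hg' _ (hw.add hv), add_assoc, hvg w hw]
    have := (density hD v (h1 v List.mem_cons_self)).2 w hw
    simp only [List.cons_append, DD]
    linarith

lemma DD_vanish (hY : DualVal n m Y) (t : List (Vn n → ℝ)) (ht : ∀ h ∈ t, Cvx h)
    (hl : t.length = m + 1) (w : Vn n → ℝ) (hw : Cvx w) : DD Y t w = 0 := by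
  simpa using DD_vanish_aux hY t [] ht (by simp) (by simpa using hl) w hw

lemma DD_const (hY : DualVal n m Y) (t : List (Vn n → ℝ)) (ht : ∀ h ∈ t, Cvx h)
    (hl : t.length = m) (w : Vn n → ℝ) (hw : Cvx w) : DD Y t w = DD Y t 0 := by
  have := DD_vanish hY (w :: t) (by
    intro h hh
    rcases List.mem_cons.1 hh with rfl | hh
    · exact hw
    · exact ht h hh) (by simp [hl]) 0 Cvx.zero
  simp only [DD, zero_add] at this
  linarith

lemma DD_add (hY : DualVal n m Y) (t : List (Vn n → ℝ)) (ht : ∀ h ∈ t, Cvx h)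
    (hl : t.length + 1 = m) (h h' : Vn n → ℝ) (hh : Cvx h) (hh' : Cvx h') :
    DD Y ((h + h') :: t) 0 = DD Y (h :: t) 0 + DD Y (h' :: t) 0 := by
  have := DD_const hY (h' :: t) (by
    intro g hg
    rcases List.mem_cons.1 hg with rfl | hg
    · exact hh'
    · exact ht g hg) (by simp [hl]) h hh
  rw [← this]
  simp only [DD, zero_add]
  ring

lemma DD_zero_cons (t : List (Vn n → ℝ)) (w : Vn n → ℝ) : DD Y (0 :: t) w = 0 := by
  simp [DD]

lemma DD_nat (hY : DualVal n m Y) (t : List (Vn n → ℝ)) (ht : ∀ h ∈ t, Cvx h)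
    (hl : t.length + 1 = m) (h : Vn n → ℝ) (hh : Cvx h) (k : ℕ) :
    DD Y (((k : ℝ) • h) :: t) 0 = k * DD Y (h :: t) 0 := by
  induction k with
  | zero => simp [DD_zero_cons]
  | succ k ih =>
    push_cast
    rw [add_smul, one_smul, DD_add hY t ht hl _ _ (hh.smul (by positivity)) hh, ih]
    ring

lemma DD_smul (hY : DualVal n m Y) (t : List (Vn n → ℝ)) (ht : ∀ h ∈ t, Cvx h)
    (hl : t.length + 1 = m) (h : Vn n → ℝ) (hh : Cvx h) (α : ℝ) (hα : 0 ≤ α) :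
    DD Y ((α • h) :: t) 0 = α * DD Y (h :: t) 0 := by
  have hf : Tendsto (fun k : ℕ => (⌊α * k⌋₊ : ℝ) / k) atTop (𝓝 α) := by
    have := (tendsto_nat_floor_mul_div_atTop hα).comp (tendsto_natCast_atTop_atTop (R := ℝ))
    exact this
  have h1 : Tendsto (fun k : ℕ => DD Y ((((⌊α * k⌋₊ : ℝ) / k) • h) :: t) 0) atTop
      (𝓝 (DD Y ((α • h) :: t) 0)) := by
    have := DD_tendsto hY (none :: t.attach.map some)
      (fun k o => o.elim (((⌊α * k⌋₊ : ℝ) / k) • h) (fun i => i.1))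
      (fun o => o.elim (α • h) (fun i => i.1))
      (by
        rintro k (_ | i)
        · exact hh.smul (by positivity)
        · exact ht _ i.2)
      (by
        rintro (_ | i)
        · exact hh.smul hα
        · exact ht _ i.2)
      (by
        rintro (_ | i) y
        · exact hf.mul_const (h y)
        · exact tendsto_const_nhds)
      (fun _ => 0) 0 (fun _ => Cvx.zero) Cvx.zero (fun y => tendsto_const_nhds)
    simpa [Function.comp_def] using this
  refine tendsto_nhds_unique h1 ?_
  refine (hf.mul_const (DD Y (h :: t) 0)).congr' ?_
  filter_upwards [eventually_gt_atTop 0] with k hk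
  have hk' : (k : ℝ) ≠ 0 := by positivity
  have e1 := DD_nat hY t ht hl (((⌊α * k⌋₊ : ℝ) / k) • h) (hh.smul (by positivity)) k
  rw [smul_smul, mul_div_cancel₀ _ hk', DD_nat hY t ht hl h hh] at e1
  field_simp
  linarith

lemma DD_prod (hY : DualVal n m Y) {ι : Type*} (c : ι → ℝ) (h : ι → Vn n → ℝ) (hc : ∀ i, 0 ≤ c i)
    (hh : ∀ i, Cvx (h i)) (I : List ι) : ∀ t : List (Vn n → ℝ), (∀ h ∈ t, Cvx h) →
    I.length + t.length = m →
    DD Y (I.map (fun i => c i • h i) ++ t) 0 = (I.map c).prod * DD Y (I.map h ++ t) 0 := by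
  induction I with
  | nil => intro t _ _; simp
  | cons i I ih =>
    intro t ht hl
    simp only [List.map_cons, List.cons_append, List.prod_cons, List.length_cons] at hl ⊢
    rw [DD_smul hY _ ?_ ?_ _ (hh i) _ (hc i), ← DD_perm List.perm_middle, ih, mul_assoc,
      DD_perm List.perm_middle]
    · intro g hg
      rcases List.mem_cons.1 hg with rfl | hg
      · exact hh i
      · exact ht g hg
    · simp; omega
    · intro g hg
      rcases List.mem_append.1 hg with hg | hg
      · obtain ⟨j, _, rfl⟩ := List.mem_map.1 hg
        exact (hh j).smul (hc j)
      · exact ht g hg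
    · simp; omega

lemma DD_replicate (hY : DualVal n m Y) (hm : 1 ≤ m) (V : Vn n → ℝ) (hV : Cvx V) :
    DD Y (List.replicate m V) 0 = m.factorial * Y V := by
  have key : ∀ r c : ℕ, DD Y (List.replicate r V) ((c : ℝ) • V) =
      ((fwdDiff (1 : ℝ))^[r] (fun x : ℝ => x ^ m)) c * Y V := by
    intro r
    induction r with
    | zero =>
      intro c
      simp only [List.replicate_zero, DD, Function.iterate_zero, id]
      rcases Nat.eq_zero_or_pos c with rfl | hc
      · simp [Y_zero hY hm, zero_pow (by omega : m ≠ 0)]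
      · exact hY.hom V hV c (by exact_mod_cast hc)
    | succ r ih =>
      intro c
      rw [Function.iterate_succ_apply']
      simp only [List.replicate_succ, DD, fwdDiff]
      have e : (c : ℝ) • V + V = ((c + 1 : ℕ) : ℝ) • V := by
        push_cast
        rw [add_smul, one_smul]
      rw [e, ih, ih]
      push_cast
      ring
  have := key m 0
  rw [fwdDiff_iter_eq_factorial] at this
  simpa using this

lemma DD_sum (hY : DualVal n m Y) (t : List (Vn n → ℝ)) (ht : ∀ h ∈ t, Cvx h)
    (hl : t.length + 1 = m) {ι : Type*} (s : Finset ι) (c : ι → ℝ) (v : ι → Vn n → ℝ)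
    (hc : ∀ i, 0 ≤ c i) (hv : ∀ i, Cvx (v i)) :
    Cvx (∑ i ∈ s, c i • v i) ∧
    DD Y ((∑ i ∈ s, c i • v i) :: t) 0 = ∑ i ∈ s, c i * DD Y (v i :: t) 0 := by
  classical
  induction s using Finset.induction_on with
  | empty => exact ⟨by simpa using Cvx.zero, by simp [DD_zero_cons]⟩
  | insert i s hi ih =>
    rw [Finset.sum_insert hi, Finset.sum_insert hi]
    have h1 := (hv i).smul (hc i)
    exact ⟨h1.add ih.1, by rw [DD_add hY t ht hl _ _ h1 ih.1, ih.2, DD_smul hY t ht hl _ (hv i) _ (hc i)]⟩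

/-- Multiset of repeated entries. -/
def repM {k : ℕ} (v : Fin k → Vn n → ℝ) (d : Fin k →₀ ℕ) : Multiset (Vn n → ℝ) :=
  ∑ j, d j • ({v j} : Multiset (Vn n → ℝ))

lemma repM_mem {k : ℕ} (v : Fin k → Vn n → ℝ) (hv : ∀ i, Cvx (v i)) (d : Fin k →₀ ℕ) :
    ∀ h ∈ (repM v d).toList, Cvx h := by
  intro h hh
  rw [Multiset.mem_toList, repM, Multiset.mem_sum] at hh
  obtain ⟨j, _, hj⟩ := hh
  have := Multiset.mem_of_mem_nsmul hj
  rw [Multiset.mem_singleton] at this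
  rw [this]
  exact hv j

lemma repM_card {k : ℕ} (v : Fin k → Vn n → ℝ) (d : Fin k →₀ ℕ) :
    (repM v d).card = ∑ j, d j := by
  simp [repM, Multiset.card_sum]

lemma repM_single {k : ℕ} (v : Fin k → Vn n → ℝ) (d : Fin k →₀ ℕ) (i : Fin k) :
    repM v (d + Finsupp.single i 1) = v i ::ₘ repM v d := by
  classical
  simp only [repM, Finsupp.add_apply, add_smul, Finset.sum_add_distrib]
  rw [add_comm, ← Multiset.singleton_add]
  congr 1
  rw [Finset.sum_eq_single i]
  · simp
  · intro j _ hj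
    rw [Finsupp.single_eq_of_ne hj, zero_smul]
  · simp

lemma repM_list {k : ℕ} (v : Fin k → Vn n → ℝ) (d : Fin k → ℕ) :
    (((List.finRange k).flatMap (fun j => List.replicate (d j) (v j)) : List (Vn n → ℝ)) :
      Multiset (Vn n → ℝ)) = repM v (Finsupp.equivFunOnFinite.symm d) := by
  have : ∀ I : List (Fin k), ((I.flatMap (fun j => List.replicate (d j) (v j)) :
      List (Vn n → ℝ)) : Multiset (Vn n → ℝ)) =
      (I.map (fun j => d j • ({v j} : Multiset (Vn n → ℝ)))).sum := by
    intro I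
    induction I with
    | nil => rfl
    | cons i I ih =>
      rw [List.flatMap_cons, ← Multiset.coe_add, ih, List.map_cons, List.sum_cons,
        Multiset.coe_replicate, Multiset.nsmul_singleton]
  rw [this, repM, ← List.sum_ofFn, List.ofFn_eq_map]
  rfl

lemma Y_expand (hY : DualVal n m Y) (hm : 1 ≤ m) {k : ℕ} (v : Fin k → Vn n → ℝ)
    (hv : ∀ i, Cvx (v i)) (l : Fin k → ℝ) (hl : ∀ i, 0 ≤ l i) :
    Y (∑ i, l i • v i) = ∑ d ∈ Finset.Nat.antidiagonalTuple k m,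
      (Nat.multinomial Finset.univ d : ℝ) * (∏ i, l i ^ d i) *
        (DD Y ((List.finRange k).flatMap (fun j => List.replicate (d j) (v j))) 0
          / (m.factorial : ℝ)) := by
  classical
  set V := ∑ i, l i • v i with hV
  have hVc : Cvx V := by
    rw [hV]
    exact Finset.sum_induction _ Cvx (fun _ _ => Cvx.add) Cvx.zero (fun i _ => (hv i).smul (hl i))
  set φ : MvPolynomial (Fin k) ℝ →ₗ[ℝ] ℝ :=
    (MvPolynomial.basisMonomials (Fin k) ℝ).constr ℝ (fun d => DD Y (repM v d).toList 0) with hφ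
  have hφm : ∀ d, φ (MvPolynomial.monomial d 1) = DD Y (repM v d).toList 0 := by
    intro d
    have := (MvPolynomial.basisMonomials (Fin k) ℝ).constr_basis ℝ
      (fun d => DD Y (repM v d).toList 0) d
    simpa using this
  set P : MvPolynomial (Fin k) ℝ := ∑ i, MvPolynomial.C (l i) * MvPolynomial.X i with hP
  have key : ∀ s (d : Fin k →₀ ℕ), s + ∑ j, d j = m →
      DD Y (List.replicate s V ++ (repM v d).toList) 0 =
        φ (P ^ s * MvPolynomial.monomial d 1) := by
    intro s
    induction s with
    | zero => intro d _; simp [hφm]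
    | succ s ih =>
      intro d hd
      rw [List.replicate_succ, List.cons_append]
      have hsum := (DD_sum hY (List.replicate s V ++ (repM v d).toList) (by
        intro h hh
        rcases List.mem_append.1 hh with hh | hh
        · rw [List.eq_of_mem_replicate hh]; exact hVc
        · exact repM_mem v hv d h hh) (by simp [repM_card]; omega) Finset.univ l v hl hv).2
      rw [← hV] at hsum
      rw [hsum, pow_succ, mul_assoc]
      conv_rhs => rw [hP, Finset.sum_mul, Finset.mul_sum, map_sum]
      apply Finset.sum_congr rfl
      intro i _
      have e1 : P ^ s * (MvPolynomial.C (l i) * MvPolynomial.X i * MvPolynomial.monomial d 1) =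
          (l i) • (P ^ s * MvPolynomial.monomial (d + Finsupp.single i 1) 1) := by
        rw [MvPolynomial.smul_eq_C_mul, MvPolynomial.monomial_add_single]
        ring
      rw [← hP, e1, map_smul, ← ih (d + Finsupp.single i 1) ?_, smul_eq_mul]
      · congr 1
        apply DD_perm
        refine List.perm_middle.symm.trans ?_
        apply List.Perm.append_left
        rw [← Multiset.coe_eq_coe]
        rw [Multiset.coe_toList, repM_single, ← Multiset.cons_coe, Multiset.coe_toList]
      · simp [Finset.sum_add_distrib, Finsupp.single_apply]
        omega
  have h0 := key m 0 (by simp)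
  have e0 : (repM v 0).toList = [] := by simp [repM]
  rw [e0, List.append_nil, DD_replicate hY hm V hVc] at h0
  have hfac : (m.factorial : ℝ) ≠ 0 := by exact_mod_cast m.factorial_ne_zero
  have h1 : Y V = φ (P ^ m) / m.factorial := by
    rw [eq_div_iff hfac, mul_comm, h0]
    congr 1
    simp
  rw [h1, hP, Finset.sum_pow_eq_sum_piAntidiag, map_sum, Finset.sum_div,
    Finset.piAntidiag_univ_fin_eq_antidiagonalTuple]
  apply Finset.sum_congr rfl
  intro d _
  have e2 : (Nat.multinomial Finset.univ d : MvPolynomial (Fin k) ℝ) *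
      ∏ i, (MvPolynomial.C (l i) * MvPolynomial.X i) ^ d i =
      ((Nat.multinomial Finset.univ d : ℝ) * (∏ i, l i ^ d i)) •
        MvPolynomial.monomial (Finsupp.equivFunOnFinite.symm d) 1 := by
    rw [MvPolynomial.smul_eq_C_mul, MvPolynomial.monomial_eq]
    simp only [mul_pow, Finset.prod_mul_distrib, map_mul, map_natCast, map_prod, map_pow, map_one,
      one_mul]
    rw [Finsupp.prod_fintype _ _ (by simp)]
    simp [mul_assoc]
  rw [e2, map_smul, hφm, smul_eq_mul, mul_div_assoc]
  congr 2
  apply DD_perm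
  rw [← Multiset.coe_eq_coe, repM_list, Multiset.coe_toList]

end

section
variable {n : ℕ}

/-- Convex conjugate of a finite function. -/
def cs (v : Vn n → ℝ) : Vn n → EReal := fun x => ⨆ y, ((inner ℝ x y - v y : ℝ) : EReal)

/-- Convex conjugate (finite valued) of a super-coercive function. -/
def cj (u : Vn n → EReal) : Vn n → ℝ :=
  fun y => sInf {c : ℝ | ∀ x, ((inner ℝ x y - c : ℝ) : EReal) ≤ u x}

lemma cs_le_iff (v : Vn n → ℝ) (x : Vn n) (c : ℝ) :
    cs v x ≤ (c : EReal) ↔ ∀ y, inner ℝ x y - v y ≤ c := by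
  simp only [cs, iSup_le_iff, EReal.coe_le_coe_iff]

lemma le_cs (v : Vn n → ℝ) (x y : Vn n) : ((inner ℝ x y - v y : ℝ) : EReal) ≤ cs v x :=
  le_iSup (fun y => ((inner ℝ x y - v y : ℝ) : EReal)) y

lemma ereal_cases (p : EReal) (h : p ≠ ⊥) : p = ⊤ ∨ ∃ r : ℝ, p = (r : EReal) := by
  induction p with
  | bot => exact absurd rfl h
  | top => exact Or.inl rfl
  | coe r => exact Or.inr ⟨r, rfl⟩

lemma ereal_ext {p q : EReal} (h : ∀ c : ℝ, p ≤ (c : EReal) ↔ q ≤ (c : EReal)) : p = q := by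
  apply le_antisymm
  · exact EReal.le_of_forall_lt_iff_le.1 fun c hc => (h c).2 hc.le
  · exact EReal.le_of_forall_lt_iff_le.1 fun c hc => (h c).1 hc.le

lemma cs_convex (v : Vn n → ℝ) : IsConvexFn (cs v) := by
  intro x y t ht ht1
  refine iSup_le fun z => ?_
  have e : (inner ℝ (t • x + (1 - t) • y) z - v z : ℝ) =
      t * (inner ℝ x z - v z) + (1 - t) * (inner ℝ y z - v z) := by
    rw [inner_add_left, real_inner_smul_left, real_inner_smul_left]
    ring
  rw [e, EReal.coe_add, EReal.coe_mul, EReal.coe_mul]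
  refine add_le_add (mul_le_mul_of_nonneg_left (le_cs v x z) ?_)
    (mul_le_mul_of_nonneg_left (le_cs v y z) ?_)
  · exact_mod_cast ht.le
  · exact_mod_cast (by linarith : (0 : ℝ) ≤ 1 - t)

lemma cs_lsc (v : Vn n → ℝ) : LowerSemicontinuous (cs v) := by
  apply lowerSemicontinuous_iSup
  intro y
  apply Continuous.lowerSemicontinuous
  exact continuous_coe_real_ereal.comp (by fun_prop)

lemma cs_ne_bot (v : Vn n → ℝ) (x : Vn n) : cs v x ≠ ⊥ := by
  intro h
  have := le_cs v x 0
  rw [h] at this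
  simp at this

lemma cs_mem {v : Vn n → ℝ} (hv : Cvx v) : cs v ∈ ConvSc n := by
  refine ⟨⟨cs_convex v, cs_lsc v, cs_ne_bot v, ?_⟩, ?_⟩
  · obtain ⟨a, ha⟩ := subgrad hv 0
    refine ⟨a, fun h => ?_⟩
    have : cs v a ≤ ((-v 0 : ℝ) : EReal) := by
      rw [cs_le_iff]
      intro y
      have := ha y
      rw [sub_zero] at this
      linarith
    rw [h] at this
    simp at this
  · intro M
    obtain ⟨B, hB⟩ := (isCompact_closedBall (0 : Vn n) (|M| + 1)).bddAbove_image
      hv.continuous.continuousOn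
    refine ⟨max B 1, fun x hx => ?_⟩
    have hx1 : 1 ≤ ‖x‖ := (le_max_right _ _).trans hx
    have hxB : B ≤ ‖x‖ := (le_max_left _ _).trans hx
    have hx0 : ‖x‖ ≠ 0 := by positivity
    set y : Vn n := ((|M| + 1) / ‖x‖) • x with hy
    have hM : 0 ≤ |M| := abs_nonneg M
    have hyn : ‖y‖ = |M| + 1 := by
      rw [hy, norm_smul, Real.norm_of_nonneg (by positivity), div_mul_cancel₀ _ hx0]
    have hvy : v y ≤ B := hB ⟨y, by simp [hyn], rfl⟩
    refine le_trans ?_ (le_cs v x y)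
    rw [EReal.coe_le_coe_iff, hy, real_inner_smul_right, real_inner_self_eq_norm_sq, ← hy]
    have e : (|M| + 1) / ‖x‖ * ‖x‖ ^ 2 = (|M| + 1) * ‖x‖ := by field_simp
    rw [e]
    nlinarith [le_abs_self M]

lemma cj_set {u : Vn n → EReal} (hu : u ∈ ConvSc n) (y : Vn n) :
    {c : ℝ | ∀ x, ((inner ℝ x y - c : ℝ) : EReal) ≤ u x}.Nonempty ∧
    BddBelow {c : ℝ | ∀ x, ((inner ℝ x y - c : ℝ) : EReal) ≤ u x} := by
  obtain ⟨⟨-, hlsc, hbot, x0, hx0⟩, hsc⟩ := hu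
  constructor
  · obtain ⟨R, hR⟩ := hsc ‖y‖
    obtain ⟨z, hz, hmin⟩ := LowerSemicontinuousOn.exists_isMinOn
      (s := Metric.closedBall (0 : Vn n) (max R 0)) ⟨0, by simp⟩ (isCompact_closedBall _ _)
      (hlsc.lowerSemicontinuousOn _)
    obtain ⟨b, hb⟩ : ∃ b : ℝ, (b : EReal) ≤ u z := by
      rcases ereal_cases _ (hbot z) with h | ⟨r, h⟩
      · exact ⟨0, by rw [h]; exact le_top⟩
      · exact ⟨r, h.ge⟩
    refine ⟨max 0 (max R 0 * ‖y‖ - b), fun x => ?_⟩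
    rcases le_total (max R 0) ‖x‖ with hx | hx
    · refine le_trans ?_ (hR x ((le_max_left _ _).trans hx))
      rw [EReal.coe_le_coe_iff]
      have := real_inner_le_norm x y
      have := le_max_left 0 (max R 0 * ‖y‖ - b)
      nlinarith
    · refine le_trans ?_ (hb.trans (hmin (by simpa using hx)))
      rw [EReal.coe_le_coe_iff]
      have h1 := real_inner_le_norm x y
      have h2 := le_max_right 0 (max R 0 * ‖y‖ - b)
      have h3 := mul_le_mul_of_nonneg_right hx (norm_nonneg y)
      linarith
  · rcases ereal_cases _ (hbot x0) with h | ⟨r, h⟩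
    · exact absurd h hx0
    · refine ⟨inner ℝ x0 y - r, fun c hc => ?_⟩
      have := hc x0
      rw [h, EReal.coe_le_coe_iff] at this
      linarith

lemma cj_spec {u : Vn n → EReal} (hu : u ∈ ConvSc n) (y : Vn n) (c : ℝ) :
    cj u y ≤ c ↔ ∀ x, ((inner ℝ x y - c : ℝ) : EReal) ≤ u x := by
  obtain ⟨hne, hbd⟩ := cj_set hu y
  constructor
  · intro h x
    rcases ereal_cases _ (hu.1.2.2.1 x) with h' | ⟨r, h'⟩
    · rw [h']; exact le_top
    · rw [h', EReal.coe_le_coe_iff]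
      apply le_of_forall_pos_le_add
      intro ε hε
      obtain ⟨c', hc', hlt⟩ := (csInf_lt_iff hbd hne).1 (lt_of_le_of_lt h (lt_add_of_pos_right c hε))
      have := hc' x
      rw [h', EReal.coe_le_coe_iff] at this
      linarith
  · intro h
    exact csInf_le hbd h

lemma cj_le {u : Vn n → EReal} (hu : u ∈ ConvSc n) (x y : Vn n) :
    ((inner ℝ x y - cj u y : ℝ) : EReal) ≤ u x := (cj_spec hu y _).1 le_rfl x

lemma cj_cvx {u : Vn n → EReal} (hu : u ∈ ConvSc n) : Cvx (cj u) := by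
  refine ⟨convex_univ, ?_⟩
  intro y _ z _ a b ha hb hab
  rw [cj_spec hu]
  intro x
  have h1 := cj_le hu x y
  have h2 := cj_le hu x z
  rcases ereal_cases _ (hu.1.2.2.1 x) with h' | ⟨r, h'⟩
  · rw [h']; exact le_top
  · rw [h', EReal.coe_le_coe_iff] at h1 h2 ⊢
    rw [inner_add_right, real_inner_smul_right, real_inner_smul_right, smul_eq_mul, smul_eq_mul]
    have : r = a * r + b * r := by rw [← add_mul, hab, one_mul]
    nlinarith [mul_le_mul_of_nonneg_left h1 ha, mul_le_mul_of_nonneg_left h2 hb]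

lemma cj_cs {v : Vn n → ℝ} (hv : Cvx v) : cj (cs v) = v := by
  funext y
  apply le_antisymm
  · rw [cj_spec (cs_mem hv)]
    exact fun x => le_cs v x y
  · obtain ⟨a, ha⟩ := subgrad hv y
    have h1 : cs v a ≤ ((inner ℝ a y - v y : ℝ) : EReal) := by
      rw [cs_le_iff]
      intro z
      have := ha z
      rw [inner_sub_right] at this
      linarith
    have h2 := (cj_le (cs_mem hv) a y).trans h1
    rw [EReal.coe_le_coe_iff] at h2
    linarith

lemma epi_convex {u : Vn n → EReal} (hu : IsConvexFn u) :
    Convex ℝ {p : Vn n × ℝ | u p.1 ≤ (p.2 : EReal)} := by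
  rw [convex_iff_forall_pos]
  rintro ⟨x, r⟩ hx ⟨y, s⟩ hy a b ha hb hab
  simp only [Set.mem_ofPred_eq] at hx hy ⊢
  obtain rfl : b = 1 - a := by linarith
  refine (hu x y a ha (by linarith)).trans ?_
  simp only [Prod.snd_add, Prod.smul_snd, smul_eq_mul]
  rw [EReal.coe_add, EReal.coe_mul, EReal.coe_mul]
  refine add_le_add (mul_le_mul_of_nonneg_left hx ?_) (mul_le_mul_of_nonneg_left hy ?_)
  · exact_mod_cast ha.le
  · exact_mod_cast hb.le

lemma cs_cj {u : Vn n → EReal} (hu : u ∈ ConvSc n) : cs (cj u) = u := by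
  funext x
  apply le_antisymm
  · exact iSup_le fun y => cj_le hu x y
  · apply EReal.ge_of_forall_gt_iff_ge.1
    intro r hr
    -- it suffices to find an affine minorant
    suffices H : ∃ (y : Vn n) (c : ℝ), (∀ z, ((inner ℝ z y - c : ℝ) : EReal) ≤ u z) ∧
        r ≤ inner ℝ x y - c by
      obtain ⟨y, c, h1, h2⟩ := H
      refine le_trans ?_ (le_cs (cj u) x y)
      rw [EReal.coe_le_coe_iff]
      have := (cj_spec hu y c).2 h1
      linarith
    have hcl : IsClosed {p : Vn n × ℝ | u p.1 ≤ (p.2 : EReal)} := by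
      have h1 := hu.1.2.1.isClosed_epigraph
      exact h1.preimage (f := fun p : Vn n × ℝ => (p.1, (p.2 : EReal)))
        (continuous_fst.prodMk (continuous_coe_real_ereal.comp continuous_snd))
    obtain ⟨φ, t, h1, h2⟩ := geometric_hahn_banach_point_closed (epi_convex hu.1.1) hcl
      (x := (x, r)) (by simpa using hr)
    set β := φ (0, 1) with hβ
    set φ1 : Vn n →L[ℝ] ℝ := φ.comp (ContinuousLinearMap.inl ℝ (Vn n) ℝ) with hφ1
    have hφ : ∀ y r, φ (y, r) = φ1 y + r * β := by
      intro y r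
      have : ((y, r) : Vn n × ℝ) = (y, 0) + r • (0, 1) := by simp
      rw [this, map_add, map_smul, smul_eq_mul]
      rfl
    obtain ⟨x0, hx0⟩ := hu.1.2.2.2
    obtain ⟨r0, hr0⟩ : ∃ r0 : ℝ, u x0 = r0 := by
      rcases ereal_cases _ (hu.1.2.2.1 x0) with h | h
      · exact absurd h hx0
      · exact h
    have hb0 : 0 ≤ β := by
      by_contra hneg
      push Not at hneg
      set k := max 0 ((φ1 x0 + r0 * β - t) / (-β)) with hk
      have := h2 (x0, r0 + k) (by
        simp only [Set.mem_ofPred_eq]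
        rw [hr0, EReal.coe_le_coe_iff]
        linarith [le_max_left 0 ((φ1 x0 + r0 * β - t) / (-β))])
      rw [hφ] at this
      have h3 : (φ1 x0 + r0 * β - t) / (-β) ≤ k := le_max_right _ _
      rw [div_le_iff₀ (by linarith)] at h3
      linarith
    rw [hφ] at h1
    have hE : ∀ z s, u z ≤ ((s : ℝ) : EReal) → t < φ1 z + s * β := by
      intro z s hs
      have := h2 (z, s) hs
      rwa [hφ] at this
    set d : Vn n := (InnerProductSpace.toDual ℝ (Vn n)).symm φ1 with hd
    have hdin : ∀ z, inner ℝ z d = φ1 z := by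
      intro z
      rw [real_inner_comm, hd, InnerProductSpace.toDual_symm_apply]
    rcases hb0.lt_or_eq with hpos | hzero
    · refine ⟨(-β⁻¹) • d, -(β⁻¹ * t), ?_, ?_⟩
      · intro z
        rcases ereal_cases _ (hu.1.2.2.1 z) with h | ⟨s, h⟩
        · rw [h]; exact le_top
        · rw [h, EReal.coe_le_coe_iff, real_inner_smul_right, hdin]
          have := hE z s h.le
          have e : -β⁻¹ * φ1 z - -(β⁻¹ * t) = β⁻¹ * (t - φ1 z) := by ring
          rw [e, inv_mul_le_iff₀ hpos]
          linarith
      · rw [real_inner_smul_right, hdin]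
        have e : -β⁻¹ * φ1 x - -(β⁻¹ * t) = β⁻¹ * (t - φ1 x) := by ring
        rw [e, le_inv_mul_iff₀ hpos]
        linarith
    · rw [← hzero] at h1 hE
      simp only [mul_zero, add_zero] at h1 hE
      set M := cj u 0 with hM
      have hMb : ∀ z, ((-M : ℝ) : EReal) ≤ u z := by
        intro z
        have := cj_le hu z 0
        simpa using this
      set k := max 0 ((r + M) / (t - φ1 x)) with hk
      have hk0 : 0 ≤ k := le_max_left _ _
      refine ⟨(-k) • d, M - k * t, ?_, ?_⟩
      · intro z
        rcases ereal_cases _ (hu.1.2.2.1 z) with h | ⟨s, h⟩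
        · rw [h]; exact le_top
        · have h3 := hMb z
          rw [h, EReal.coe_le_coe_iff] at h3 ⊢
          rw [real_inner_smul_right, hdin]
          have := hE z s h.le
          nlinarith
      · rw [real_inner_smul_right, hdin]
        have h3 : (r + M) / (t - φ1 x) ≤ k := le_max_right _ _
        rw [div_le_iff₀ (by linarith)] at h3
        linarith

end

section
variable {n : ℕ}

lemma coe_convexFn {v : Vn n → ℝ} (hv : Cvx v) : IsConvexFn (fun x => (v x : EReal)) := by
  intro x y t ht ht1
  have := hv.2 (Set.mem_univ x) (Set.mem_univ y) ht.le (by linarith : 0 ≤ 1 - t) (by ring)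
  simp only [smul_eq_mul] at this
  rw [← EReal.coe_mul, ← EReal.coe_mul, ← EReal.coe_add, EReal.coe_le_coe_iff]
  exact this

lemma minmax {f g : Vn n → EReal} (hf : LowerSemicontinuous f) (hg : LowerSemicontinuous g)
    (hc : IsConvexFn (f ⊓ g)) (y : Vn n) (c : ℝ)
    (h : ∀ x, ((inner ℝ x y - c : ℝ) : EReal) ≤ (f ⊔ g) x) :
    (∀ x, ((inner ℝ x y - c : ℝ) : EReal) ≤ f x) ∨ (∀ x, ((inner ℝ x y - c : ℝ) : EReal) ≤ g x) := by
  by_contra hcon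
  push Not at hcon
  obtain ⟨⟨x1, h1⟩, x2, h2⟩ := hcon
  obtain ⟨r1, h1a, h1b⟩ := EReal.lt_iff_exists_real_btwn.1 h1
  obtain ⟨r2, h2a, h2b⟩ := EReal.lt_iff_exists_real_btwn.1 h2
  rw [EReal.coe_lt_coe_iff] at h1b h2b
  set ε := min (inner ℝ x1 y - c - r1) (inner ℝ x2 y - c - r2) with hε
  have hε0 : 0 < ε := lt_min (by linarith) (by linarith)
  have he1 : ε ≤ _ := min_le_left _ _
  have he2 : ε ≤ _ := min_le_right _ _
  have hcl : ∀ {f : Vn n → EReal}, LowerSemicontinuous f →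
      IsClosed {x : Vn n | f x ≤ ((inner ℝ x y - c - ε : ℝ) : EReal)} := by
    intro f hf
    exact hf.isClosed_epigraph.preimage
      (f := fun x : Vn n => (x, ((inner ℝ x y - c - ε : ℝ) : EReal)))
      (continuous_id.prodMk (continuous_coe_real_ereal.comp (by fun_prop)))
  have k1 : f x1 ≤ ((inner ℝ x1 y - c - ε : ℝ) : EReal) :=
    h1a.le.trans (EReal.coe_le_coe_iff.2 (by linarith))
  have k2 : g x2 ≤ ((inner ℝ x2 y - c - ε : ℝ) : EReal) :=
    h2a.le.trans (EReal.coe_le_coe_iff.2 (by linarith))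
  have hpc := isPreconnected_closed_iff.1 (convex_segment (𝕜 := ℝ) x1 x2).isPreconnected _ _ (hcl hf) (hcl hg)
    (by
      rintro x ⟨a, b, ha, hb, hab, rfl⟩
      have E := epi_convex hc (x := (x1, inner ℝ x1 y - c - ε)) (y := (x2, inner ℝ x2 y - c - ε))
        (show (f ⊓ g) x1 ≤ _ from inf_le_left.trans k1)
        (show (f ⊓ g) x2 ≤ _ from inf_le_right.trans k2) ha hb hab
      simp only [Set.mem_ofPred_eq, Prod.fst_add, Prod.snd_add, Prod.smul_fst, Prod.smul_snd, smul_eq_mul,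
        Pi.inf_apply, inf_le_iff] at E
      have e : a * (inner ℝ x1 y - c - ε) + b * (inner ℝ x2 y - c - ε)
          = inner ℝ (a • x1 + b • x2) y - c - ε := by
        rw [inner_add_left, real_inner_smul_left, real_inner_smul_left]
        have : c = a * c + b * c := by rw [← add_mul, hab, one_mul]
        have : ε = a * ε + b * ε := by rw [← add_mul, hab, one_mul]
        linarith
      rw [e] at E
      exact E)
    ⟨x1, left_mem_segment _ _ _, k1⟩ ⟨x2, right_mem_segment _ _ _, k2⟩
  obtain ⟨x, -, hx1, hx2⟩ := hpc
  have := (h x).trans (sup_le hx1 hx2)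
  rw [EReal.coe_le_coe_iff] at this
  linarith

lemma cs_sup {a b : Vn n → ℝ} (ha : Cvx a) (hb : Cvx b) (hab : Cvx (a ⊓ b)) :
    cs (a ⊔ b) = cs a ⊓ cs b := by
  funext x
  apply ereal_ext
  intro c
  rw [Pi.inf_apply, inf_le_iff, cs_le_iff, cs_le_iff, cs_le_iff]
  constructor
  · intro h
    have := minmax (f := fun y => (a y : EReal)) (g := fun y => (b y : EReal))
      (continuous_coe_real_ereal.comp ha.continuous).lowerSemicontinuous
      (continuous_coe_real_ereal.comp hb.continuous).lowerSemicontinuous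
      (by
        have := coe_convexFn hab
        convert this using 2 with y
        exact (EReal.coe_strictMono.monotone.map_min).symm) x c
      (by
        intro y
        have := h y
        rw [real_inner_comm]
        simp only [Pi.sup_apply] at this ⊢
        rw [← EReal.coe_strictMono.monotone.map_max, EReal.coe_le_coe_iff]
        linarith)
    rcases this with h | h
    · left; intro y; have := h y
      rw [real_inner_comm, EReal.coe_le_coe_iff] at this
      linarith
    · right; intro y; have := h y
      rw [real_inner_comm, EReal.coe_le_coe_iff] at this
      linarith
  · rintro (h | h) y
    · have := h y
      have : a y ≤ (a ⊔ b) y := le_sup_left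
      linarith
    · have := h y
      have : b y ≤ (a ⊔ b) y := le_sup_right
      linarith

lemma cs_inf {a b : Vn n → ℝ} : cs (a ⊓ b) = cs a ⊔ cs b := by
  funext x
  apply ereal_ext
  intro c
  rw [Pi.sup_apply, sup_le_iff, cs_le_iff, cs_le_iff, cs_le_iff, ← forall_and]
  refine forall_congr' fun y => ?_
  rw [Pi.inf_apply]
  constructor
  · intro h
    have := min_le_left (a y) (b y)
    have := min_le_right (a y) (b y)
    constructor <;> linarith
  · rintro ⟨h1, h2⟩
    rcases min_choice (a y) (b y) with h | h <;> (rw [h]; assumption)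

lemma real_ext {p q : ℝ} (h : ∀ c : ℝ, p ≤ c ↔ q ≤ c) : p = q :=
  le_antisymm ((h q).2 le_rfl) ((h p).1 le_rfl)

lemma cj_sup {u v : Vn n → EReal} (hu : u ∈ ConvSc n) (hv : v ∈ ConvSc n) (h1 : u ⊔ v ∈ ConvSc n)
    (h2 : u ⊓ v ∈ ConvSc n) : cj (u ⊔ v) = cj u ⊓ cj v := by
  funext y
  apply real_ext
  intro c
  rw [Pi.inf_apply, inf_le_iff, cj_spec h1, cj_spec hu, cj_spec hv]
  constructor
  · exact minmax hu.1.2.1 hv.1.2.1 h2.1.1 y c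
  · rintro (h | h) x
    · exact (h x).trans le_sup_left
    · exact (h x).trans le_sup_right

lemma cj_inf {u v : Vn n → EReal} (hu : u ∈ ConvSc n) (hv : v ∈ ConvSc n)
    (h2 : u ⊓ v ∈ ConvSc n) : cj (u ⊓ v) = cj u ⊔ cj v := by
  funext y
  apply real_ext
  intro c
  rw [Pi.sup_apply, sup_le_iff, cj_spec h2, cj_spec hu, cj_spec hv, ← forall_and]
  refine forall_congr' fun x => ?_
  rw [Pi.inf_apply, le_inf_iff]

lemma cs_translate (v : Vn n → ℝ) (a : Vn n) (c : ℝ) :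
    cs (v + fun y => inner ℝ a y + c) = fun x => cs v (x - a) + ((-c : ℝ) : EReal) := by
  funext x
  apply ereal_ext
  intro r
  have e : cs v (x - a) + ((-c : ℝ) : EReal) ≤ r ↔ cs v (x - a) ≤ ((r + c : ℝ) : EReal) := by
    rcases ereal_cases _ (cs_ne_bot v (x - a)) with h | ⟨s, h⟩
    · rw [h, EReal.top_add_coe]
      simp only [top_le_iff, EReal.coe_ne_top]
    · rw [h, ← EReal.coe_add, EReal.coe_le_coe_iff, EReal.coe_le_coe_iff]
      constructor <;> intro h <;> linarith
  rw [e, cs_le_iff, cs_le_iff]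
  refine forall_congr' fun y => ?_
  simp only [Pi.add_apply, inner_sub_left]
  constructor <;> intro h <;> linarith

lemma epiMul_cs {v : Vn n → ℝ} (l : ℝ) (hl : 0 ≤ l) : epiMul l (cs v) = cs (l • v) := by
  unfold epiMul
  split_ifs with h0
  · subst h0
    funext x
    apply ereal_ext
    intro c
    rw [cs_le_iff]
    split_ifs with hx
    · subst hx
      simp
    · simp only [zero_smul, Pi.zero_apply, sub_zero, top_le_iff, EReal.coe_ne_top, false_iff]
      intro h
      have hx0 : ‖x‖ ^ 2 ≠ 0 := by positivity
      have := h (((c + 1) / ‖x‖ ^ 2) • x)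
      rw [real_inner_smul_right, real_inner_self_eq_norm_sq, div_mul_cancel₀ _ hx0] at this
      linarith
  · have hl' : 0 < l := lt_of_le_of_ne hl (Ne.symm h0)
    funext x
    apply ereal_ext
    intro c
    have e : (l : EReal) * cs v (l⁻¹ • x) ≤ c ↔ cs v (l⁻¹ • x) ≤ ((c / l : ℝ) : EReal) := by
      rcases ereal_cases _ (cs_ne_bot v (l⁻¹ • x)) with h | ⟨s, h⟩
      · rw [h, EReal.coe_mul_top_of_pos hl']
        simp
      · rw [h, ← EReal.coe_mul, EReal.coe_le_coe_iff, EReal.coe_le_coe_iff, le_div_iff₀ hl', mul_comm]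
    rw [e, cs_le_iff, cs_le_iff]
    refine forall_congr' fun y => ?_
    simp only [Pi.smul_apply, smul_eq_mul, real_inner_smul_left]
    rw [le_div_iff₀ hl']
    have e2 : (l⁻¹ * inner ℝ x y - v y) * l = inner ℝ x y - l * v y := by
      field_simp
    rw [e2]

lemma split2 {a b : Vn n → ℝ} (ha : Cvx a) (hb : Cvx b) (z : Vn n) (c : ℝ)
    (h : ∀ y, inner ℝ z y - (a y + b y) ≤ c) :
    ∃ (f : Vn n) (e : ℝ), (∀ y, inner ℝ f y - a y ≤ e) ∧ ∀ y, inner ℝ (z - f) y - b y ≤ c - e := by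
  have hT : Convex ℝ {p : Vn n × ℝ | p.2 ≤ inner ℝ z p.1 - c - b p.1} := by
    rintro ⟨x, r⟩ hx ⟨y, s⟩ hy t t' ht ht' htt
    simp only [Set.mem_ofPred_eq, Prod.fst_add, Prod.snd_add, Prod.smul_fst, Prod.smul_snd, smul_eq_mul] at hx hy ⊢
    have := hb.2 (Set.mem_univ x) (Set.mem_univ y) ht ht' htt
    simp only [smul_eq_mul] at this
    rw [inner_add_right, real_inner_smul_right, real_inner_smul_right]
    have : c = t * c + t' * c := by rw [← add_mul, htt, one_mul]
    nlinarith [mul_le_mul_of_nonneg_left hx ht, mul_le_mul_of_nonneg_left hy ht']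
  obtain ⟨f, e, h1, h2⟩ := sandwich ha _ hT ⟨(0, inner ℝ z 0 - c - b 0), le_refl (inner ℝ z 0 - c - b 0)⟩
    (by
      rintro ⟨y, r⟩ hy
      simp only [Set.mem_ofPred_eq] at hy
      have := h y
      simp only
      linarith)
  refine ⟨f, e, fun y => by linarith [h1 y], fun y => ?_⟩
  have := h2 (y, inner ℝ z y - c - b y) (le_refl (inner ℝ z y - c - b y))
  simp only at this
  rw [inner_sub_left]
  linarith

lemma infConv_cs {a b : Vn n → ℝ} (ha : Cvx a) (hb : Cvx b) : infConv (cs a) (cs b) = cs (a + b) := by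
  funext z
  apply le_antisymm
  · apply EReal.le_of_forall_lt_iff_le.1
    intro c hc
    obtain ⟨f, e, h1, h2⟩ := split2 ha hb z c ((cs_le_iff _ _ _).1 hc.le)
    refine (iInf_le _ f).trans ?_
    refine (add_le_add ((cs_le_iff _ _ _).2 h1) ((cs_le_iff _ _ _).2 h2)).trans ?_
    rw [← EReal.coe_add, EReal.coe_le_coe_iff]
    linarith
  · refine le_iInf fun f => iSup_le fun y => ?_
    have e : inner ℝ z y - (a + b) y = (inner ℝ f y - a y) + (inner ℝ (z - f) y - b y) := by
      rw [inner_sub_left, Pi.add_apply]; ring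
    rw [e, EReal.coe_add]
    exact add_le_add (le_cs _ _ _) (le_cs _ _ _)

lemma Cvx.sum {k : ℕ} {v : Fin k → Vn n → ℝ} (hv : ∀ i, Cvx (v i)) : Cvx (∑ i, v i) := by
  induction k with
  | zero => simpa using Cvx.zero
  | succ k ih =>
    rw [Fin.sum_univ_succ]
    exact (hv 0).add (ih fun i => hv _)

lemma split_sum : ∀ (k : ℕ) (v : Fin k → Vn n → ℝ) (_ : ∀ i, Cvx (v i)) (z : Vn n) (c : ℝ),
    (∀ y, inner ℝ z y - (∑ i, v i) y ≤ c) → ∃ (f : Fin k → Vn n) (e : Fin k → ℝ),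
      ∑ i, f i = z ∧ (∀ i y, inner ℝ (f i) y - v i y ≤ e i) ∧ ∑ i, e i ≤ c := by
  intro k
  induction k with
  | zero =>
    intro v hv z c h
    refine ⟨fun _ => 0, fun _ => 0, ?_, fun i => i.elim0, ?_⟩
    · simp only [Finset.univ_eq_empty, Finset.sum_empty]
      by_contra hz
      have hx0 : ‖z‖ ^ 2 ≠ 0 := by
        have : z ≠ 0 := fun h => hz h.symm
        positivity
      have := h (((c + 1) / ‖z‖ ^ 2) • z)
      rw [real_inner_smul_right, real_inner_self_eq_norm_sq, div_mul_cancel₀ _ hx0] at this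
      simp at this
      linarith
    · have := h 0
      simpa using this
  | succ k ih =>
    intro v hv z c h
    obtain ⟨f, e, h1, h2⟩ := split2 (hv 0) (Cvx.sum fun i : Fin k => hv i.succ) z c
      (by intro y; have := h y; rw [Fin.sum_univ_succ] at this; exact this)
    obtain ⟨f', e', h3, h4, h5⟩ := ih (fun i => v i.succ) (fun i => hv _) (z - f) (c - e) h2
    refine ⟨Fin.cons f f', Fin.cons e e', ?_, ?_, ?_⟩
    · rw [Fin.sum_univ_succ]; simp [h3]
    · intro i
      refine Fin.cases ?_ (fun i => ?_) i
      · simpa using h1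
      · simpa using h4 i
    · rw [Fin.sum_univ_succ]; simp only [Fin.cons_zero, Fin.cons_succ]; linarith

lemma ereal_coe_sum {k : ℕ} (e : Fin k → ℝ) : ((∑ i, e i : ℝ) : EReal) = ∑ i, (e i : EReal) := by
  induction k with
  | zero => simp
  | succ k ih => rw [Fin.sum_univ_succ, Fin.sum_univ_succ, EReal.coe_add, ih]

lemma infConvFamily_cs {k : ℕ} {v : Fin k → Vn n → ℝ} (hv : ∀ i, Cvx (v i)) :
    infConvFamily (fun i => cs (v i)) = cs (∑ i, v i) := by
  funext z
  apply le_antisymm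
  · apply EReal.le_of_forall_lt_iff_le.1
    intro c hc
    obtain ⟨f, e, h1, h2, h3⟩ := split_sum k v hv z c ((cs_le_iff _ _ _).1 hc.le)
    refine (iInf₂_le f h1).trans ?_
    refine (Finset.sum_le_sum fun i _ => (cs_le_iff _ _ _).2 (h2 i)).trans ?_
    rw [← ereal_coe_sum, EReal.coe_le_coe_iff]
    exact h3
  · refine le_iInf₂ fun f hf => iSup_le fun y => ?_
    have e : inner ℝ z y - (∑ i, v i) y = ∑ i, (inner ℝ (f i) y - v i y) := by
      rw [Finset.sum_sub_distrib, ← sum_inner, hf, Finset.sum_apply]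
    rw [e, ereal_coe_sum]
    exact Finset.sum_le_sum fun i _ => le_cs _ _ _

end

section
variable {n : ℕ}

lemma cvx_upper {wk : ℕ → Vn n → ℝ} {w : Vn n → ℝ} (hk : ∀ k, Cvx (wk k))
    (hlim : ∀ y, Tendsto (fun k => wk k y) atTop (𝓝 (w y))) (y : Vn n) :
    ∃ r > 0, ∃ M : ℝ, ∀ᶠ k in atTop, ∀ z, ‖z - y‖ ≤ r → wk k z ≤ M := by
  obtain ⟨F, hF, -⟩ := Convex.exists_subset_interior_convexHull_finset_of_isCompact
    (s := {y}) (t := Set.univ) (convex_singleton y) isCompact_singleton Filter.univ_mem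
  have hy : y ∈ interior (convexHull ℝ (F : Set (Vn n))) := hF rfl
  obtain ⟨r, hr, hsub⟩ := Metric.nhds_basis_closedBall.mem_iff.1 (mem_interior_iff_mem_nhds.1 hy)
  obtain ⟨M, hM⟩ := (F.image w).exists_le
  refine ⟨r, hr, M + 1, ?_⟩
  have : ∀ᶠ k in atTop, ∀ f ∈ F, wk k f ≤ M + 1 := by
    rw [Filter.eventually_all_finset]
    intro f hf
    have h1 : w f < M + 1 := lt_of_le_of_lt (hM _ (Finset.mem_image_of_mem w hf)) (by linarith)
    filter_upwards [(hlim f).eventually_lt_const h1] with k hk using hk.le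
  filter_upwards [this] with k hkF z hz
  have hz' : z ∈ convexHull ℝ (F : Set (Vn n)) := hsub (by rwa [Metric.mem_closedBall, dist_eq_norm])
  obtain ⟨f, hf, hle⟩ := ConvexOn.exists_ge_of_mem_convexHull (hk k) (Set.subset_univ _) hz'
  exact hle.trans (hkF f hf)

lemma cvx_lower_loc {wk : ℕ → Vn n → ℝ} {w : Vn n → ℝ} (hk : ∀ k, Cvx (wk k))
    (hlim : ∀ y, Tendsto (fun k => wk k y) atTop (𝓝 (w y))) (y : Vn n) (δ : ℝ) (hδ : 0 < δ) :
    ∃ s > 0, ∀ᶠ k in atTop, ∀ z, ‖z - y‖ ≤ s → w y - δ ≤ wk k z := by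
  obtain ⟨r, hr, M, hM⟩ := cvx_upper hk hlim y
  set D := |M - w y| + 1 with hD
  have hD0 : 0 < D := by positivity
  set t := δ / (2 * D) with ht
  have ht0 : 0 < t := by positivity
  have htD : t * (M - w y) ≤ δ / 2 := by
    have h1 : t * (M - w y) ≤ t * D := mul_le_mul_of_nonneg_left (by linarith [le_abs_self (M - w y)]) ht0.le
    have h2 : t * D = δ / 2 := by rw [ht]; field_simp
    linarith
  refine ⟨t * r, by positivity, ?_⟩
  have hev : ∀ᶠ k in atTop, (1 + t) * w y - δ / 2 < (1 + t) * wk k y :=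
    ((hlim y).const_mul (1 + t)).eventually_const_lt (by linarith)
  filter_upwards [hM, hev] with k h1 h2 z hz
  have h3 := h1 (y + t⁻¹ • (y - z)) (by
    rw [add_sub_cancel_left, norm_smul, Real.norm_of_nonneg (by positivity), norm_sub_rev, inv_mul_le_iff₀ ht0]
    exact hz)
  have h4 := (hk k).2 (Set.mem_univ z) (Set.mem_univ (y + t⁻¹ • (y - z)))
    (by positivity : 0 ≤ 1 / (1 + t)) (by positivity : 0 ≤ t / (1 + t)) (by field_simp)
  have e : (1 / (1 + t)) • z + (t / (1 + t)) • (y + t⁻¹ • (y - z)) = y := by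
    have e1 : (t / (1 + t)) • (t⁻¹ • (y - z)) = (1 / (1 + t)) • (y - z) := by
      rw [smul_smul]; congr 1; field_simp
    have e2 : (1 / (1 + t)) • y + (t / (1 + t)) • y = y := by
      rw [← add_smul]
      have : 1 / (1 + t) + t / (1 + t) = 1 := by field_simp
      rw [this, one_smul]
    rw [smul_add, e1, smul_sub]
    conv_rhs => rw [← e2]
    abel
  rw [e, smul_eq_mul, smul_eq_mul] at h4
  have h5 : (1 + t) * wk k y ≤ wk k z + t * wk k (y + t⁻¹ • (y - z)) := by
    have := mul_le_mul_of_nonneg_left h4 (by positivity : 0 ≤ 1 + t)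
    calc _ ≤ _ := this
      _ = _ := by field_simp
  nlinarith [mul_le_mul_of_nonneg_left h3 ht0.le]

lemma cvx_lower_ball {wk : ℕ → Vn n → ℝ} {w : Vn n → ℝ} (hk : ∀ k, Cvx (wk k))
    (hlim : ∀ y, Tendsto (fun k => wk k y) atTop (𝓝 (w y))) (hw : ∀ y, 0 ≤ w y) (R δ : ℝ) (hδ : 0 < δ) :
    ∀ᶠ k in atTop, ∀ z ∈ Metric.closedBall (0 : Vn n) R, -δ ≤ wk k z := by
  refine IsCompact.induction_on (isCompact_closedBall (0 : Vn n) R)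
    (p := fun S => ∀ᶠ k in atTop, ∀ z ∈ S, -δ ≤ wk k z) ?_ ?_ ?_ ?_
  · exact Filter.Eventually.of_forall fun k z hz => absurd hz (Set.notMem_empty z)
  · intro s t hst h
    filter_upwards [h] with k hk z hz using hk z (hst hz)
  · intro s t h1 h2
    filter_upwards [h1, h2] with k h1 h2 z hz
    exact hz.elim (h1 z) (h2 z)
  · intro y _
    obtain ⟨s, hs, h⟩ := cvx_lower_loc hk hlim y δ hδ
    refine ⟨Metric.closedBall y s, mem_nhdsWithin_of_mem_nhds (Metric.closedBall_mem_nhds y hs), ?_⟩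
    filter_upwards [h] with k h z hz
    rw [Metric.mem_closedBall, dist_eq_norm] at hz
    linarith [h z hz, hw y]

lemma cvx_growth {wk : ℕ → Vn n → ℝ} {w : Vn n → ℝ} (hk : ∀ k, Cvx (wk k))
    (hlim : ∀ y, Tendsto (fun k => wk k y) atTop (𝓝 (w y))) (hw : ∀ y, 0 ≤ w y) (δ : ℝ) (hδ : 0 < δ) :
    ∀ᶠ k in atTop, ∀ y, -δ * ‖y‖ - δ ≤ wk k y := by
  set A := w 0 + 1 with hA
  have hA0 : 0 < A := by linarith [hw 0]
  set R := (δ + A) / δ with hR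
  have hR0 : 0 < R := by positivity
  have hRδ : R * δ = δ + A := by rw [hR]; field_simp
  filter_upwards [cvx_lower_ball hk hlim hw R δ hδ, (hlim 0).eventually_lt_const (by linarith : w 0 < A)]
    with k h1 h2 y
  have hn := norm_nonneg y
  rcases le_or_gt ‖y‖ R with h | h
  · have := h1 y (by simpa using h)
    nlinarith
  · have hy0 : 0 < ‖y‖ := hR0.trans h
    set τ := R / ‖y‖ with hτ
    have hτ0 : 0 < τ := by positivity
    have hτ1 : τ ≤ 1 := (div_le_one hy0).2 h.le
    have h3 := h1 (τ • y) (by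
      rw [mem_closedBall_zero_iff, norm_smul, Real.norm_of_nonneg hτ0.le, hτ, div_mul_cancel₀ _ hy0.ne'])
    have h4 := (hk k).2 (Set.mem_univ y) (Set.mem_univ (0 : Vn n)) hτ0.le (by linarith : 0 ≤ 1 - τ) (by ring)
    rw [smul_zero, add_zero, smul_eq_mul, smul_eq_mul] at h4
    have h5 : (1 - τ) * wk k 0 ≤ A := by
      rcases le_total (wk k 0) 0 with h0 | h0 <;> nlinarith
    have h6 : -(δ + A) ≤ τ * wk k y := by linarith
    have h7 : τ * ‖y‖ = R := by rw [hτ, div_mul_cancel₀ _ hy0.ne']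
    have h8 : τ * (-δ * ‖y‖) = -(δ + A) := by rw [← hRδ, ← h7]; ring
    have h9 : -δ * ‖y‖ ≤ wk k y := le_of_mul_le_mul_left (by linarith) hτ0
    linarith

lemma cvx_recover {wk : ℕ → Vn n → ℝ} {w : Vn n → ℝ} (hk : ∀ k, Cvx (wk k))
    (hlim : ∀ y, Tendsto (fun k => wk k y) atTop (𝓝 (w y))) (hw : ∀ y, 0 ≤ w y) (δ : ℝ) (hδ : 0 < δ) :
    ∀ᶠ k in atTop, ∃ x' : Vn n, ‖x'‖ ≤ δ ∧ ∀ y, inner ℝ x' y - wk k y ≤ δ := by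
  filter_upwards [cvx_growth hk hlim hw δ hδ] with k h
  have hT : Convex ℝ {p : Vn n × ℝ | p.2 ≤ -δ * ‖p.1‖ - δ} := by
    rintro ⟨x, r⟩ hx ⟨y, s⟩ hy t t' ht ht' htt
    simp only [Set.mem_ofPred_eq, Prod.fst_add, Prod.snd_add, Prod.smul_fst, Prod.smul_snd, smul_eq_mul] at hx hy ⊢
    have h1 : ‖t • x + t' • y‖ ≤ t * ‖x‖ + t' * ‖y‖ := by
      refine (norm_add_le _ _).trans ?_
      rw [norm_smul, norm_smul, Real.norm_of_nonneg ht, Real.norm_of_nonneg ht']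
    have : δ = t * δ + t' * δ := by rw [← add_mul, htt, one_mul]
    have h2 := mul_le_mul_of_nonneg_left h1 hδ.le
    have h3 := mul_le_mul_of_nonneg_left hx ht
    have h4 := mul_le_mul_of_nonneg_left hy ht'
    linarith
  obtain ⟨a, c, h1, h2⟩ := sandwich (hk k) _ hT ⟨(0, -δ * ‖(0 : Vn n)‖ - δ), le_refl (-δ * ‖(0 : Vn n)‖ - δ)⟩
    (fun p hp => le_trans hp (h p.1))
  have h3 : ∀ y, -δ * ‖y‖ - δ ≤ inner ℝ a y - c := fun y => h2 (y, -δ * ‖y‖ - δ) (le_refl (-δ * ‖y‖ - δ))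
  have hc : c ≤ δ := by
    have := h3 0
    simp at this
    linarith
  refine ⟨a, ?_, fun y => by linarith [h1 y]⟩
  by_contra hcon
  push Not at hcon
  have ha0 : 0 < ‖a‖ := hδ.trans hcon
  set t := (δ - c + 1) / (‖a‖ * (‖a‖ - δ)) with ht
  have hpos : 0 < ‖a‖ * (‖a‖ - δ) := mul_pos ha0 (by linarith)
  have ht0 : 0 ≤ t := div_nonneg (by linarith) hpos.le
  have := h3 (-t • a)
  rw [norm_smul, norm_neg, Real.norm_of_nonneg ht0, real_inner_smul_right, real_inner_self_eq_norm_sq] at this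
  have e : t * (‖a‖ * (‖a‖ - δ)) = δ - c + 1 := div_mul_cancel₀ _ hpos.ne'
  nlinarith

lemma diagonal {A : Type*} (a0 : A) (P : ℕ → ℕ → A → Prop) (hmono : ∀ i j, i ≤ j → ∀ k a, P j k a → P i k a)
    (h : ∀ j, ∀ᶠ k in atTop, ∃ a, P j k a) : ∃ a : ℕ → A, ∀ j, ∀ᶠ k in atTop, P j k (a k) := by
  classical
  refine ⟨fun k => if h : ∃ a, P (Nat.findGreatest (fun j => ∃ a, P j k a) k) k a then h.choose else a0, fun j => ?_⟩
  filter_upwards [h j, eventually_ge_atTop j] with k hk hjk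
  have h1 : ∃ a, P (Nat.findGreatest (fun j => ∃ a, P j k a) k) k a :=
    Nat.findGreatest_spec (P := fun j => ∃ a, P j k a) hjk hk
  rw [dif_pos h1]
  exact hmono _ _ (Nat.le_findGreatest hjk hk) _ _ h1.choose_spec

lemma cs_epi {vk : ℕ → Vn n → ℝ} {v : Vn n → ℝ} (hk : ∀ k, Cvx (vk k))
    (hlim : ∀ y, Tendsto (fun k => vk k y) atTop (𝓝 (v y))) : EpiConverges (fun k => cs (vk k)) (cs v) := by
  intro x
  have key : ∀ xk : ℕ → Vn n, Tendsto xk atTop (𝓝 x) →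
      cs v x ≤ liminf (fun k => cs (vk k) (xk k)) atTop := by
    intro xk hx
    refine iSup_le fun y => ?_
    have h1 : Tendsto (fun k => ((inner ℝ (xk k) y - vk k y : ℝ) : EReal)) atTop
        (𝓝 ((inner ℝ x y - v y : ℝ) : EReal)) :=
      (continuous_coe_real_ereal.tendsto _).comp ((hx.inner tendsto_const_nhds).sub (hlim y))
    rw [← h1.liminf_eq]
    exact liminf_le_liminf (Eventually.of_forall fun k => le_cs _ _ _)
  refine ⟨key, ?_⟩
  rcases ereal_cases _ (cs_ne_bot v x) with h | ⟨α, h⟩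
  · refine ⟨fun _ => x, tendsto_const_nhds, ?_⟩
    refine tendsto_of_le_liminf_of_limsup_le (key _ tendsto_const_nhds) ?_
    rw [h]; exact le_top
  · set w : Vn n → ℝ := v + fun y => inner ℝ (-x) y + α with hw
    have hrec := cvx_recover (wk := fun k => vk k + fun y => inner ℝ (-x) y + α) (w := w)
      (fun k => (hk k).add (IsAff.cvx ⟨-x, α, rfl⟩)) (fun y => (hlim y).add tendsto_const_nhds)
      (by
        intro y
        have := (cs_le_iff v x α).1 h.le y
        simp only [hw, Pi.add_apply, inner_neg_left]
        linarith)
    obtain ⟨a, ha⟩ := diagonal (0 : Vn n) (fun j k a => ‖a‖ ≤ 1 / ((j : ℝ) + 1) ∧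
        ∀ y, inner ℝ a y - (vk k + fun y => inner ℝ (-x) y + α) y ≤ 1 / ((j : ℝ) + 1))
      (by
        intro i j hij k a h
        have : 1 / ((j : ℝ) + 1) ≤ 1 / ((i : ℝ) + 1) := Nat.one_div_le_one_div hij
        exact ⟨h.1.trans this, fun y => (h.2 y).trans this⟩)
      (fun j => hrec _ Nat.one_div_pos_of_nat)
    have hax : Tendsto (fun k => x + a k) atTop (𝓝 x) := by
      have : Tendsto a atTop (𝓝 0) := by
        rw [NormedAddGroup.tendsto_nhds_zero]
        intro ε hε
        obtain ⟨j, hj⟩ := exists_nat_one_div_lt hε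
        filter_upwards [ha j] with k hk using lt_of_le_of_lt hk.1 hj
      simpa using tendsto_const_nhds.add this
    refine ⟨fun k => x + a k, hax, ?_⟩
    refine tendsto_of_le_liminf_of_limsup_le (key _ hax) ?_
    rw [h]
    apply EReal.le_of_forall_lt_iff_le.1
    intro c hc
    rw [EReal.coe_lt_coe_iff] at hc
    obtain ⟨j, hj⟩ := exists_nat_one_div_lt (sub_pos.2 hc)
    refine limsup_le_of_le (h := ?_)
    filter_upwards [ha j] with k hk
    rw [cs_le_iff]
    intro y
    have := hk.2 y
    simp only [Pi.add_apply, inner_neg_left] at this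
    rw [inner_add_left]
    linarith

end

section
variable {n : ℕ}

lemma epi_compact {uk : ℕ → Vn n → EReal} {u : Vn n → EReal} (he : EpiConverges uk u)
    {S : Set (Vn n)} (hS : IsCompact S) (y : Vn n) (K : ℝ)
    (h : ∀ z ∈ S, ((inner ℝ z y + K : ℝ) : EReal) < u z) :
    ∀ᶠ k in atTop, ∀ z ∈ S, ((inner ℝ z y + K : ℝ) : EReal) < uk k z := by
  by_contra hcon
  obtain ⟨φ, hφ, hbad⟩ := extraction_of_frequently_atTop (Filter.not_eventually.1 hcon)
  push Not at hbad
  choose zz hzS hzle using hbad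
  obtain ⟨z, hz, ψ, hψ, hlim⟩ := hS.tendsto_subseq hzS
  have hΦ : StrictMono (φ ∘ ψ) := hφ.comp hψ
  set zt : ℕ → Vn n := Function.extend (φ ∘ ψ) (zz ∘ ψ) (fun _ => z) with hzt
  have hztl : Tendsto zt atTop (𝓝 z) := by
    rw [Metric.tendsto_atTop] at hlim ⊢
    intro ε hε
    obtain ⟨J, hJ⟩ := hlim ε hε
    refine ⟨(φ ∘ ψ) J, fun k hk => ?_⟩
    by_cases hr : ∃ j, (φ ∘ ψ) j = k
    · obtain ⟨j, rfl⟩ := hr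
      rw [hzt, hΦ.injective.extend_apply]
      exact hJ j (hΦ.le_iff_le.1 hk)
    · rw [hzt, Function.extend_apply' _ _ _ hr]
      simpa using hε
  have h1 := (he z).1 zt hztl
  obtain ⟨c, hc1, hc2⟩ := EReal.lt_iff_exists_real_btwn.1 (h z hz)
  rw [EReal.coe_lt_coe_iff] at hc1
  have h2 := eventually_lt_of_lt_liminf (lt_of_lt_of_le hc2 h1)
  have h3 : ∀ᶠ k in atTop, inner ℝ (zt k) y + K < c :=
    ((hztl.inner tendsto_const_nhds).add tendsto_const_nhds).eventually_lt_const hc1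
  obtain ⟨j, hj2, hj3⟩ := (hΦ.tendsto_atTop.eventually (h2.and h3)).exists
  rw [hzt, hΦ.injective.extend_apply] at hj2 hj3
  have h4 := hzle (ψ j)
  have h5 := lt_of_lt_of_le hj2 h4
  rw [EReal.coe_lt_coe_iff] at h5
  simp only [Function.comp_apply] at hj3 h5
  linarith

lemma cj_lower {uk : ℕ → Vn n → EReal} {u : Vn n → EReal} (hk : ∀ k, uk k ∈ ConvSc n)
    (hu : u ∈ ConvSc n) (he : EpiConverges uk u) (y : Vn n) (ε : ℝ) (hε : 0 < ε) :
    ∀ᶠ k in atTop, cj u y - ε < cj (uk k) y := by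
  have h1 : ¬ cj u y ≤ cj u y - ε := by linarith
  rw [cj_spec hu] at h1
  push Not at h1
  obtain ⟨x, hx⟩ := h1
  obtain ⟨xk, hxk, hlim⟩ := (he x).2
  obtain ⟨c, hc1, hc2⟩ := EReal.lt_iff_exists_real_btwn.1 hx
  rw [EReal.coe_lt_coe_iff] at hc2
  have h3 : ∀ᶠ k in atTop, c < inner ℝ (xk k) y - (cj u y - ε) :=
    ((hxk.inner tendsto_const_nhds).sub tendsto_const_nhds).eventually_const_lt hc2
  filter_upwards [h3, hlim.eventually_lt_const hc1] with k h3 h4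
  have h5 := lt_of_le_of_lt (cj_le (hk k) (xk k) y) h4
  rw [EReal.coe_lt_coe_iff] at h5
  linarith

lemma cj_upper {uk : ℕ → Vn n → EReal} {u : Vn n → EReal} (hk : ∀ k, uk k ∈ ConvSc n)
    (hu : u ∈ ConvSc n) (he : EpiConverges uk u) (y : Vn n) (ε : ℝ) (hε : 0 < ε) :
    ∀ᶠ k in atTop, cj (uk k) y ≤ cj u y + ε := by
  set r := cj u y + ε with hr
  obtain ⟨p, hp⟩ := hu.1.2.2.2
  obtain ⟨s, hs⟩ : ∃ s : ℝ, u p = s := by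
    rcases ereal_cases _ (hu.1.2.2.1 p) with h | h
    · exact absurd h hp
    · exact h
  obtain ⟨pk, hpk, hplim⟩ := (he p).2
  rw [hs] at hplim
  set B := s - inner ℝ p y + 1 with hB
  set K := |B| + |r| with hK
  have hK0 : 0 ≤ K := by positivity
  obtain ⟨R0, hR0⟩ := hu.2 (‖y‖ + 1)
  set R := max R0 (K + 1) + ‖p‖ with hR
  have hRpos : 0 < R := by
    have := le_max_right R0 (K + 1)
    have := norm_nonneg p
    linarith
  have hout : ∀ z, R ≤ ‖z - p‖ → ((inner ℝ z y + K : ℝ) : EReal) < u z := by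
    intro z hz
    have h1 := norm_sub_le z p
    have h2 : max R0 (K + 1) ≤ ‖z‖ := by linarith
    have h3 := (le_max_left R0 (K + 1)).trans h2
    have h4 := (le_max_right R0 (K + 1)).trans h2
    refine lt_of_lt_of_le ?_ (hR0 z h3)
    rw [EReal.coe_lt_coe_iff]
    have := real_inner_le_norm z y
    nlinarith
  have E1 := epi_compact he (isCompact_closedBall p (2 * R)) y (-r) (by
    intro z _
    refine lt_of_lt_of_le ?_ (cj_le hu z y)
    rw [EReal.coe_lt_coe_iff]
    linarith)
  have hSc : IsCompact (Metric.closedBall p (2 * R) ∩ {z | R ≤ ‖z - p‖}) :=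
    (isCompact_closedBall p (2 * R)).inter_right (isClosed_le continuous_const (by fun_prop))
  have E2 := epi_compact he hSc y K (fun z hz => hout z hz.2)
  have E3 : ∀ᶠ k in atTop, ‖pk k - p‖ < R / 2 := by
    have : Tendsto (fun k => ‖pk k - p‖) atTop (𝓝 0) := tendsto_iff_norm_sub_tendsto_zero.1 hpk
    exact this.eventually_lt_const (by linarith)
  have E4 : ∀ᶠ k in atTop, uk k (pk k) < ((s + 1 / 2 : ℝ) : EReal) :=
    hplim.eventually_lt_const (EReal.coe_lt_coe_iff.2 (by linarith))
  have E5 : ∀ᶠ k in atTop, inner ℝ p y - 1 / 2 < inner ℝ (pk k) y :=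
    (hpk.inner tendsto_const_nhds).eventually_const_lt (by simp)
  filter_upwards [E1, E2, E3, E4, E5] with k h1 h2 h3 h4 h5
  rw [cj_spec (hk k)]
  intro x
  rcases le_or_gt ‖x - pk k‖ (3 * R / 2) with hx | hx
  · have : ‖x - p‖ ≤ 2 * R := by
      have := norm_add_le (x - pk k) (pk k - p)
      rw [sub_add_sub_cancel] at this
      linarith
    have := (h1 x (by rwa [Metric.mem_closedBall, dist_eq_norm])).le
    rwa [← sub_eq_add_neg] at this
  · rcases ereal_cases _ ((hk k).1.2.2.1 x) with ht | ⟨b, hb⟩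
    · rw [ht]; exact le_top
    · rw [hb, EReal.coe_le_coe_iff]
      obtain ⟨b', hb'⟩ : ∃ b' : ℝ, uk k (pk k) = b' := by
        rcases ereal_cases _ ((hk k).1.2.2.1 (pk k)) with h | h
        · rw [h] at h4; simp at h4
        · exact h
      rw [hb', EReal.coe_lt_coe_iff] at h4
      have hx0 : 0 < ‖x - pk k‖ := by linarith
      set τ := (3 * R / 2) / ‖x - pk k‖ with hτ
      have hτ0 : 0 < τ := by positivity
      have hτ1 : τ < 1 := (div_lt_one hx0).2 hx
      have hc := (hk k).1.1 x (pk k) τ hτ0 hτ1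
      set z := τ • x + (1 - τ) • pk k with hz
      have hzp : ‖z - pk k‖ = 3 * R / 2 := by
        have : z - pk k = τ • (x - pk k) := by rw [hz]; module
        rw [this, norm_smul, Real.norm_of_nonneg hτ0.le, hτ, div_mul_cancel₀ _ hx0.ne']
      have hz1 : ‖z - p‖ ≤ 2 * R := by
        have := norm_add_le (z - pk k) (pk k - p)
        rw [sub_add_sub_cancel] at this
        linarith
      have hz2 : R ≤ ‖z - p‖ := by
        have := norm_sub_le (z - p) (pk k - p)
        rw [sub_sub_sub_cancel_right] at this
        linarith
      have h6 := lt_of_lt_of_le (h2 z ⟨by rwa [Metric.mem_closedBall, dist_eq_norm], hz2⟩) hc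
      rw [hb, hb', ← EReal.coe_mul, ← EReal.coe_mul, ← EReal.coe_add, EReal.coe_lt_coe_iff, hz,
        inner_add_left, real_inner_smul_left, real_inner_smul_left] at h6
      set g := b - inner ℝ x y with hg
      set g' := b' - inner ℝ (pk k) y with hg'
      have h7 : K < τ * g + (1 - τ) * g' := by rw [hg, hg']; linarith
      have h8 : g' ≤ |B| := le_trans (by linarith) (le_abs_self B)
      have h9 : (1 - τ) * g' ≤ |B| := by
        have := abs_nonneg B
        rcases le_total g' 0 with h0 | h0 <;> nlinarith
      have h10 : |r| < τ * g := by linarith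
      have h11 : |r| ≤ g := by
        have := abs_nonneg r
        have hg0 : 0 < g := by
          by_contra hneg
          push Not at hneg
          nlinarith
        nlinarith
      have := neg_abs_le r
      linarith

lemma cj_tendsto {uk : ℕ → Vn n → EReal} {u : Vn n → EReal} (hk : ∀ k, uk k ∈ ConvSc n)
    (hu : u ∈ ConvSc n) (he : EpiConverges uk u) (y : Vn n) :
    Tendsto (fun k => cj (uk k) y) atTop (𝓝 (cj u y)) := by
  rw [Metric.tendsto_nhds]
  intro ε hε
  filter_upwards [cj_lower hk hu he y ε hε, cj_upper hk hu he y (ε / 2) (by linarith)] with k h1 h2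
  rw [Real.dist_eq, abs_lt]
  constructor <;> linarith

end

section
variable {n : ℕ}

lemma dualVal_of {m : ℕ} {Z : (Vn n → EReal) → ℝ}
    (hcont : ContinuousVal (ConvSc n) Z)
    (hval : IsValuation (ConvSc n) Z)
    (hinv : EpiTranslationInvariant (ConvSc n) Z)
    (hhom : EpiHomogeneous (ConvSc n) Z (m : ℝ)) : DualVal n m (fun v => Z (cs v)) where
  val a b ha hb hab := by
    have hab' : Cvx (a ⊔ b) := ConvexOn.sup ha hb
    have h := hval (cs a) (cs b) (cs_mem ha) (cs_mem hb)
      (by rw [← cs_inf]; exact cs_mem hab) (by rw [← cs_sup ha hb hab]; exact cs_mem hab')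
    rw [cs_sup ha hb hab, cs_inf, add_comm]
    exact h
  inv v p hv hp := by
    obtain ⟨a, c, rfl⟩ := hp
    rw [cs_translate]
    exact hinv _ (cs_mem hv) a (-c)
  cont vk v hk hv hlim := hcont _ _ (fun k => cs_mem (hk k)) (cs_mem hv) (cs_epi hk hlim)
  hom v hv l hl := by
    rw [← epiMul_cs l hl.le, hhom _ (cs_mem hv) l hl, Real.rpow_natCast]

lemma epiMul_eq {u : Vn n → EReal} (hu : u ∈ ConvSc n) {l : ℝ} (hl : 0 ≤ l) :
    epiMul l u = cs (l • cj u) := by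
  rw [← epiMul_cs l hl, cs_cj hu]

lemma cj_epiMul {u : Vn n → EReal} (hu : u ∈ ConvSc n) {l : ℝ} (hl : 0 ≤ l) :
    cj (epiMul l u) = l • cj u := by
  rw [epiMul_eq hu hl, cj_cs ((cj_cvx hu).smul hl)]

lemma map_getD {A B : Type*} (m : ℕ) (L : List A) (hL : L.length = m) (d : A) (f : A → B) :
    (List.finRange m).map (fun x : Fin m => f (L.getD (x : ℕ) d)) = L.map f := by
  apply List.ext_getElem
  · simp [hL]
  · intro i h1 h2
    simp at h1 h2
    simp [List.getD_eq_getElem?_getD, h2]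

lemma map_update {A B : Type*} {m : ℕ} (f : A → B) (w : Fin m → A) (j : Fin m) (X : A) :
    ((List.finRange m).map (fun x => f (Function.update w j X x))).Perm
      (f X :: ((List.finRange m).erase j).map (fun x => f (w x))) := by
  have h1 := (List.perm_cons_erase (List.mem_finRange j)).map (fun x => f (Function.update w j X x))
  refine h1.trans (List.Perm.of_eq ?_)
  rw [List.map_cons, Function.update_self]
  congr 1
  apply List.map_congr_left
  intro x hx
  have : x ≠ j := fun h => ((List.nodup_finRange m).not_mem_erase) (h ▸ hx)
  rw [Function.update_of_ne this]

lemma prod_if (m i : ℕ) (hi : i ≤ m) (l : ℝ) :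
    ((List.finRange m).map (fun x : Fin m => if (x : ℕ) < i then l else 1)).prod = l ^ i := by
  rw [← List.ofFn_eq_map, List.prod_ofFn, Finset.prod_ite, Finset.prod_const, Finset.prod_const_one,
    mul_one]
  congr 1
  rw [Fin.card_filter_val_lt]
  omega

end

section

/-- Template describing the diagonal restriction. -/
def tmpl {n : ℕ} (m i : ℕ) (rest : Fin (m - i) → Vn n → EReal) (x : Fin m) : Option (Vn n → ℝ) :=
  if h : (x : ℕ) < i then none else some (cj (rest ⟨(x : ℕ) - i, by have := x.isLt; omega⟩))

lemma cj_repConcat {n : ℕ} (m i : ℕ) (rest : Fin (m - i) → Vn n → EReal) (u : Vn n → EReal) (x : Fin m) :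
    cj (repConcat m i u rest x) = (tmpl m i rest x).getD (cj u) := by
  unfold repConcat tmpl
  split_ifs <;> rfl

lemma tmpl_cvx {n : ℕ} (m i : ℕ) (rest : Fin (m - i) → Vn n → EReal) (hrest : ∀ j, rest j ∈ ConvSc n)
    (x : Fin m) : ∀ r ∈ tmpl m i rest x, Cvx r := by
  intro r hr
  unfold tmpl at hr
  split_ifs at hr
  · simp at hr
  · simp at hr
    rw [← hr]
    exact cj_cvx (hrest _)

lemma tmpl_getD_cvx {n : ℕ} (m i : ℕ) (rest : Fin (m - i) → Vn n → EReal) (hrest : ∀ j, rest j ∈ ConvSc n)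
    (x : Fin m) (v : Vn n → ℝ) (hv : Cvx v) : Cvx ((tmpl m i rest x).getD v) := by
  have := tmpl_cvx m i rest hrest x
  rcases h : tmpl m i rest x with _ | r
  · exact hv
  · exact this r h

end

theorem polynomiality_sc (n : ℕ) (Z : (Vn n → EReal) → ℝ)
    (hcont : ContinuousVal (ConvSc n) Z)
    (hval : IsValuation (ConvSc n) Z)
    (hinv : EpiTranslationInvariant (ConvSc n) Z)
    (m : ℕ) (hm1 : 1 ≤ m) (hmn : m ≤ n)
    (hhom : EpiHomogeneous (ConvSc n) Z (m : ℝ)) :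
    ∃ Zb : (Fin m → Vn n → EReal) → ℝ,
      -- symmetry
      (∀ (σ : Equiv.Perm (Fin m)) (w : Fin m → Vn n → EReal),
        Zb (w ∘ σ) = Zb w) ∧
      -- polynomial expansion
      (∀ (k : ℕ) (u : Fin k → Vn n → EReal), (∀ i, u i ∈ ConvSc n) →
        ∀ l : Fin k → ℝ, (∀ i, 0 ≤ l i) →
          Z (infConvFamily fun i => epiMul (l i) (u i)) =
            ∑ d ∈ Finset.Nat.antidiagonalTuple k m,
              (Nat.multinomial Finset.univ d : ℝ) * (∏ i, l i ^ d i) *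
                Zb (repTuple k m d u)) ∧
      -- epi-additivity in each variable
      (∀ (w : Fin m → Vn n → EReal), (∀ j, w j ∈ ConvSc n) →
        ∀ (j : Fin m) (u u' : Vn n → EReal), u ∈ ConvSc n → u' ∈ ConvSc n →
          ∀ α β : ℝ, 0 < α → 0 < β →
            Zb (Function.update w j (infConv (epiMul α u) (epiMul β u'))) =
              α * Zb (Function.update w j u) + β * Zb (Function.update w j u')) ∧
      (∀ i : ℕ, 1 ≤ i → i ≤ m → ∀ rest : Fin (m - i) → Vn n → EReal,
        (∀ j, rest j ∈ ConvSc n) →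
          ContinuousVal (ConvSc n) (fun u => Zb (repConcat m i u rest)) ∧
          IsValuation (ConvSc n) (fun u => Zb (repConcat m i u rest)) ∧
          EpiTranslationInvariant (ConvSc n) (fun u => Zb (repConcat m i u rest)) ∧
          EpiHomogeneous (ConvSc n) (fun u => Zb (repConcat m i u rest)) (i : ℝ)) := by
  have hY := dualVal_of hcont hval hinv hhom
  set Y : (Vn n → ℝ) → ℝ := fun v => Z (cs v) with hYdef
  have hrw : ∀ (i : ℕ) (rest : Fin (m - i) → Vn n → EReal) (u : Vn n → EReal),
      (List.finRange m).map (fun x => cj (repConcat m i u rest x)) =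
      (List.finRange m).map (fun x => (tmpl m i rest x).getD (cj u)) := by
    intro i rest u
    simp only [cj_repConcat]
  refine ⟨fun w => DD Y ((List.finRange m).map (fun x => cj (w x))) 0 / (m.factorial : ℝ), ?_, ?_, ?_, ?_⟩
  · intro σ w
    simp only
    congr 1
    apply DD_perm
    have h1 : ((List.finRange m).map σ).Perm (List.finRange m) := σ.map_finRange_perm
    have h2 := h1.map (fun x => cj (w x))
    rwa [List.map_map] at h2
  · intro k u hu l hl
    have e1 : infConvFamily (fun i => epiMul (l i) (u i)) = cs (∑ i, l i • cj (u i)) := by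
      rw [← infConvFamily_cs fun i => (cj_cvx (hu i)).smul (hl i)]
      congr 1
      funext i
      exact epiMul_eq (hu i) (hl i)
    have e2 := Y_expand hY hm1 (fun i => cj (u i)) (fun i => cj_cvx (hu i)) l hl
    rw [e1]
    refine Eq.trans e2 (Finset.sum_congr rfl fun d hd => ?_)
    congr 2
    rw [Finset.Nat.mem_antidiagonalTuple] at hd
    unfold repTuple
    rw [map_getD m _ (by
      rw [List.length_flatMap]
      simp only [List.length_replicate]
      rw [← List.ofFn_eq_map, List.sum_ofFn, hd]) _ cj, List.map_flatMap]
    simp only [List.map_replicate]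
  · intro w hw j u u' hu hu' α β hα hβ
    have e1 : cj (infConv (epiMul α u) (epiMul β u')) = α • cj u + β • cj u' := by
      rw [epiMul_eq hu hα.le, epiMul_eq hu' hβ.le,
        infConv_cs ((cj_cvx hu).smul hα.le) ((cj_cvx hu').smul hβ.le),
        cj_cs (((cj_cvx hu).smul hα.le).add ((cj_cvx hu').smul hβ.le))]
    set t := ((List.finRange m).erase j).map (fun x => cj (w x)) with ht
    have htc : ∀ h ∈ t, Cvx h := by
      intro h hh
      obtain ⟨x, -, rfl⟩ := List.mem_map.1 hh
      exact cj_cvx (hw x)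
    have htl : t.length + 1 = m := by
      rw [ht, List.length_map, List.length_erase_of_mem (List.mem_finRange j), List.length_finRange]
      omega
    simp only
    rw [DD_perm (map_update cj w j _), DD_perm (map_update cj w j u), DD_perm (map_update cj w j u'),
      e1, ← ht, DD_add hY t htc htl _ _ ((cj_cvx hu).smul hα.le) ((cj_cvx hu').smul hβ.le),
      DD_smul hY t htc htl _ (cj_cvx hu) α hα.le, DD_smul hY t htc htl _ (cj_cvx hu') β hβ.le]
    ring
  · intro i hi1 him rest hrest
    refine ⟨?_, ?_, ?_, ?_⟩
    · intro uk u hk hu he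
      simp only [hrw]
      refine Tendsto.div_const ?_ _
      refine DD_tendsto hY (List.finRange m) (fun k x => (tmpl m i rest x).getD (cj (uk k)))
        (fun x => (tmpl m i rest x).getD (cj u))
        (fun k x => tmpl_getD_cvx m i rest hrest x _ (cj_cvx (hk k)))
        (fun x => tmpl_getD_cvx m i rest hrest x _ (cj_cvx hu)) ?_ (fun _ => 0) 0
        (fun _ => Cvx.zero) Cvx.zero (fun _ => tendsto_const_nhds)
      intro x y
      rcases h : tmpl m i rest x with _ | r
      · exact cj_tendsto hk hu he y
      · exact tendsto_const_nhds
    · intro u v hu hv h1 h2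
      simp only [hrw]
      have h := DD_val hY ((List.finRange m).map (tmpl m i rest)) (by
          intro o ho
          obtain ⟨x, -, rfl⟩ := List.mem_map.1 ho
          exact tmpl_cvx m i rest hrest x) (cj u) (cj v) (cj_cvx hu) (cj_cvx hv)
          (by rw [← cj_sup hu hv h1 h2]; exact cj_cvx h1)
          (by rw [← cj_inf hu hv h2]; exact cj_cvx h2) 0 0 Cvx.zero
      simp only [Nat.cast_zero, zero_smul, add_zero, List.map_map, Function.comp_def] at h
      rw [cj_sup hu hv h1 h2, cj_inf hu hv h2, ← add_div, ← add_div, ← h, add_comm]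
    · intro u hu x0 c
      simp only [hrw]
      have e : (fun x => u (x - x0) + (c : EReal)) = cs (cj u + fun y => inner ℝ x0 y + (-c)) := by
        rw [cs_translate, cs_cj hu, neg_neg]
      have hp : IsAff (fun y : Vn n => inner ℝ x0 y + (-c)) := ⟨x0, -c, rfl⟩
      rw [e, cj_cs ((cj_cvx hu).add hp.cvx)]
      have h := DD_aff hY (List.finRange m) (fun x => (tmpl m i rest x).getD (cj u))
        (fun x => if (tmpl m i rest x) = none then (fun y : Vn n => inner ℝ x0 y + (-c)) else 0)
        (fun x => tmpl_getD_cvx m i rest hrest x _ (cj_cvx hu))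
        (by intro x; split_ifs; exacts [hp, IsAff.zero]) 0 0 Cvx.zero IsAff.zero
      rw [add_zero] at h
      rw [← h]
      congr 3
      funext x
      rcases tmpl m i rest x with _ | r <;> simp
    · intro u hu l hl
      simp only [hrw]
      rw [cj_epiMul hu hl.le]
      have h := DD_prod hY (fun x : Fin m => if (x : ℕ) < i then l else 1)
        (fun x => (tmpl m i rest x).getD (cj u))
        (by intro x; split_ifs; exacts [hl.le, zero_le_one])
        (fun x => tmpl_getD_cvx m i rest hrest x _ (cj_cvx hu)) (List.finRange m) [] (by simp) (by simp)
      rw [List.append_nil, List.append_nil, prod_if m i him] at h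
      rw [Real.rpow_natCast, ← mul_div_assoc, ← h]
      congr 3
      funext x
      unfold tmpl
      split_ifs <;> simp
end
end
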